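/- (Theorem B.3, correlation bound against ANY∘{SYM,THR}∘AC^0 circuits.) There exist absolute constants τ > 0 and c > 0 with the following property: for every depth d ∈ ℕ there exists n₀ such that for all n ≥ n₀ of the form n = m(k+1)r with m = r and k = ⌊0.0005·log₂ m⌋, setting u = ⌊n^{0.249}⌋ and s = n^{τ·log₂ n}, every Boolean function F on {0,1}^n of the form F(x) = h(F_1(x),…,F_u(x)), where h : {0,1}^u → {0,1} is arbitrary and each F_i is computed by a circuit of size at most s whose top gate is SYM or THR fed by depth-d AC^0 circuits, satisfies Pr_{x ← uniform on {0,1}^n}[ F(x) = RW_{m,k,r}(x) ] ≤ 1/2 + exp(−c·n^{0.249}). -/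

import Mathlib

open Finset

/-! ### AC⁰ circuits: unbounded fan-in AND/OR gates over literals -/

inductive AC0 (ι : Type) : Type
  | lit : ι → Bool → AC0 ι
  | and : (a : ℕ) → (Fin a → AC0 ι) → AC0 ι
  | or  : (a : ℕ) → (Fin a → AC0 ι) → AC0 ι

namespace AC0

variable {ι : Type}

def eval : AC0 ι → (ι → Bool) → Bool
  | .lit i b, x => if b then x i else !(x i)
  | .and _ f, x => decide (∀ j, (f j).eval x = true)
  | .or _ f, x => decide (∃ j, (f j).eval x = true)

/-- Number of gates, literals included in the count. -/
def size : AC0 ι → ℕ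
  | .lit _ _ => 1
  | .and _ f => 1 + ∑ j, (f j).size
  | .or _ f => 1 + ∑ j, (f j).size

def depth : AC0 ι → ℕ
  | .lit _ _ => 0
  | .and _ f => 1 + Finset.univ.sup fun j => (f j).depth
  | .or _ f => 1 + Finset.univ.sup fun j => (f j).depth

end AC0

/-- `g` is an arbitrary symmetric Boolean function: it depends only on the
number of `true`s among its inputs. -/
def IsSymFun {a : ℕ} (g : (Fin a → Bool) → Bool) : Prop :=
  ∃ φ : ℕ → Bool, ∀ y, g y = φ (Finset.univ.filter fun i => y i = true).card

/-- `g` is an arbitrary linear threshold function: `g y = 1` iff `∑ wᵢ yᵢ ≥ θ`. -/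
def IsThrFun {a : ℕ} (g : (Fin a → Bool) → Bool) : Prop :=
  ∃ (w : Fin a → ℝ) (θ : ℝ), ∀ y, g y = decide (θ ≤ ∑ i, if y i = true then w i else 0)

/-- `F` is computed by a SYM∘AC⁰ circuit: a symmetric output gate fed by
AC⁰ circuits of depth at most `d`, with at most `S` gates in total
(the top gate and all gates of the feeding circuits, literals included). -/
def SymOnAC0 {ι : Type} (S : ℝ) (d : ℕ) (F : (ι → Bool) → Bool) : Prop :=
  ∃ (a : ℕ) (g : (Fin a → Bool) → Bool) (C : Fin a → AC0 ι),
    IsSymFun g ∧ (∀ i, (C i).depth ≤ d) ∧ (((1 + ∑ i, (C i).size : ℕ) : ℝ) ≤ S) ∧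
    ∀ x, F x = g fun i => (C i).eval x

/-- `F` is computed by a THR∘AC⁰ circuit, analogously. -/
def ThrOnAC0 {ι : Type} (S : ℝ) (d : ℕ) (F : (ι → Bool) → Bool) : Prop :=
  ∃ (a : ℕ) (g : (Fin a → Bool) → Bool) (C : Fin a → AC0 ι),
    IsThrFun g ∧ (∀ i, (C i).depth ≤ d) ∧ (((1 + ∑ i, (C i).size : ℕ) : ℝ) ≤ S) ∧
    ∀ x, F x = g fun i => (C i).eval x

/-! ### General circuits with AND/OR gates and arbitrary SYM/THR gates -/

inductive GenCircuit (ι : Type) : Type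
  | lit : ι → Bool → GenCircuit ι
  | and : (a : ℕ) → (Fin a → GenCircuit ι) → GenCircuit ι
  | or  : (a : ℕ) → (Fin a → GenCircuit ι) → GenCircuit ι
  | sym : (a : ℕ) → (ℕ → Bool) → (Fin a → GenCircuit ι) → GenCircuit ι
  | thr : (a : ℕ) → (Fin a → ℝ) → ℝ → (Fin a → GenCircuit ι) → GenCircuit ι

namespace GenCircuit

variable {ι : Type}

noncomputable def eval : GenCircuit ι → (ι → Bool) → Bool
  | .lit i b, x => if b then x i else !(x i)
  | .and _ f, x => decide (∀ j, (f j).eval x = true)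
  | .or _ f, x => decide (∃ j, (f j).eval x = true)
  | .sym _ φ f, x => φ (Finset.univ.filter fun j => (f j).eval x = true).card
  | .thr _ w θ f, x => decide (θ ≤ ∑ j, if (f j).eval x = true then w j else 0)

/-- Number of gates, literals included in the count. -/
def size : GenCircuit ι → ℕ
  | .lit _ _ => 1
  | .and _ f => 1 + ∑ j, (f j).size
  | .or _ f => 1 + ∑ j, (f j).size
  | .sym _ _ f => 1 + ∑ j, (f j).size
  | .thr _ _ _ f => 1 + ∑ j, (f j).size

def depth : GenCircuit ι → ℕ
  | .lit _ _ => 0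
  | .and _ f => 1 + Finset.univ.sup fun j => (f j).depth
  | .or _ f => 1 + Finset.univ.sup fun j => (f j).depth
  | .sym _ _ f => 1 + Finset.univ.sup fun j => (f j).depth
  | .thr _ _ _ f => 1 + Finset.univ.sup fun j => (f j).depth

/-- The number of SYM and THR gates in the circuit. -/
def symThrCount : GenCircuit ι → ℕ
  | .lit _ _ => 0
  | .and _ f => ∑ j, (f j).symThrCount
  | .or _ f => ∑ j, (f j).symThrCount
  | .sym _ _ f => 1 + ∑ j, (f j).symThrCount
  | .thr _ _ _ f => 1 + ∑ j, (f j).symThrCount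

end GenCircuit

/-! ### Restrictions and distributions -/

/-- Apply a restriction (`none` = `*` = free) to an input. -/
def applyR {ι : Type} (ρ : ι → Option Bool) (x : ι → Bool) : ι → Bool :=
  fun i => (ρ i).getD (x i)

/-- The restricted function `f↾ρ`. -/
def restrictF {ι : Type} (f : (ι → Bool) → Bool) (ρ : ι → Option Bool) :
    (ι → Bool) → Bool :=
  fun x => f (applyR ρ x)

def freeCount {ι : Type} [Fintype ι] (ρ : ι → Option Bool) : ℕ :=
  (Finset.univ.filter fun i => ρ i = none).card

open Classical in
/-- Probability of the event `P` under the (finitely supported) density `R`. -/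
noncomputable def prOf {α : Type} [Fintype α] (R : α → ℝ) (P : α → Prop) : ℝ :=
  ∑ a, if P a then R a else 0

/-- A density `R` on restrictions is a fair distribution: it is a probability
distribution, and drawing `ρ ← R` and filling in all `*`s with independent
uniform bits yields the uniform distribution on `{0,1}^n`. -/
def IsFair {ι : Type} [Fintype ι] [DecidableEq ι] (R : (ι → Option Bool) → ℝ) : Prop :=
  (∀ ρ, 0 ≤ R ρ) ∧ ((∑ ρ : ι → Option Bool, R ρ) = 1) ∧
  ∀ x : ι → Bool,
    (∑ ρ : ι → Option Bool, R ρ * if applyR ρ x = x then ((1 : ℝ) / 2) ^ freeCount ρ else 0)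
      = ((1 : ℝ) / 2) ^ Fintype.card ι

/-- The density of the random restriction `R_p`: each coordinate independently
is `*` with probability `p`, and `0` or `1` each with probability `(1-p)/2`. -/
noncomputable def RpDensity {ι : Type} [Fintype ι] (p : ℝ) (ρ : ι → Option Bool) : ℝ :=
  ∏ i, (ρ i).elim p (fun _ => (1 - p) / 2)

/-- The density of the random subset `L ⊆_q ι` (as an indicator function):
each element is included independently with probability `q`. -/
noncomputable def subsetDensity {ι : Type} [Fintype ι] (q : ℝ) (L : ι → Bool) : ℝ :=
  ∏ i, if L i then q else 1 - q

/-- The fraction of inputs on which `F` and `H` agree. -/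
noncomputable def agreePr {ι : Type} [Fintype ι] [DecidableEq ι]
    (F H : (ι → Bool) → Bool) : ℝ :=
  ((Finset.univ.filter fun x : ι → Bool => F x = H x).card : ℝ) / 2 ^ Fintype.card ι

/-- `G : {0,1}^t → {0,1}^ι` ε-fools the Boolean function `f`. -/
def Fools {ι : Type} [Fintype ι] [DecidableEq ι] {t : ℕ}
    (G : (Fin t → Bool) → (ι → Bool)) (f : (ι → Bool) → Bool) (ε : ℝ) : Prop :=
  |(∑ s : Fin t → Bool, if f (G s) = true then (1 : ℝ) else 0) / 2 ^ t
    - (∑ x : ι → Bool, if f x = true then (1 : ℝ) else 0) / 2 ^ Fintype.card ι| ≤ ε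

/-! ### Decision trees -/

inductive DTree (ι : Type) (α : Type) : Type
  | leaf : α → DTree ι α
  | node : ι → DTree ι α → DTree ι α → DTree ι α

namespace DTree

variable {ι α : Type}

def depth : DTree ι α → ℕ
  | .leaf _ => 0
  | .node _ t0 t1 => 1 + max t0.depth t1.depth

def evalWith (ev : α → (ι → Bool) → Bool) : DTree ι α → (ι → Bool) → Bool
  | .leaf a, x => ev a x
  | .node i t0 t1, x => if x i then t1.evalWith ev x else t0.evalWith ev x

def leaves : DTree ι α → List α
  | .leaf a => [a]
  | .node _ t0 t1 => t0.leaves ++ t1.leaves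

end DTree

/-- Evaluation of an ordinary decision tree with Boolean leaves. -/
def evalDT {ι : Type} (T : DTree ι Bool) (x : ι → Bool) : Bool :=
  T.evalWith (fun b _ => b) x

/-- `F` is computed by a `(t, C)`-decision tree: a depth-`t` decision tree
whose leaves are labeled by functions from the class `C`. -/
def ComputedByClassDT {ι : Type} (t : ℕ) (C : ((ι → Bool) → Bool) → Prop)
    (F : (ι → Bool) → Bool) : Prop :=
  ∃ T : DTree ι ((ι → Bool) → Bool), T.depth ≤ t ∧ (∀ g ∈ T.leaves, C g) ∧
    ∀ x, F x = T.evalWith (fun g => g) x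

/-! ### SYM∘AND and THR∘AND circuits -/

/-- `F` is computed by a SYM∘AND circuit with at most `S` bottom AND gates
(terms), each a conjunction of at most `kb` literals. -/
def IsSymAnd {ι : Type} (S kb : ℝ) (F : (ι → Bool) → Bool) : Prop :=
  ∃ (a : ℕ) (g : (Fin a → Bool) → Bool) (T : Fin a → List (ι × Bool)),
    IsSymFun g ∧ ((a : ℝ) ≤ S) ∧ (∀ i, ((T i).length : ℝ) ≤ kb) ∧
    ∀ x, F x = g fun i => (T i).all fun l => x l.1 == l.2

/-- `F` is computed by a THR∘AND circuit, analogously. -/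
def IsThrAnd {ι : Type} (S kb : ℝ) (F : (ι → Bool) → Bool) : Prop :=
  ∃ (a : ℕ) (g : (Fin a → Bool) → Bool) (T : Fin a → List (ι × Bool)),
    IsThrFun g ∧ ((a : ℝ) ≤ S) ∧ (∀ i, ((T i).length : ℝ) ≤ kb) ∧
    ∀ x, F x = g fun i => (T i).all fun l => x l.1 == l.2

/-! ### The Razborov–Wigderson and generalized inner product functions -/

/-- Parity (XOR) of a finite family of bits. -/
def bparity {α : Type} [Fintype α] (f : α → Bool) : Bool :=
  decide ((Finset.univ.filter fun a => f a = true).card % 2 = 1)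

/-- `RW_{m,k,r}(x) = ⊕_{i∈[m]} ⋀_{j∈[k+1]} ⊕_{ℓ∈[r]} x_{i,j,ℓ}`. -/
def RW (m k r : ℕ) (x : Fin m × Fin (k + 1) × Fin r → Bool) : Bool :=
  bparity fun i : Fin m =>
    decide (∀ j : Fin (k + 1), bparity (fun ℓ : Fin r => x (i, j, ℓ)) = true)

/-- `GIP_{m',k'}(x) = ⊕_{i∈[m']} ⋀_{j∈[k']} x_{i,j}`. -/
def GIP (m' k' : ℕ) (x : Fin m' × Fin k' → Bool) : Bool :=
  bparity fun i : Fin m' => decide (∀ j : Fin k', x (i, j) = true)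

/-- `g` contains a perfect copy of `GIP_{m',k'}`: there is a restriction `κ`
whose free variables are exactly the range of an injection `e` from the GIP
index set, and bits `b`, `bb i j`, such that `g↾κ` is the corresponding
shifted/negated copy of GIP. -/
def ContainsGIP {ι : Type} (m' k' : ℕ) (g : (ι → Bool) → Bool) : Prop :=
  ∃ (κ : ι → Option Bool) (e : Fin m' × Fin k' → ι) (b : Bool)
    (bb : Fin m' × Fin k' → Bool),
    Function.Injective e ∧ (∀ v, κ v = none ↔ v ∈ Set.range e) ∧
    ∀ x : ι → Bool,
      g (applyR κ x) =
        xor b (bparity fun i : Fin m' =>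
          decide (∀ j : Fin k', xor (bb (i, j)) (x (e (i, j))) = true))

/-- `g` contains a perfect copy of `RW_{m',k',r'}`, analogously. -/
def ContainsRW {ι : Type} (m' k' r' : ℕ) (g : (ι → Bool) → Bool) : Prop :=
  ∃ (κ : ι → Option Bool) (e : Fin m' × Fin (k' + 1) × Fin r' → ι) (b : Bool)
    (bb : Fin m' × Fin (k' + 1) → Bool),
    Function.Injective e ∧ (∀ v, κ v = none ↔ v ∈ Set.range e) ∧
    ∀ x : ι → Bool,
      g (applyR κ x) =
        xor b (bparity fun i : Fin m' =>
          decide (∀ j : Fin (k' + 1),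
            xor (bb (i, j)) (bparity fun ℓ : Fin r' => x (e (i, j, ℓ))) = true))

set_option linter.unusedSectionVars false

/-! ### Part 1: restrictions, the canonical process and its weight bound -/

namespace CB

open Classical in
/-- override: `σ` has priority over `ρ` -/
def ov {ι : Type} (σ ρ : ι → Option Bool) : ι → Option Bool := fun i => (σ i).or (ρ i)

/-- the empty restriction -/
def emp {ι : Type} : ι → Option Bool := fun _ => none

/-- `ρ'` refines `ρ` -/
def Refines {ι : Type} (ρ ρ' : ι → Option Bool) : Prop := ∀ i b, ρ i = some b → ρ' i = some b

/-- the term `T` is falsified by `ρ` -/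
def Fals {ι : Type} (T ρ : ι → Option Bool) : Prop := ∃ i b, T i = some b ∧ ρ i = some (!b)

section
variable {ι : Type} [Fintype ι] [DecidableEq ι]

/-- the assignment `α` on `J` -/
def asg (J : Finset ι) (α : ι → Bool) : ι → Option Bool :=
  fun i => if i ∈ J then some (α i) else none

def supp (T : ι → Option Bool) : Finset ι := univ.filter fun i => T i ≠ none

/-- variables of the term `T` left free by `ρ` -/
def stars (T ρ : ι → Option Bool) : Finset ι := univ.filter fun i => T i ≠ none ∧ ρ i = none

open Classical in
noncomputable def first (L : List (ι → Option Bool)) (ρ : ι → Option Bool) :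
    Option (ι → Option Bool) := L.find? (fun T => decide (¬ Fals T ρ))

noncomputable def live (L : List (ι → Option Bool)) (ρ : ι → Option Bool) : Finset ι :=
  match first L ρ with
  | none => ∅
  | some T => stars T ρ

noncomputable def avg (g : (ι → Bool) → ℝ) : ℝ := (∑ x, g x) / 2 ^ Fintype.card ι

theorem avg_mono {g h : (ι → Bool) → ℝ} (H : ∀ x, g x ≤ h x) : avg g ≤ avg h := by
  unfold avg
  gcongr
  exact H _

theorem avg_const (c : ℝ) : avg (fun _ : ι → Bool => c) = c := by
  unfold avg
  simp

theorem avg_nonneg {g : (ι → Bool) → ℝ} (H : ∀ x, 0 ≤ g x) : 0 ≤ avg g := by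
  have := avg_mono H
  rwa [avg_const] at this

theorem abs_avg_le (g : (ι → Bool) → ℝ) : |avg g| ≤ avg fun x => |g x| := by
  unfold avg
  rw [abs_div, abs_of_pos (by positivity : (0:ℝ) < 2 ^ Fintype.card ι)]
  gcongr
  exact Finset.abs_sum_le_sum_abs _ _

theorem avg_add (g h : (ι → Bool) → ℝ) : avg (fun x => g x + h x) = avg g + avg h := by
  unfold avg
  rw [Finset.sum_add_distrib, add_div]

theorem avg_add_const (g : (ι → Bool) → ℝ) (c : ℝ) : avg (fun x => g x + c) = avg g + c := by
  rw [avg_add, avg_const]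

theorem avg_sum {κ : Type} (s : Finset κ) (g : κ → (ι → Bool) → ℝ) :
    avg (fun x => ∑ k ∈ s, g k x) = ∑ k ∈ s, avg (g k) := by
  unfold avg
  rw [Finset.sum_comm, Finset.sum_div]

theorem avg_mul_left (c : ℝ) (g : (ι → Bool) → ℝ) : avg (fun x => c * g x) = c * avg g := by
  unfold avg
  rw [← Finset.mul_sum, mul_div_assoc]

/-- if something is true on average it is attained -/
theorem le_avg_of_mem {g : (ι → Bool) → ℝ} (H : ∀ x, 0 ≤ g x) (J : Finset ι)
    (hg : ∀ x y, (∀ i ∈ J, x i = y i) → g x = g y) (a : ι → Bool) :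
    g a ≤ 2 ^ J.card * avg g := by
  unfold avg
  have h1 : ∑ x ∈ univ.filter (fun x : ι → Bool => ∀ i ∈ J, x i = a i), g x ≤ ∑ x, g x :=
    Finset.sum_le_sum_of_subset_of_nonneg (Finset.filter_subset _ _) (fun x _ _ => H x)
  have h2 : ∑ x ∈ univ.filter (fun x : ι → Bool => ∀ i ∈ J, x i = a i), g x
      = (univ.filter (fun x : ι → Bool => ∀ i ∈ J, x i = a i)).card * g a := by
    rw [← nsmul_eq_mul, ← Finset.sum_const]
    apply Finset.sum_congr rfl
    intro x hx
    exact hg _ _ (by simpa using hx)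
  have h3 : (univ.filter (fun x : ι → Bool => ∀ i ∈ J, x i = a i)).card
      = 2 ^ (Fintype.card ι - J.card) := by
    have : (univ.filter (fun x : ι → Bool => ∀ i ∈ J, x i = a i))
        = Fintype.piFinset (fun i => if i ∈ J then {a i} else univ) := by
      ext x
      simp only [mem_filter, mem_univ, true_and, Fintype.mem_piFinset]
      apply forall_congr'
      intro i
      by_cases hi : i ∈ J <;> simp [hi]
    rw [this, Fintype.card_piFinset]
    have : ∀ i, (if i ∈ J then ({a i} : Finset Bool) else univ).card = if i ∈ J then 1 else 2 := by
      intro i; by_cases hi : i ∈ J <;> simp [hi]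
    simp_rw [this]
    rw [Finset.prod_ite]
    simp only [prod_const_one, prod_const, one_mul]
    congr 1
    rw [Finset.filter_not, Finset.card_sdiff_of_subset (Finset.filter_subset _ _)]
    simp
  rw [h2, h3] at h1
  have hJ : J.card ≤ Fintype.card ι := Finset.card_le_univ J
  have e : (2:ℝ) ^ Fintype.card ι = 2 ^ J.card * 2 ^ (Fintype.card ι - J.card) := by
    rw [← pow_add]; congr 1; omega
  push_cast at h1
  rw [e, mul_div_assoc', mul_div_mul_left _ _ (by positivity), le_div_iff₀ (by positivity)]
  linarith

/-- The canonical process functional. -/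
noncomputable def V (L : List (ι → Option Bool)) (Ψ : (ι → Option Bool) → ℝ) (N : ℕ)
    (π σ ρ : ι → Option Bool) : ℝ :=
  if hN : N = 0 then Ψ (ov σ ρ) else
  if hJ : (live L (ov π ρ)).card = 0 then 0 else
    2 ^ (live L (ov π ρ)).card * avg fun α => avg fun γ =>
      V L Ψ (N - (live L (ov π ρ)).card) (ov (asg (live L (ov π ρ)) α) π)
        (ov (asg (live L (ov π ρ)) γ) σ) ρ
termination_by N
decreasing_by omega

theorem V_zero (L : List (ι → Option Bool)) (Ψ : (ι → Option Bool) → ℝ)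
    (π σ ρ : ι → Option Bool) : V L Ψ 0 π σ ρ = Ψ (ov σ ρ) := by
  rw [V]; simp

theorem V_stuck (L : List (ι → Option Bool)) (Ψ : (ι → Option Bool) → ℝ) {N : ℕ} (hN : N ≠ 0)
    (π σ ρ : ι → Option Bool) (hJ : (live L (ov π ρ)).card = 0) : V L Ψ N π σ ρ = 0 := by
  rw [V]; simp [hN, hJ]

theorem V_step (L : List (ι → Option Bool)) (Ψ : (ι → Option Bool) → ℝ) {N : ℕ} (hN : N ≠ 0)
    (π σ ρ : ι → Option Bool) (J : Finset ι) (h : live L (ov π ρ) = J) (hJ : J.card ≠ 0) :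
    V L Ψ N π σ ρ = 2 ^ J.card * avg fun α => avg fun γ =>
      V L Ψ (N - J.card) (ov (asg J α) π) (ov (asg J γ) σ) ρ := by
  rw [V]; simp [hN, h, hJ]

theorem V_nonneg (L : List (ι → Option Bool)) {Ψ : (ι → Option Bool) → ℝ} (hΨ : ∀ ρ, 0 ≤ Ψ ρ)
    (N : ℕ) (π σ ρ : ι → Option Bool) : 0 ≤ V L Ψ N π σ ρ := by
  induction N using Nat.strong_induction_on generalizing π σ with
  | _ N ih =>
    by_cases hN : N = 0
    · subst hN; rw [V_zero]; exact hΨ _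
    by_cases hJ : (live L (ov π ρ)).card = 0
    · rw [V_stuck L Ψ hN _ _ _ hJ]
    · rw [V_step L Ψ hN _ _ _ _ rfl hJ]
      apply mul_nonneg (by positivity)
      apply avg_nonneg; intro α
      apply avg_nonneg; intro γ
      exact ih _ (by omega) _ _

theorem ov_assoc (a b c : ι → Option Bool) : ov (ov a b) c = ov a (ov b c) := by
  funext i; simp [ov, Option.or_assoc]

/-- `V` only depends on the composed restrictions. -/
theorem V_congr (L : List (ι → Option Bool)) (Ψ : (ι → Option Bool) → ℝ)
    (N : ℕ) (π σ ρ π' σ' ρ' : ι → Option Bool) (h1 : ov π ρ = ov π' ρ') (h2 : ov σ ρ = ov σ' ρ') :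
    V L Ψ N π σ ρ = V L Ψ N π' σ' ρ' := by
  induction N using Nat.strong_induction_on generalizing π σ π' σ' with
  | _ N ih =>
    by_cases hN : N = 0
    · subst hN; rw [V_zero, V_zero, h2]
    by_cases hJ : (live L (ov π ρ)).card = 0
    · rw [V_stuck L Ψ hN _ _ _ hJ, V_stuck L Ψ hN _ _ _ (by rw [← h1]; exact hJ)]
    · rw [V_step L Ψ hN _ _ _ _ rfl hJ, V_step L Ψ hN π' σ' ρ' (live L (ov π ρ)) (by rw [h1]) hJ]
      congr 2; funext α; congr 1; funext γ
      apply ih _ (by omega)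
      · rw [ov_assoc, ov_assoc, h1]
      · rw [ov_assoc, ov_assoc, h2]

theorem first_mem {L : List (ι → Option Bool)} {ρ T : ι → Option Bool} (h : first L ρ = some T) :
    T ∈ L := by
  unfold first at h
  exact List.mem_of_find?_eq_some h

theorem first_not_fals {L : List (ι → Option Bool)} {ρ T : ι → Option Bool}
    (h : first L ρ = some T) : ¬ Fals T ρ := by
  unfold first at h
  have := List.find?_some h
  simpa using this

theorem fals_mono {T ρ ρ' : ι → Option Bool} (h : Refines ρ ρ') (hf : Fals T ρ) : Fals T ρ' := by
  obtain ⟨i, b, h1, h2⟩ := hf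
  exact ⟨i, b, h1, h _ _ h2⟩

theorem first_refine {L : List (ι → Option Bool)} {ρ ρ' T : ι → Option Bool}
    (h : first L ρ = some T) (hr : Refines ρ ρ') (hT : ¬ Fals T ρ') : first L ρ' = some T := by
  unfold first at *
  rw [List.find?_eq_some_iff_append] at *
  obtain ⟨_, as, bs, hL, has⟩ := h
  refine ⟨by simpa using hT, as, bs, hL, ?_⟩
  intro a ha
  have := has a ha
  have h2 : Fals a ρ := by simpa using this
  simpa using fals_mono hr h2

theorem refines_ov {ρ ρ' : ι → Option Bool} (π : ι → Option Bool) (h : Refines ρ ρ') :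
    Refines (ov π ρ) (ov π ρ') := by
  intro i b hb
  unfold ov at *
  cases hp : π i with
  | none => simp only [hp, Option.none_or] at *; exact h _ _ hb
  | some c => simp only [hp, Option.some_or] at *; exact hb

/-- families closed under refinement -/
def Closed (F : Finset (ι → Option Bool)) : Prop := ∀ ρ ∈ F, ∀ ρ', Refines ρ ρ' → ρ' ∈ F

/-- the functional `Ψ` has weight at most `M` on each closed family -/
def Bdd (p : ℝ) (Ψ : (ι → Option Bool) → ℝ) (M : ℝ) : Prop :=
  ∀ σ, ∀ F : Finset (ι → Option Bool), Closed F →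
    ∑ ρ ∈ F, RpDensity p ρ * Ψ (ov σ ρ) ≤ M * ∑ ρ ∈ F, RpDensity p ρ

theorem Rp_nonneg {p : ℝ} (hp : 0 ≤ p) (hp1 : p ≤ 1) (ρ : ι → Option Bool) :
    0 ≤ RpDensity p ρ := by
  unfold RpDensity
  apply Finset.prod_nonneg
  intro i _
  cases ρ i with
  | none => simpa using hp
  | some b => simp only [Option.elim]; linarith

theorem Rp_sum (p : ℝ) : ∑ ρ : ι → Option Bool, RpDensity p ρ = 1 := by
  unfold RpDensity
  rw [← Fintype.prod_sum (fun (_ : ι) (o : Option Bool) => o.elim p (fun _ => (1 - p) / 2))]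
  have : (p + 2 * ((1 - p) / 2)) = 1 := by ring
  simp [Fintype.sum_option, this]

/-- erase the values on `J` -/
def era (J : Finset ι) (ρ : ι → Option Bool) : ι → Option Bool :=
  fun i => if i ∈ J then none else ρ i

/-- restrict the term `T` to `J` -/
def rest (J : Finset ι) (T : ι → Option Bool) : ι → Option Bool :=
  fun i => if i ∈ J then T i else none

theorem Rp_ratio {p : ℝ} (hp1 : p < 1) (J : Finset ι) (T ρ : ι → Option Bool)
    (h1 : ∀ i ∈ J, ρ i = none) (h2 : ∀ i ∈ J, T i ≠ none) :
    RpDensity p ρ = (2 * p / (1 - p)) ^ J.card * RpDensity p (ov (rest J T) ρ) := by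
  unfold RpDensity
  rw [← Finset.prod_mul_prod_compl J, ← Finset.prod_mul_prod_compl J
    (fun i => ((ov (rest J T) ρ) i).elim p (fun _ => (1 - p) / 2)), ← mul_assoc]
  congr 1
  · rw [Finset.prod_congr rfl (g := fun _ => p), Finset.prod_congr (s₁ := J) rfl
      (f := fun i => ((ov (rest J T) ρ) i).elim p (fun _ => (1 - p) / 2))
      (g := fun _ => (1 - p) / 2)]
    · rw [prod_const, prod_const, ← mul_pow]
      congr 1
      have : (1 - p) ≠ 0 := by linarith
      field_simp
    · intro i hi
      have := h2 i hi
      cases hT : T i with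
      | none => exact absurd hT this
      | some b => simp [ov, rest, hi, hT]
    · intro i hi
      simp [h1 i hi]
  · apply Finset.prod_congr rfl
    intro i hi
    have : i ∉ J := by simpa using hi
    simp [ov, rest, this]

theorem live_some {L : List (ι → Option Bool)} {ρ T : ι → Option Bool} (h : first L ρ = some T) :
    live L ρ = stars T ρ := by
  unfold live; rw [h]

theorem live_none {L : List (ι → Option Bool)} {ρ : ι → Option Bool} (h : first L ρ = none) :
    live L ρ = ∅ := by
  unfold live; rw [h]

end
end CB

set_option linter.unusedSectionVars false

namespace CB
section
variable {ι : Type} [Fintype ι] [DecidableEq ι]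

open Classical in
theorem fiber_bound {p li M : ℝ} (hp : 0 < p) (hp1 : p < 1) (L : List (ι → Option Bool))
    {Ψ : (ι → Option Bool) → ℝ} (hΨ : ∀ ρ, 0 ≤ Ψ ρ) (N : ℕ) (hN : N ≠ 0)
    (hM : 0 ≤ M) (hli : 0 ≤ li)
    (ih : ∀ N' < N, ∀ (π σ : ι → Option Bool) (F : Finset (ι → Option Bool)), Closed F →
      ∑ ρ ∈ F, RpDensity p ρ * V L Ψ N' π σ ρ ≤ li ^ N' * M * ∑ ρ ∈ F, RpDensity p ρ)
    (π σ : ι → Option Bool) (F : Finset (ι → Option Bool)) (hF : Closed F)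
    (T : ι → Option Bool) (J : Finset ι) (hJ : J.card ≠ 0) :
    ∑ ρ ∈ F.filter (fun ρ => first L (ov π ρ) = some T ∧ stars T (ov π ρ) = J),
      RpDensity p ρ * V L Ψ N π σ ρ ≤
    (4 * p / (1 - p)) ^ J.card * li ^ (N - J.card) * M *
      ∑ ρ ∈ F.filter (fun ρ => first L (ov π ρ) = some T ∧ stars T (ov π ρ) = ∅),
        RpDensity p ρ := by
  set G := F.filter (fun ρ => first L (ov π ρ) = some T ∧ stars T (ov π ρ) = J) with hG
  set H := F.filter (fun ρ => first L (ov π ρ) = some T ∧ stars T (ov π ρ) = ∅) with hH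
  set φ : (ι → Option Bool) → (ι → Option Bool) := fun ρ => ov (rest J T) ρ with hφ
  set Q : (ι → Option Bool) → ℝ := fun ρ => avg fun α => avg fun γ =>
      V L Ψ (N - J.card) (ov (asg J α) π) (ov (asg J γ) σ) ρ with hQ
  have hQ0 : ∀ ρ, 0 ≤ Q ρ := fun ρ => avg_nonneg fun α => avg_nonneg fun γ => V_nonneg L hΨ _ _ _ _
  have hR0 : ∀ ρ : ι → Option Bool, 0 ≤ RpDensity p ρ := fun ρ => Rp_nonneg hp.le hp1.le ρ
  set F' := H.filter (fun ρ => era J ρ ∈ F) with hF'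
  have key : ∀ ρ ∈ G, ∀ i ∈ J, T i ≠ none ∧ π i = none ∧ ρ i = none := by
    intro ρ hρ i hi
    rw [hG, mem_filter] at hρ
    rw [← hρ.2.2] at hi
    simp only [stars, mem_filter, mem_univ, true_and, ov, Option.or_eq_none_iff] at hi
    exact ⟨hi.1, hi.2.1, hi.2.2⟩
  have hera : ∀ ρ ∈ G, era J (φ ρ) = ρ := by
    intro ρ hρ
    funext i
    by_cases hi : i ∈ J
    · simp [era, hi, (key ρ hρ i hi).2.2]
    · simp [era, hi, hφ, ov, rest]
  have hterm : ∀ ρ ∈ G, RpDensity p ρ * V L Ψ N π σ ρ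
      = (4 * p / (1 - p)) ^ J.card * (RpDensity p (φ ρ) * Q (φ ρ)) := by
    intro ρ hρ
    have hρ' := hρ
    rw [hG, mem_filter] at hρ'
    rw [V_step L Ψ hN π σ ρ J (by rw [live_some hρ'.2.1]; exact hρ'.2.2) hJ,
      Rp_ratio hp1 J T ρ (fun i hi => (key ρ hρ i hi).2.2) (fun i hi => (key ρ hρ i hi).1)]
    have hQe : (avg fun α => avg fun γ =>
      V L Ψ (N - J.card) (ov (asg J α) π) (ov (asg J γ) σ) ρ) = Q (φ ρ) := by
      rw [hQ]
      congr 1; funext α; congr 1; funext γ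
      apply V_congr
      · funext i
        by_cases hi : i ∈ J <;> simp [ov, asg, hi, hφ, rest]
      · funext i
        by_cases hi : i ∈ J <;> simp [ov, asg, hi, hφ, rest]
    rw [hQe]
    have : (4 * p / (1 - p)) = (2 * p / (1 - p)) * 2 := by ring
    rw [this, mul_pow]
    ring
  have hmem : ∀ ρ ∈ G, φ ρ ∈ F' := by
    intro ρ hρ
    have hρ' := hρ
    rw [hG, mem_filter] at hρ'
    have href : Refines ρ (φ ρ) := by
      intro i b hb
      by_cases hi : i ∈ J
      · rw [(key ρ hρ i hi).2.2] at hb; simp at hb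
      · simp [hφ, ov, rest, hi, hb]
    have hval : ∀ i, ov π (φ ρ) i = if i ∈ J then T i else ov π ρ i := by
      intro i
      by_cases hi : i ∈ J
      · have := key ρ hρ i hi
        simp [ov, hφ, rest, hi, this.2.1, this.2.2]
      · simp [ov, hφ, rest, hi]
    have hnf : ¬ Fals T (ov π (φ ρ)) := by
      rintro ⟨i, b, h1, h2⟩
      rw [hval] at h2
      by_cases hi : i ∈ J
      · rw [if_pos hi, h1] at h2
        simp at h2
      · rw [if_neg hi] at h2
        exact first_not_fals hρ'.2.1 ⟨i, b, h1, h2⟩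
    rw [hF', mem_filter, hH, mem_filter]
    refine ⟨⟨hF _ hρ'.1 _ href, first_refine hρ'.2.1 (refines_ov π href) hnf, ?_⟩, ?_⟩
    · apply Finset.eq_empty_of_forall_notMem
      intro i hi
      simp only [stars, mem_filter, mem_univ, true_and] at hi
      rw [hval] at hi
      by_cases hiJ : i ∈ J
      · rw [if_pos hiJ] at hi; exact hi.1 hi.2
      · rw [if_neg hiJ] at hi
        apply hiJ
        rw [← hρ'.2.2]
        simp only [stars, mem_filter, mem_univ, true_and]
        exact hi
    · rw [hera ρ hρ]; exact hρ'.1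
  have hinj : Set.InjOn φ (G : Set (ι → Option Bool)) := by
    intro a ha b hb hab
    rw [← hera a ha, ← hera b hb, hab]
  have hF'c : Closed F' := by
    intro ρ hρ ρ' href
    rw [hF', mem_filter, hH, mem_filter] at hρ
    obtain ⟨⟨h1, h2, h3⟩, h4⟩ := hρ
    have href' := refines_ov π href
    have hfix : ∀ i b, T i = some b → ov π ρ i = some b := by
      intro i b hb
      have hs : i ∉ stars T (ov π ρ) := by rw [h3]; simp
      simp only [stars, mem_filter, mem_univ, true_and, not_and] at hs
      have := hs (by rw [hb]; simp)
      cases hc : ov π ρ i with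
      | none => exact absurd hc this
      | some c =>
        by_cases hbc : c = b
        · rw [hbc]
        · exfalso
          apply first_not_fals h2
          refine ⟨i, b, hb, ?_⟩
          rw [hc]
          cases b <;> cases c <;> simp_all
    have hfix' : ∀ i b, T i = some b → ov π ρ' i = some b := fun i b hb => href' _ _ (hfix i b hb)
    rw [hF', mem_filter, hH, mem_filter]
    refine ⟨⟨hF _ h1 _ href, first_refine h2 href' ?_, ?_⟩, ?_⟩
    · rintro ⟨i, b, hb1, hb2⟩
      rw [hfix' i b hb1] at hb2
      simp at hb2
    · apply Finset.eq_empty_of_forall_notMem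
      intro i hi
      simp only [stars, mem_filter, mem_univ, true_and] at hi
      obtain ⟨b, hb⟩ := Option.ne_none_iff_exists'.mp hi.1
      rw [hfix' i b hb] at hi
      simp at hi
    · apply hF _ h4
      intro i b hb
      by_cases hi : i ∈ J
      · simp [era, hi] at hb
      · simp only [era, hi, if_false] at hb ⊢
        exact href _ _ hb
  have hstep : ∑ ρ ∈ G, RpDensity p (φ ρ) * Q (φ ρ) ≤ ∑ ρ ∈ F', RpDensity p ρ * Q ρ := by
    rw [← Finset.sum_image (f := fun ρ => RpDensity p ρ * Q ρ) hinj]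
    apply Finset.sum_le_sum_of_subset_of_nonneg
    · intro ρ hρ
      rw [mem_image] at hρ
      obtain ⟨a, ha, rfl⟩ := hρ
      exact hmem a ha
    · intro ρ _ _
      exact mul_nonneg (hR0 _) (hQ0 _)
  have hstep2 : ∑ ρ ∈ F', RpDensity p ρ * Q ρ ≤ li ^ (N - J.card) * M * ∑ ρ ∈ F', RpDensity p ρ := by
    have : ∑ ρ ∈ F', RpDensity p ρ * Q ρ = avg fun α => avg fun γ => ∑ ρ ∈ F', RpDensity p ρ *
      V L Ψ (N - J.card) (ov (asg J α) π) (ov (asg J γ) σ) ρ := by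
      simp_rw [hQ, ← avg_mul_left]
      simp_rw [avg_sum]
    rw [this]
    calc _ ≤ avg fun (α : ι → Bool) => avg fun (γ : ι → Bool) =>
          li ^ (N - J.card) * M * ∑ ρ ∈ F', RpDensity p ρ :=
          avg_mono fun α => avg_mono fun γ => ih _ (by omega) _ _ _ hF'c
      _ = _ := by rw [avg_const, avg_const]
  have hstep3 : ∑ ρ ∈ F', RpDensity p ρ ≤ ∑ ρ ∈ H, RpDensity p ρ :=
    Finset.sum_le_sum_of_subset_of_nonneg (Finset.filter_subset _ _) (fun ρ _ _ => hR0 ρ)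
  have h1p : 0 < 1 - p := by linarith
  rw [Finset.sum_congr rfl hterm, ← Finset.mul_sum]
  calc _ ≤ (4 * p / (1 - p)) ^ J.card * (li ^ (N - J.card) * M * ∑ ρ ∈ H, RpDensity p ρ) := by
        apply mul_le_mul_of_nonneg_left _ (by positivity)
        exact hstep.trans (hstep2.trans (mul_le_mul_of_nonneg_left hstep3 (by positivity)))
    _ = _ := by ring

open Classical in
theorem V_bdd {p lam M : ℝ} (hp : 0 < p) (hp1 : p < 1) (hlam : 1 ≤ lam) {w : ℕ}
    (hw : (1 + 4 * p * lam / (1 - p)) ^ w ≤ 2) (L : List (ι → Option Bool))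
    (hL : ∀ T ∈ L, (supp T).card ≤ w)
    {Ψ : (ι → Option Bool) → ℝ} (hΨ : ∀ ρ, 0 ≤ Ψ ρ) (hM : 0 ≤ M) (hB : Bdd p Ψ M) (N : ℕ) :
    ∀ (π σ : ι → Option Bool) (F : Finset (ι → Option Bool)), Closed F →
      ∑ ρ ∈ F, RpDensity p ρ * V L Ψ N π σ ρ ≤ (lam⁻¹) ^ N * M * ∑ ρ ∈ F, RpDensity p ρ := by
  induction N using Nat.strong_induction_on with
  | _ N ih =>
    intro π σ F hF
    have hR0 : ∀ ρ : ι → Option Bool, 0 ≤ RpDensity p ρ := fun ρ => Rp_nonneg hp.le hp1.le ρ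
    have hlam0 : 0 < lam := by linarith
    have h1p : 0 < 1 - p := by linarith
    by_cases hN : N = 0
    · subst hN
      simp_rw [V_zero]
      simpa using hB σ F hF
    have hfib := fun T J hJ => fiber_bound hp hp1 L hΨ N hN hM (inv_nonneg.mpr hlam0.le) ih π σ F hF T J hJ
    set H : (ι → Option Bool) → ℝ := fun T => ∑ ρ ∈ F.filter (fun ρ => first L (ov π ρ) = some T ∧
        stars T (ov π ρ) = ∅), RpDensity p ρ with hH
    have hH0 : ∀ T, 0 ≤ H T := fun T => Finset.sum_nonneg fun ρ _ => hR0 ρ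
    have hT : ∀ T : ι → Option Bool, ∑ ρ ∈ F.filter (fun ρ => first L (ov π ρ) = some T),
        RpDensity p ρ * V L Ψ N π σ ρ ≤ (lam⁻¹) ^ N * M * H T := by
      intro T
      by_cases hTL : T ∈ L
      swap
      · rw [Finset.filter_false_of_mem]
        · simp only [sum_empty]
          have := hH0 T
          positivity
        · intro ρ _ h
          exact hTL (first_mem h)
      rw [← Finset.sum_fiberwise_of_maps_to (t := (supp T).powerset)
        (g := fun ρ => stars T (ov π ρ))]
      swap
      · intro ρ _
        rw [mem_powerset]
        intro i hi
        simp only [stars, supp, mem_filter, mem_univ, true_and] at hi ⊢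
        exact hi.1
      calc _ ≤ ∑ J ∈ (supp T).powerset, (if J = ∅ then 0 else
              (4 * p * lam / (1 - p)) ^ J.card * ((lam⁻¹) ^ N * M * H T)) := by
            apply Finset.sum_le_sum
            intro J hJ
            rw [Finset.filter_filter]
            by_cases hJ0 : J = ∅
            · rw [if_pos hJ0]
              apply le_of_eq
              apply Finset.sum_eq_zero
              intro ρ hρ
              rw [mem_filter] at hρ
              rw [V_stuck L Ψ hN, mul_zero]
              rw [live_some hρ.2.1, hρ.2.2, hJ0]; simp
            · rw [if_neg hJ0]
              have hJc : J.card ≠ 0 := by simpa using hJ0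
              refine (hfib T J hJc).trans ?_
              have hHT := hH0 T
              have e : (lam⁻¹) ^ (N - J.card) ≤ lam ^ J.card * (lam⁻¹) ^ N := by
                by_cases hJN : J.card ≤ N
                · have : N = (N - J.card) + J.card := by omega
                  conv_rhs => rw [this, pow_add]
                  have e2 : lam ^ J.card * lam⁻¹ ^ J.card = 1 := by
                    rw [← mul_pow, mul_inv_cancel₀ hlam0.ne', one_pow]
                  have : lam ^ J.card * (lam⁻¹ ^ (N - J.card) * lam⁻¹ ^ J.card)
                    = lam⁻¹ ^ (N - J.card) := by
                    rw [mul_comm (lam⁻¹ ^ (N - J.card)), ← mul_assoc, e2, one_mul]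
                  rw [this]
                · have : N - J.card = 0 := by omega
                  rw [this, pow_zero, inv_pow]
                  rw [← div_eq_mul_inv, le_div_iff₀ (by positivity), one_mul]
                  exact pow_le_pow_right₀ hlam (by omega)
              calc _ ≤ (4 * p / (1 - p)) ^ J.card * (lam ^ J.card * (lam⁻¹) ^ N) * M * H T := by
                    gcongr
                _ = _ := by
                    have : 4 * p * lam / (1 - p) = (4 * p / (1 - p)) * lam := by ring
                    rw [this, mul_pow]; ring
        _ = (∑ J ∈ (supp T).powerset, (4 * p * lam / (1 - p)) ^ J.card - 1) *
              ((lam⁻¹) ^ N * M * H T) := by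
            rw [sub_mul, Finset.sum_mul]
            have : ∀ J : Finset ι, (if J = ∅ then 0 else
              (4 * p * lam / (1 - p)) ^ J.card * ((lam⁻¹) ^ N * M * H T)) =
              (4 * p * lam / (1 - p)) ^ J.card * ((lam⁻¹) ^ N * M * H T) -
              (if J = ∅ then 1 * ((lam⁻¹) ^ N * M * H T) else 0) := by
              intro J
              by_cases h : J = ∅ <;> simp [h]
            simp_rw [this]
            rw [Finset.sum_sub_distrib]
            congr 1
            rw [Finset.sum_ite_eq']
            simp
        _ ≤ 1 * ((lam⁻¹) ^ N * M * H T) := by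
            have hHT := hH0 T
            apply mul_le_mul_of_nonneg_right _ (by positivity)
            have := Finset.sum_pow_mul_eq_add_pow (4 * p * lam / (1 - p)) 1 (supp T)
            simp only [one_pow, mul_one] at this
            rw [this, add_comm]
            have : (1 + 4 * p * lam / (1 - p)) ^ (supp T).card ≤ (1 + 4 * p * lam / (1 - p)) ^ w := by
              apply pow_le_pow_right₀ _ (hL T hTL)
              have : 0 ≤ 4 * p * lam / (1 - p) := by positivity
              linarith
            linarith
        _ = _ := one_mul _
    rw [← Finset.sum_fiberwise F (fun ρ => first L (ov π ρ)), Fintype.sum_option]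
    have hnone : ∑ ρ ∈ F.filter (fun ρ => first L (ov π ρ) = none),
        RpDensity p ρ * V L Ψ N π σ ρ = 0 := by
      apply Finset.sum_eq_zero
      intro ρ hρ
      rw [mem_filter] at hρ
      rw [V_stuck L Ψ hN, mul_zero]
      rw [live_none hρ.2]; simp
    rw [hnone, zero_add]
    refine (Finset.sum_le_sum fun T _ => hT T).trans ?_
    rw [← Finset.mul_sum]
    apply mul_le_mul_of_nonneg_left _ (by positivity)
    rw [← Finset.sum_fiberwise F (fun ρ => first L (ov π ρ)), Fintype.sum_option]
    have h0 : 0 ≤ ∑ ρ ∈ F.filter (fun ρ => first L (ov π ρ) = none), RpDensity p ρ :=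
      Finset.sum_nonneg fun ρ _ => hR0 ρ
    have : ∀ T, H T ≤ ∑ ρ ∈ F.filter (fun ρ => first L (ov π ρ) = some T), RpDensity p ρ := by
      intro T
      apply Finset.sum_le_sum_of_subset_of_nonneg
      · intro ρ hρ
        rw [mem_filter] at hρ ⊢
        exact ⟨hρ.1, hρ.2.1⟩
      · intro ρ _ _; exact hR0 ρ
    have := Finset.sum_le_sum fun T (_ : T ∈ univ) => this T
    linarith

/-- rounds of the process over a family of DNFs -/
noncomputable def Ps {I : Type} [Fintype I] (L : I → List (ι → Option Bool)) (N : ℕ) :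
    ℕ → (ι → Option Bool) → ℝ
  | 0 => fun _ => 1
  | q + 1 => fun ρ => ∑ i, V (L i) (Ps L N q) N emp emp ρ

theorem Ps_nonneg {I : Type} [Fintype I] (L : I → List (ι → Option Bool)) (N q : ℕ)
    (ρ : ι → Option Bool) : 0 ≤ Ps L N q ρ := by
  induction q generalizing ρ with
  | zero => simp [Ps]
  | succ q ih => exact Finset.sum_nonneg fun i _ => V_nonneg _ ih _ _ _ _

theorem emp_ov (ρ : ι → Option Bool) : ov emp ρ = ρ := by
  funext i; simp [ov, emp]

theorem Ps_bdd {I : Type} [Fintype I] {p lam : ℝ} (hp : 0 < p) (hp1 : p < 1) (hlam : 1 ≤ lam)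
    {w : ℕ} (hw : (1 + 4 * p * lam / (1 - p)) ^ w ≤ 2) (L : I → List (ι → Option Bool))
    (hL : ∀ i, ∀ T ∈ L i, (supp T).card ≤ w) (N q : ℕ) :
    Bdd p (Ps L N q) ((Fintype.card I * (lam⁻¹) ^ N) ^ q) := by
  induction q with
  | zero => intro σ F _; simp [Ps]
  | succ q ih =>
    intro σ F hF
    have hlam0 : 0 < lam := by linarith
    have e : ∀ ρ, Ps L N (q+1) (ov σ ρ) = ∑ i, V (L i) (Ps L N q) N σ σ ρ := by
      intro ρ
      apply Finset.sum_congr rfl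
      intro i _
      apply V_congr <;> rw [emp_ov]
    simp_rw [e, Finset.mul_sum]
    rw [Finset.sum_comm]
    refine (Finset.sum_le_sum fun i _ => V_bdd hp hp1 hlam hw (L i) (hL i) (Ps_nonneg L N q)
      (by positivity) ih N σ σ F hF).trans ?_
    rw [Finset.sum_const, card_univ, nsmul_eq_mul, ← Finset.mul_sum]
    apply le_of_eq
    ring

theorem Ps_expect {I : Type} [Fintype I] {p lam : ℝ} (hp : 0 < p) (hp1 : p < 1) (hlam : 1 ≤ lam)
    {w : ℕ} (hw : (1 + 4 * p * lam / (1 - p)) ^ w ≤ 2) (L : I → List (ι → Option Bool))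
    (hL : ∀ i, ∀ T ∈ L i, (supp T).card ≤ w) (N q : ℕ) :
    ∑ ρ, RpDensity p ρ * Ps L N q ρ ≤ (Fintype.card I * (lam⁻¹) ^ N) ^ q := by
  have := Ps_bdd hp hp1 hlam hw L hL N q emp univ (fun _ _ _ _ => mem_univ _)
  simp_rw [emp_ov] at this
  rwa [Rp_sum, mul_one] at this

end
end CB

set_option linter.unusedSectionVars false

namespace CB
section
variable {ι : Type} [Fintype ι] [DecidableEq ι]

/-- `f` has a decision tree of depth less than `N` -/
def DTlt : ℕ → ((ι → Bool) → Bool) → Prop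
  | 0, _ => False
  | N + 1, f => (∃ c, ∀ x, f x = c) ∨ ∃ i, ∀ b, DTlt N (fun x => f (Function.update x i b))

theorem DTlt_succ {N : ℕ} {f : (ι → Bool) → Bool} (h : DTlt N f) : DTlt (N + 1) f := by
  induction N generalizing f with
  | zero => exact absurd h (by simp [DTlt])
  | succ N ih =>
    rcases h with h | ⟨i, h⟩
    · exact Or.inl h
    · exact Or.inr ⟨i, fun b => ih (h b)⟩

theorem DTlt_mono {N N' : ℕ} (hN : N ≤ N') {f : (ι → Bool) → Bool} (h : DTlt N f) : DTlt N' f := by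
  induction hN with
  | refl => exact h
  | step _ ih => exact DTlt_succ ih

theorem DTlt_const {N : ℕ} (hN : N ≠ 0) {f : (ι → Bool) → Bool} (c : Bool) (h : ∀ x, f x = c) :
    DTlt N f := by
  cases N with
  | zero => exact absurd rfl hN
  | succ N => exact Or.inl ⟨c, h⟩

theorem DTlt_not {N : ℕ} {f : (ι → Bool) → Bool} (h : DTlt N f) : DTlt N (fun x => !f x) := by
  induction N generalizing f with
  | zero => exact absurd h (by simp [DTlt])
  | succ N ih =>
    rcases h with ⟨c, h⟩ | ⟨i, h⟩
    · exact Or.inl ⟨!c, fun x => by simp only [h]⟩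
    · exact Or.inr ⟨i, fun b => ih (h b)⟩

theorem DTlt_restrict {N : ℕ} {f : (ι → Bool) → Bool} (h : DTlt N f) (κ : ι → Option Bool) :
    DTlt N (fun x => f (applyR κ x)) := by
  induction N generalizing f with
  | zero => exact absurd h (by simp [DTlt])
  | succ N ih =>
    rcases h with ⟨c, h⟩ | ⟨i, h⟩
    · exact Or.inl ⟨c, fun x => by simp only [h]⟩
    · cases hκ : κ i with
      | some b =>
        apply DTlt_succ
        have := ih (h b)
        convert this using 3 with x
        funext j
        by_cases hj : j = i
        · subst hj; simp [applyR, hκ]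
        · simp [applyR, hj]
      | none =>
        refine Or.inr ⟨i, fun b => ?_⟩
        have := ih (h b)
        convert this using 3 with x
        funext j
        by_cases hj : j = i
        · subst hj; simp [applyR, hκ]
        · simp [applyR, hj]

theorem DTlt_J (J : Finset ι) : ∀ {N : ℕ} {f : (ι → Bool) → Bool},
    (∀ α, DTlt N (fun x => f (applyR (asg J α) x))) → DTlt (N + J.card) f := by
  induction J using Finset.induction_on with
  | empty =>
    intro N f h
    have := h (fun _ => true)
    have hid : ∀ x, applyR (asg (∅ : Finset ι) (fun _ => true)) x = x := by
      intro x; funext i; simp [applyR, asg]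
    simpa only [hid, card_empty, add_zero] using this
  | insert i J hi ih =>
    intro N f h
    rw [card_insert_of_notMem hi, ← add_assoc]
    refine Or.inr ⟨i, fun b => ih fun α => ?_⟩
    have := h (Function.update α i b)
    convert this using 3 with x
    funext j
    by_cases hj : j = i
    · subst hj; simp [applyR, asg]
    · by_cases hjJ : j ∈ J <;> simp [applyR, asg, hj, hjJ]

/-- `L` is a DNF for `f` -/
def IsDNF (L : List (ι → Option Bool)) (f : (ι → Bool) → Bool) : Prop :=
  ∀ x, f x = true ↔ ∃ T ∈ L, ∀ i b, T i = some b → x i = b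

theorem live_ne {L : List (ι → Option Bool)} {f : (ι → Bool) → Bool} (hL : IsDNF L f) {N : ℕ}
    (hN : N ≠ 0) (κ : ι → Option Bool) (h : ¬ DTlt N (fun x => f (applyR κ x))) :
    (live L κ).card ≠ 0 := by
  intro h0
  apply h
  rw [card_eq_zero] at h0
  cases hf : first L κ with
  | none =>
    apply DTlt_const hN false
    intro x
    rw [Bool.eq_false_iff]
    intro hx
    obtain ⟨T, hT, hsat⟩ := (hL _).mp hx
    unfold first at hf
    rw [List.find?_eq_none] at hf
    have h2 : Fals T κ := by simpa using hf T hT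
    obtain ⟨i, b, h3, h4⟩ := h2
    have := hsat i b h3
    simp [applyR, h4] at this
  | some T =>
    rw [live_some hf] at h0
    apply DTlt_const hN true
    intro x
    rw [hL]
    refine ⟨T, first_mem hf, fun i b hb => ?_⟩
    have hs : i ∉ stars T κ := by rw [h0]; simp
    simp only [stars, mem_filter, mem_univ, true_and, not_and] at hs
    have hs' := hs (by rw [hb]; simp)
    cases hc : κ i with
    | none => exact absurd hc hs'
    | some c =>
      simp only [applyR, hc, Option.getD_some]
      by_contra hcb
      apply first_not_fals hf
      refine ⟨i, b, hb, ?_⟩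
      rw [hc]
      cases b <;> cases c <;> simp_all

theorem live_width {L : List (ι → Option Bool)} {w : ℕ} (hL : ∀ T ∈ L, (supp T).card ≤ w)
    (κ : ι → Option Bool) : (live L κ).card ≤ w := by
  cases hf : first L κ with
  | none => rw [live_none hf]; simp
  | some T =>
    rw [live_some hf]
    refine (Finset.card_le_card ?_).trans (hL T (first_mem hf))
    intro i hi
    simp only [stars, supp, mem_filter, mem_univ, true_and] at hi ⊢
    exact hi.1

theorem live_star {L : List (ι → Option Bool)} {κ : ι → Option Bool} {i : ι} (hi : i ∈ live L κ) :
    κ i = none := by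
  cases hf : first L κ with
  | none => rw [live_none hf] at hi; simp at hi
  | some T =>
    rw [live_some hf] at hi
    simp only [stars, mem_filter, mem_univ, true_and] at hi
    exact hi.2

theorem avg_mix (h : (ι → Bool) → ℝ) (J : Finset ι) :
    (avg fun γ => avg fun x => h (applyR (asg J γ) x)) = avg h := by
  unfold avg
  rw [← Finset.sum_div, div_div]
  have : ∑ γ : ι → Bool, ∑ x : ι → Bool, h (applyR (asg J γ) x)
      = ∑ γ : ι → Bool, ∑ _x : ι → Bool, h γ := by
    rw [← Finset.sum_product', ← Finset.sum_product']
    apply Finset.sum_nbij' (i := fun z => (applyR (asg J z.1) z.2, applyR (asg J z.2) z.1))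
      (j := fun z => (applyR (asg J z.1) z.2, applyR (asg J z.2) z.1))
    · intro a _; simp
    · intro a _; simp
    · rintro ⟨a, b⟩ _
      ext i <;> by_cases hi : i ∈ J <;> simp [applyR, asg, hi]
    · rintro ⟨a, b⟩ _
      ext i <;> by_cases hi : i ∈ J <;> simp [applyR, asg, hi]
    · intro a _; simp
  rw [this]
  simp only [sum_const, card_univ, Fintype.card_pi, Fintype.card_bool, prod_const, nsmul_eq_mul]
  rw [← Finset.mul_sum]
  push_cast
  rw [mul_div_mul_left _ _ (by positivity)]

theorem Rp_fair (p : ℝ) (h : (ι → Bool) → ℝ) :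
    ∑ ρ : ι → Option Bool, RpDensity p ρ * (avg fun x => h (applyR ρ x)) = avg h := by
  unfold avg
  simp_rw [mul_div_assoc']
  rw [← Finset.sum_div]
  congr 1
  have e1 : ∀ ρ : ι → Option Bool, RpDensity p ρ * ∑ x, h (applyR ρ x)
      = ∑ y, h y * ∑ x : ι → Bool, ∏ i, ((ρ i).elim p (fun _ => (1 - p) / 2) *
          if (ρ i).getD (x i) = y i then 1 else 0) := by
    intro ρ
    have : ∀ x : ι → Bool, h (applyR ρ x) = ∑ y, if applyR ρ x = y then h y else 0 := by
      intro x; simp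
    simp_rw [this, Finset.mul_sum]
    rw [Finset.sum_comm]
    apply Finset.sum_congr rfl; intro y _
    apply Finset.sum_congr rfl; intro x _
    rw [Finset.prod_mul_distrib]
    have : (∏ i, if (ρ i).getD (x i) = y i then (1:ℝ) else 0) = if applyR ρ x = y then 1 else 0 := by
      rw [Fintype.prod_ite_zero]
      simp [funext_iff, applyR]
    rw [this]
    unfold RpDensity
    by_cases hc : applyR ρ x = y <;> simp [hc, mul_comm]
  simp_rw [e1]
  rw [Finset.sum_comm]
  apply Finset.sum_congr rfl; intro y _
  rw [← Finset.mul_sum]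
  have e2 : ∀ ρ : ι → Option Bool, ∑ x : ι → Bool, ∏ i, ((ρ i).elim p (fun _ => (1 - p) / 2) *
          if (ρ i).getD (x i) = y i then 1 else 0) = ∏ i, ∑ b : Bool,
          ((ρ i).elim p (fun _ => (1 - p) / 2) * if (ρ i).getD b = y i then 1 else 0) := by
    intro ρ
    rw [Fintype.prod_sum]
  simp_rw [e2]
  rw [← Fintype.prod_sum (fun (i : ι) (o : Option Bool) => ∑ b : Bool,
          (o.elim p (fun _ => (1 - p) / 2) * if o.getD b = y i then (1:ℝ) else 0))]
  have e3 : ∀ i, ∑ o : Option Bool, ∑ b : Bool,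
          (o.elim p (fun _ => (1 - p) / 2) * if o.getD b = y i then (1:ℝ) else 0) = 1 := by
    intro i
    cases y i <;> simp [Fintype.sum_option]
  simp_rw [e3]
  simp

/-- correlation after the restriction -/
noncomputable def Corr (g : (ι → Bool) → ℝ) (κ : ι → Option Bool) : ℝ := avg fun x => g (applyR κ x)

/-- `κ` agrees with `κ0` off a set of size at most `b` -/
def Near (b : ℕ) (κ0 κ : ι → Option Bool) : Prop :=
  ∃ D : Finset ι, D.card ≤ b ∧ ∀ i, i ∉ D → κ i = κ0 i

theorem applyR_asg_comp {J : Finset ι} {κ : ι → Option Bool} (hJ : ∀ i ∈ J, κ i = none)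
    (α x : ι → Bool) : applyR κ (applyR (asg J α) x) = applyR (ov (asg J α) κ) x := by
  funext i
  by_cases hi : i ∈ J
  · simp [applyR, ov, asg, hi, hJ i hi]
  · simp [applyR, ov, asg, hi]

theorem corr_split (g : (ι → Bool) → ℝ) {J : Finset ι} {κ : ι → Option Bool}
    (hJ : ∀ i ∈ J, κ i = none) : Corr g κ = avg fun γ => Corr g (ov (asg J γ) κ) := by
  unfold Corr
  rw [← avg_mix _ J]
  simp_rw [applyR_asg_comp hJ]

theorem dom_inner {L : List (ι → Option Bool)} {f : (ι → Bool) → Bool} (hLf : IsDNF L f) {w : ℕ}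
    (hL : ∀ T ∈ L, (supp T).card ≤ w) (g : (ι → Bool) → ℝ) (Ψ : (ι → Option Bool) → ℝ)
    (hΨ0 : ∀ ρ, 0 ≤ Ψ ρ)
    (P : (ι → Option Bool) → Prop) (β : ℝ) (b0 : ℕ)
    (hΨ : ∀ ρ, (∀ κ, Near b0 ρ κ → P κ → |Corr g κ| ≤ β) → |Corr g ρ| ≤ Ψ ρ + β) (N : ℕ) :
    ∀ π σ ρ : ι → Option Bool, (∀ i, π i = none ↔ σ i = none) →
      ¬ DTlt N (fun x => f (applyR (ov π ρ) x)) →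
      (∀ κ, Near (b0 + N * w) (ov σ ρ) κ → P κ → |Corr g κ| ≤ β) →
      |Corr g (ov σ ρ)| ≤ V L Ψ N π σ ρ + β := by
  induction N using Nat.strong_induction_on with
  | _ N ih =>
    intro π σ ρ hdom hDT hgood
    by_cases hN : N = 0
    · subst hN
      rw [V_zero]
      apply hΨ
      simpa using hgood
    have hJ0 := live_ne hLf hN _ hDT
    have hJw := live_width hL (ov π ρ)
    have hJs : ∀ i ∈ live L (ov π ρ), ov π ρ i = none := fun i hi => live_star hi
    rw [V_step L Ψ hN π σ ρ _ rfl hJ0]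
    generalize live L (ov π ρ) = J at *
    have hJs' : ∀ i ∈ J, ov σ ρ i = none := by
      intro i hi
      have := hJs i hi
      simp only [ov, Option.or_eq_none_iff] at this ⊢
      exact ⟨(hdom i).mp this.1, this.2⟩
    have hα : ∃ α, ¬ DTlt (N - J.card) (fun x => f (applyR (ov (ov (asg J α) π) ρ) x)) := by
      by_contra hcon
      push Not at hcon
      by_cases hc : J.card ≤ N
      · apply hDT
        have : N = (N - J.card) + J.card := by omega
        rw [this]
        apply DTlt_J
        intro α
        have := hcon α
        rw [ov_assoc] at this
        simp_rw [applyR_asg_comp hJs]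
        exact this
      · have := hcon (fun _ => true)
        have h0 : N - J.card = 0 := by omega
        rw [h0] at this
        exact this
    obtain ⟨α, hα⟩ := hα
    have hstep : ∀ γ, |Corr g (ov (asg J γ) (ov σ ρ))| ≤
        V L Ψ (N - J.card) (ov (asg J α) π) (ov (asg J γ) σ) ρ + β := by
      intro γ
      rw [← ov_assoc]
      apply ih _ (by omega) _ _ _ _ hα
      · rintro κ ⟨D, hD, hDk⟩ hP
        apply hgood κ _ hP
        refine ⟨D ∪ J, ?_, ?_⟩
        · refine (card_union_le _ _).trans ?_
          have h1 : (N - J.card) * w + w ≤ N * w := by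
            rw [← Nat.succ_mul]
            apply Nat.mul_le_mul_right
            omega
          omega
        · intro i hi
          simp only [mem_union, not_or] at hi
          rw [hDk i hi.1]
          simp [ov, asg, hi.2]
      · intro i
        by_cases hi : i ∈ J
        · simp [ov, asg, hi]
        · simp [ov, asg, hi, hdom i]
    rw [corr_split g hJs']
    refine (abs_avg_le _).trans ((avg_mono hstep).trans ?_)
    rw [avg_add_const]
    have := le_avg_of_mem (g := fun α => avg fun γ =>
      V L Ψ (N - J.card) (ov (asg J α) π) (ov (asg J γ) σ) ρ)
      (fun α => avg_nonneg fun γ => V_nonneg L hΨ0 _ _ _ _) J (by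
        intro x y hxy
        have : asg J x = asg J y := by
          funext i
          by_cases hi : i ∈ J
          · simp [asg, hi, hxy i hi]
          · simp [asg, hi]
        simp only [this]) α
    linarith

theorem dom_rounds {I : Type} [Fintype I] {L : I → List (ι → Option Bool)}
    {f : I → (ι → Bool) → Bool} (hLf : ∀ i, IsDNF (L i) (f i)) {w : ℕ}
    (hL : ∀ i, ∀ T ∈ L i, (supp T).card ≤ w) (g : (ι → Bool) → ℝ) (hg : ∀ x, |g x| ≤ 1)
    {β : ℝ} (hβ : 0 ≤ β) (N q : ℕ) :
    ∀ ρ, (∀ κ, Near (q * (N * w)) ρ κ → (∀ i, DTlt N (fun x => f i (applyR κ x))) →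
      |Corr g κ| ≤ β) → |Corr g ρ| ≤ Ps L N q ρ + β := by
  induction q with
  | zero =>
    intro ρ _
    have : |Corr g ρ| ≤ 1 := by
      refine (abs_avg_le _).trans ?_
      rw [← avg_const (ι := ι) 1]
      exact avg_mono fun x => hg _
    simp only [Ps]
    linarith
  | succ q ih =>
    intro ρ hgood
    by_cases hall : ∀ i, DTlt N (fun x => f i (applyR ρ x))
    · have h1 := hgood ρ ⟨∅, by simp, by simp⟩ hall
      have h2 := Ps_nonneg L N (q+1) ρ
      linarith
    · push Not at hall
      obtain ⟨i, hi⟩ := hall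
      have := dom_inner (hLf i) (hL i) g (Ps L N q) (Ps_nonneg L N q) _ β (q * (N * w)) ih N
        emp emp ρ (fun _ => Iff.rfl) (by rw [emp_ov]; exact hi) (by
          rw [emp_ov]
          rw [Nat.succ_mul] at hgood
          exact hgood)
      rw [emp_ov] at this
      have h2 : V (L i) (Ps L N q) N emp emp ρ ≤ Ps L N (q+1) ρ :=
        Finset.single_le_sum (f := fun i => V (L i) (Ps L N q) N emp emp ρ)
          (fun i _ => V_nonneg _ (Ps_nonneg L N q) _ _ _ _) (mem_univ i)
      linarith

theorem block_mgf {p : ℝ} (B : Finset ι) :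
    ∑ ρ : ι → Option Bool, RpDensity p ρ * (1/2 : ℝ) ^ (B.filter fun i => ρ i = none).card
      = (1 - p / 2) ^ B.card := by
  have e : ∀ ρ : ι → Option Bool, RpDensity p ρ * (1/2 : ℝ) ^ (B.filter fun i => ρ i = none).card
      = ∏ i, ((ρ i).elim p (fun _ => (1 - p) / 2) *
          (if i ∈ B then (if ρ i = none then 1/2 else 1) else 1)) := by
    intro ρ
    rw [Finset.prod_mul_distrib]
    unfold RpDensity
    congr 1
    rw [Finset.prod_ite_mem, Finset.univ_inter, Finset.prod_ite]
    simp
  simp_rw [e]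
  rw [← Fintype.prod_sum (fun (i : ι) (o : Option Bool) => (o.elim p (fun _ => (1 - p) / 2) *
          (if i ∈ B then (if o = none then 1/2 else 1) else 1)))]
  have e3 : ∀ i, ∑ o : Option Bool, (o.elim p (fun _ => (1 - p) / 2) *
          (if i ∈ B then (if o = none then 1/2 else 1) else 1)) = if i ∈ B then 1 - p / 2 else 1 := by
    intro i
    by_cases hi : i ∈ B <;> simp [Fintype.sum_option, hi] <;> ring
  simp_rw [e3]
  rw [Finset.prod_ite_mem]
  simp

theorem stage {I Bk : Type} [Fintype I] [Fintype Bk] {p lam : ℝ} (hp : 0 < p) (hp1 : p < 1)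
    (hlam : 1 ≤ lam) {w : ℕ} (hw : (1 + 4 * p * lam / (1 - p)) ^ w ≤ 2)
    {L : I → List (ι → Option Bool)}
    {f : I → (ι → Bool) → Bool} (hLf : ∀ i, IsDNF (L i) (f i))
    (hL : ∀ i, ∀ T ∈ L i, (supp T).card ≤ w) (g : (ι → Bool) → ℝ) (hg : ∀ x, |g x| ≤ 1)
    {β : ℝ} (hβ : 0 ≤ β) (N q : ℕ) (B : Bk → Finset ι) (A a : ℕ) (hA : ∀ b, A ≤ (B b).card)
    (hgood : ∀ κ, (∀ i, DTlt N (fun x => f i (applyR κ x))) →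
      (∀ b, a < ((B b).filter fun i => κ i = none).card + q * (N * w)) → |Corr g κ| ≤ β) :
    |avg g| ≤ (Fintype.card I * (lam⁻¹) ^ N) ^ q +
      Fintype.card Bk * (2 ^ a * (1 - p / 2) ^ A) + β := by
  have hR0 : ∀ ρ : ι → Option Bool, 0 ≤ RpDensity p ρ := fun ρ => Rp_nonneg hp.le hp1.le ρ
  have hpt : ∀ ρ, |Corr g ρ| ≤ Ps L N q ρ +
      (∑ b, 2 ^ a * (1/2 : ℝ) ^ ((B b).filter fun i => ρ i = none).card) + β := by
    intro ρ
    have hnn : ∀ b, 0 ≤ 2 ^ a * (1/2 : ℝ) ^ ((B b).filter fun i => ρ i = none).card :=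
      fun b => by positivity
    by_cases hb : ∀ b, a < ((B b).filter fun i => ρ i = none).card
    · have h1 := dom_rounds hLf hL g hg hβ N q ρ (by
        rintro κ ⟨D, hD, hDk⟩ hP
        apply hgood κ hP
        intro b
        refine lt_of_lt_of_le (hb b) ?_
        calc ((B b).filter fun i => ρ i = none).card
            ≤ (((B b).filter fun i => κ i = none) ∪ D).card := by
              apply card_le_card
              intro i hi
              rw [mem_filter] at hi
              rw [mem_union, mem_filter]
              by_cases hiD : i ∈ D
              · exact Or.inr hiD
              · exact Or.inl ⟨hi.1, by rw [hDk i hiD]; exact hi.2⟩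
          _ ≤ _ := (card_union_le _ _).trans (by omega))
      have h2 : 0 ≤ ∑ b, 2 ^ a * (1/2 : ℝ) ^ ((B b).filter fun i => ρ i = none).card :=
        Finset.sum_nonneg fun b _ => hnn b
      linarith
    · push Not at hb
      obtain ⟨b, hb⟩ := hb
      have h1 : |Corr g ρ| ≤ 1 := by
        refine (abs_avg_le _).trans ?_
        rw [← avg_const (ι := ι) 1]
        exact avg_mono fun x => hg _
      have h2 : (1:ℝ) ≤ 2 ^ a * (1/2 : ℝ) ^ ((B b).filter fun i => ρ i = none).card := by
        rw [one_div, inv_pow, ← div_eq_mul_inv, le_div_iff₀ (by positivity), one_mul]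
        exact pow_le_pow_right₀ (by norm_num) hb
      have h3 := Finset.single_le_sum (f := fun b => 2 ^ a *
        (1/2 : ℝ) ^ ((B b).filter fun i => ρ i = none).card) (fun b _ => hnn b) (mem_univ b)
      have h4 := Ps_nonneg L N q ρ
      linarith
  calc |avg g| = |∑ ρ, RpDensity p ρ * Corr g ρ| := by rw [← Rp_fair p g]; rfl
    _ ≤ ∑ ρ, RpDensity p ρ * |Corr g ρ| := by
        refine (Finset.abs_sum_le_sum_abs _ _).trans (le_of_eq ?_)
        apply Finset.sum_congr rfl
        intro ρ _
        rw [abs_mul, abs_of_nonneg (hR0 ρ)]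
    _ ≤ ∑ ρ, RpDensity p ρ * (Ps L N q ρ +
      (∑ b, 2 ^ a * (1/2 : ℝ) ^ ((B b).filter fun i => ρ i = none).card) + β) :=
        Finset.sum_le_sum fun ρ _ => mul_le_mul_of_nonneg_left (hpt ρ) (hR0 ρ)
    _ = ∑ ρ, RpDensity p ρ * Ps L N q ρ + ∑ b, 2 ^ a * (1 - p / 2) ^ (B b).card + β := by
        simp_rw [mul_add, Finset.sum_add_distrib, Finset.mul_sum]
        rw [← Finset.sum_mul, Rp_sum, one_mul]
        congr 2
        rw [Finset.sum_comm]
        apply Finset.sum_congr rfl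
        intro b _
        rw [← block_mgf (p := p), Finset.mul_sum]
        apply Finset.sum_congr rfl
        intro ρ _
        ring
    _ ≤ _ := by
        have h1 := Ps_expect hp hp1 hlam hw L hL N q
        have h2 : ∑ b, 2 ^ a * (1 - p / 2) ^ (B b).card
            ≤ ∑ _b : Bk, 2 ^ a * (1 - p / 2) ^ A := by
          apply Finset.sum_le_sum
          intro b _
          apply mul_le_mul_of_nonneg_left _ (by positivity)
          exact pow_le_pow_of_le_one (by linarith) (by linarith) (hA b)
        rw [Finset.sum_const, card_univ, nsmul_eq_mul] at h2
        linarith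

end
end CB

set_option linter.unusedSectionVars false

namespace CB
section
variable {ι : Type} [Fintype ι] [DecidableEq ι]

theorem DTlt_DNF {N : ℕ} : ∀ {f : (ι → Bool) → Bool}, DTlt (N + 1) f →
    ∃ L : List (ι → Option Bool), IsDNF L f ∧ ∀ T ∈ L, (supp T).card ≤ N := by
  induction N with
  | zero =>
    intro f h
    rcases h with ⟨c, h⟩ | ⟨i, h⟩
    · cases c
      · exact ⟨[], fun x => by simp [h], by simp⟩
      · exact ⟨[emp], fun x => by simp [h, emp], by simp [supp, emp]⟩
    · exact absurd (h true) (by simp [DTlt])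
  | succ N ih =>
    intro f h
    rcases h with ⟨c, h⟩ | ⟨i, h⟩
    · cases c
      · exact ⟨[], fun x => by simp [h], by simp⟩
      · exact ⟨[emp], fun x => by simp [h, emp], by simp [supp, emp]⟩
    · choose L hL1 hL2 using fun b => ih (h b)
      refine ⟨(L false).map (fun T => Function.update T i (some false)) ++
        (L true).map (fun T => Function.update T i (some true)), ?_, ?_⟩
      · have key : ∀ x, f x = true ↔ ∃ b, ∃ T ∈ L b, ∀ j c,
            Function.update T i (some b) j = some c → x j = c := by
          intro x
          constructor
          · intro hx
            have : f (Function.update x i (x i)) = true := by simpa using hx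
            obtain ⟨T, hT, hT2⟩ := (hL1 (x i) x).1 this
            refine ⟨x i, T, hT, fun j c hj => ?_⟩
            by_cases hji : j = i
            · subst hji; simpa using hj
            · rw [Function.update_of_ne hji] at hj; exact hT2 j c hj
          · rintro ⟨b, T, hT, hT2⟩
            have hxi : x i = b := hT2 i b (by simp)
            have := (hL1 b (Function.update x i ((T i).getD b))).2 ⟨T, hT, fun j c hj => by
              by_cases hji : j = i
              · subst hji; simp [hj]
              · rw [Function.update_of_ne hji]
                exact hT2 j c (by rw [Function.update_of_ne hji]; exact hj)⟩
            simp only [Function.update_idem] at this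
            rw [← hxi, Function.update_eq_self] at this
            exact this
        intro x
        rw [key x]
        simp only [Bool.exists_bool, List.mem_append, List.mem_map]
        constructor
        · rintro (⟨T, hT, h2⟩ | ⟨T, hT, h2⟩)
          · exact ⟨_, Or.inl ⟨T, hT, rfl⟩, h2⟩
          · exact ⟨_, Or.inr ⟨T, hT, rfl⟩, h2⟩
        · rintro ⟨_, ⟨T, hT, rfl⟩ | ⟨T, hT, rfl⟩, h2⟩
          · exact Or.inl ⟨T, hT, h2⟩
          · exact Or.inr ⟨T, hT, h2⟩
      · have hs : ∀ b, ∀ T ∈ L b, (supp (Function.update T i (some b))).card ≤ N + 1 := by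
          intro b T hT
          have : supp (Function.update T i (some b)) ⊆ insert i (supp T) := by
            intro j hj
            by_cases hji : j = i
            · simp [hji]
            · simp only [supp, mem_filter, mem_univ, true_and, Function.update_of_ne hji] at hj
              simp [supp, hj]
          refine (card_le_card this).trans ((card_insert_le _ _).trans ?_)
          have := hL2 b T hT
          omega
        intro T hT
        simp only [List.mem_append, List.mem_map] at hT
        rcases hT with ⟨T, hT, rfl⟩ | ⟨T, hT, rfl⟩
        · exact hs _ _ hT
        · exact hs _ _ hT

/-- DNF of an OR of functions with shallow decision trees -/
theorem or_DNF {N n : ℕ} (f : Fin n → (ι → Bool) → Bool) (h : ∀ j, DTlt (N + 1) (f j)) :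
    ∃ L : List (ι → Option Bool), IsDNF L (fun x => decide (∃ j, f j x = true)) ∧
      ∀ T ∈ L, (supp T).card ≤ N := by
  choose L hL1 hL2 using fun j => DTlt_DNF (h j)
  refine ⟨(List.ofFn L).flatten, ?_, ?_⟩
  · intro x
    simp only [decide_eq_true_eq, List.mem_flatten, List.mem_ofFn]
    constructor
    · rintro ⟨j, hj⟩
      obtain ⟨T, hT, h2⟩ := (hL1 j x).1 hj
      exact ⟨T, ⟨L j, ⟨j, rfl⟩, hT⟩, h2⟩
    · rintro ⟨T, ⟨_, ⟨j, rfl⟩, hT⟩, h2⟩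
      exact ⟨j, (hL1 j x).2 ⟨T, hT, h2⟩⟩
  · intro T hT
    simp only [List.mem_flatten, List.mem_ofFn] at hT
    obtain ⟨_, ⟨j, rfl⟩, hT⟩ := hT
    exact hL2 j T hT

theorem applyR_ov (σ ρ : ι → Option Bool) (x : ι → Bool) :
    applyR σ (applyR ρ x) = applyR (ov σ ρ) x := by
  funext i
  simp only [applyR, ov]
  cases σ i <;> rfl

theorem applyR_emp (x : ι → Bool) : applyR emp x = x := by
  funext i; rfl

/-- A DNF for a circuit or its negation -/
theorem gate_DNF {N : ℕ} (D : AC0 ι) (κ : ι → Option Bool)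
    (h : ∀ (n : ℕ) (f : Fin n → AC0 ι), (D = AC0.and n f ∨ D = AC0.or n f) →
      ∀ j, DTlt (N + 2) (fun x => (f j).eval (applyR κ x)))
    (hlit : ∀ i b, D = AC0.lit i b → DTlt (N + 2) (fun x => D.eval (applyR κ x))) :
    ∃ (sgn : Bool) (L : List (ι → Option Bool)),
      IsDNF L (fun x => xor sgn (D.eval (applyR κ x))) ∧ ∀ T ∈ L, (supp T).card ≤ N + 1 := by
  cases D with
  | lit i b =>
    obtain ⟨L, h1, h2⟩ := DTlt_DNF (hlit i b rfl)
    exact ⟨false, L, by simpa using h1, h2⟩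
  | or n f =>
    obtain ⟨L, h1, h2⟩ := or_DNF _ (h n f (Or.inr rfl))
    exact ⟨false, L, by simpa [AC0.eval] using h1, h2⟩
  | and n f =>
    obtain ⟨L, h1, h2⟩ := or_DNF _ (fun j => DTlt_not (h n f (Or.inl rfl) j))
    refine ⟨true, L, ?_, h2⟩
    convert h1 using 2 with x
    simp only [AC0.eval, Bool.true_xor, ← decide_not, not_forall, Bool.not_eq_true,
      Bool.not_eq_true']

theorem lit_DT (i : ι) (b : Bool) (N : ℕ) (κ : ι → Option Bool) :
    DTlt (N + 2) (fun x => (AC0.lit i b).eval (applyR κ x)) := by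
  apply DTlt_restrict (f := fun x => (AC0.lit i b).eval x)
  apply DTlt_mono (N := 2) (by omega)
  refine Or.inr ⟨i, fun c => Or.inl ⟨if b then c else !c, fun x => ?_⟩⟩
  simp [AC0.eval]

theorem DTlt_xor {N : ℕ} (sgn : Bool) {f : (ι → Bool) → Bool} (h : DTlt N (fun x => xor sgn (f x))) :
    DTlt N f := by
  cases sgn
  · simpa using h
  · have := DTlt_not h
    simpa using this

def freeIn (B : Finset ι) (κ : ι → Option Bool) : Finset ι := B.filter fun i => κ i = none

/-- one application of the switching stage to circuit gates, starting from a restriction -/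
theorem circ_stage {I Bk : Type} [Fintype I] [Fintype Bk] {p lam : ℝ} (hp : 0 < p) (hp1 : p < 1)
    (hlam : 1 ≤ lam) {N0 : ℕ} (hw : (1 + 4 * p * lam / (1 - p)) ^ (N0 + 1) ≤ 2)
    (C : I → AC0 ι) (κ0 : ι → Option Bool) (g : (ι → Bool) → ℝ) (hg : ∀ x, |g x| ≤ 1)
    {β : ℝ} (hβ : 0 ≤ β) (N q : ℕ) (B : Bk → Finset ι) (A a A' : ℕ)
    (P : I → Prop)
    (hC : ∀ i, P i → ∀ (n : ℕ) (f : Fin n → AC0 ι), (C i = AC0.and n f ∨ C i = AC0.or n f) →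
      ∀ j, DTlt (N0 + 2) (fun x => (f j).eval (applyR κ0 x)))
    (hA : ∀ b, A ≤ (freeIn (B b) κ0).card) (hA' : A' + q * (N * (N0 + 1)) ≤ a + 1)
    (hgood : ∀ κ, (∀ i, P i → DTlt N (fun x => (C i).eval (applyR κ x))) →
      (∀ b, A' ≤ (freeIn (B b) κ).card) → |Corr g κ| ≤ β) :
    |Corr g κ0| ≤ (Fintype.card I * (lam⁻¹) ^ N) ^ q +
      Fintype.card Bk * (2 ^ a * (1 - p / 2) ^ A) + β := by
  classical
  have hex : ∀ i, ∃ (sgn : Bool) (L : List (ι → Option Bool)), 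
      IsDNF L (fun x => if P i then xor sgn ((C i).eval (applyR κ0 x)) else true) ∧
      ∀ T ∈ L, (supp T).card ≤ N0 + 1 := by
    intro i
    by_cases hi : P i
    · simp only [hi, if_true]
      exact gate_DNF (C i) κ0 (hC i hi) (fun j b hj => by rw [hj]; exact lit_DT j b N0 κ0)
    · simp only [hi, if_false]
      exact ⟨true, [emp], fun x => by simp [emp], by simp [supp, emp]⟩
  choose sgn L hL1 hL2 using hex
  refine stage hp hp1 hlam hw hL1 hL2 (fun x => g (applyR κ0 x)) (fun x => hg _) hβ N q
    (fun b => freeIn (B b) κ0) A a hA ?_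
  intro κ h1 h2
  have : Corr (fun x => g (applyR κ0 x)) κ = Corr g (ov κ0 κ) := by
    simp only [Corr, applyR_ov]
  rw [this]
  apply hgood
  · intro i hi
    have := h1 i
    simp only [hi, if_true] at this
    have := DTlt_xor _ this
    simpa only [applyR_ov] using this
  · intro b
    have h3 := h2 b
    have : freeIn (B b) (ov κ0 κ) = (freeIn (B b) κ0).filter fun i => κ i = none := by
      ext i
      simp only [freeIn, mem_filter, ov, Option.or_eq_none_iff]
      tauto
    rw [this]
    omega

/-- iterated stages -/
theorem circ_iter {I Bk : Type} [Fintype I] [Fintype Bk] {p : ℝ} (hp : 0 < p) (hp1 : p < 1)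
    {N0 : ℕ} (hw : (1 + 4 * p * 2 / (1 - p)) ^ (N0 + 1) ≤ 2)
    (C : I → AC0 ι) 
    (hC : ∀ i, ∀ (n : ℕ) (f : Fin n → AC0 ι), (C i = AC0.and n f ∨ C i = AC0.or n f) →
      ∀ j, ∃ i', C i' = f j) (g : (ι → Bool) → ℝ) (hg : ∀ x, |g x| ≤ 1)
    (q : ℕ) (B : Bk → Finset ι) (A a : ℕ → ℕ)
    (hA : ∀ b, A 0 ≤ (B b).card) (d : ℕ)
    (hA' : ∀ t < d, A (t + 1) + q * ((N0 + 2) * (N0 + 1)) ≤ a t + 1) :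
    ∀ t ≤ d, ∀ β : ℝ, 0 ≤ β → 
    (∀ κ, (∀ i, (C i).depth ≤ t → DTlt (N0 + 2) (fun x => (C i).eval (applyR κ x))) →
      (∀ b, A t ≤ (freeIn (B b) κ).card) → |Corr g κ| ≤ β) →
    |avg g| ≤ (∑ t' ∈ range t, ((Fintype.card I * ((2:ℝ)⁻¹) ^ (N0 + 2)) ^ q +
      Fintype.card Bk * (2 ^ a t' * (1 - p / 2) ^ A t'))) + β := by
  intro t
  induction t with
  | zero =>
    intro _ β _ h
    have := h emp ?_ ?_
    · simpa [Corr, applyR_emp] using this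
    · intro i hi
      cases hCi : C i with
      | lit j b => exact lit_DT j b N0 emp
      | and n f => rw [hCi] at hi; simp [AC0.depth] at hi
      | or n f => rw [hCi] at hi; simp [AC0.depth] at hi
    · intro b
      simpa [freeIn, emp] using hA b
  | succ t ih =>
    intro ht β hβ h
    have hp2 : 0 ≤ 1 - p / 2 := by linarith
    have h0 : 0 ≤ (Fintype.card I * ((2:ℝ)⁻¹) ^ (N0 + 2)) ^ q +
      Fintype.card Bk * (2 ^ a t * (1 - p / 2) ^ A t) := by positivity
    have := ih (by omega) _ (add_nonneg h0 hβ) (fun κ h1 h2 =>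
      circ_stage hp hp1 (lam := 2) (by norm_num) hw C κ g hg hβ (N0 + 2) q B (A t) (a t) (A (t+1))
        (fun i => (C i).depth ≤ t + 1)
        (fun i hi n f hf j => by
          obtain ⟨i', hi'⟩ := hC i n f hf j
          have hd : (f j).depth ≤ t := by
            have hle := Finset.le_sup (f := fun j => (f j).depth) (mem_univ j)
            rcases hf with hf | hf
            · rw [hf] at hi; simp only [AC0.depth] at hi; omega
            · rw [hf] at hi; simp only [AC0.depth] at hi; omega
          rw [← hi'] at hd ⊢
          exact h1 i' hd) h2 (hA' t (by omega)) h)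
    rw [sum_range_succ]
    linarith

/-- all subcircuits -/
def subs : AC0 ι → List (AC0 ι)
  | .lit i b => [.lit i b]
  | .and n f => .and n f :: (List.ofFn fun j => subs (f j)).flatten
  | .or n f => .or n f :: (List.ofFn fun j => subs (f j)).flatten

theorem subs_length (D : AC0 ι) : (subs D).length = D.size := by
  induction D with
  | lit i b => rfl
  | and n f ih => simp [subs, AC0.size, List.length_flatten, List.map_ofFn, List.sum_ofFn, ih,
      Function.comp_def, add_comm]
  | or n f ih => simp [subs, AC0.size, List.length_flatten, List.map_ofFn, List.sum_ofFn, ih,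
      Function.comp_def, add_comm]

theorem self_mem_subs (D : AC0 ι) : D ∈ subs D := by
  cases D <;> simp [subs]

theorem subs_closed (D : AC0 ι) : ∀ E ∈ subs D, ∀ (n : ℕ) (f : Fin n → AC0 ι),
    (E = AC0.and n f ∨ E = AC0.or n f) → ∀ j, f j ∈ subs D := by
  induction D with
  | lit i b =>
    intro E hE n f hf j
    simp only [subs, List.mem_singleton] at hE
    subst hE
    simp at hf
  | and n' f' ih =>
    intro E hE n f hf j
    simp only [subs, List.mem_cons, List.mem_flatten, List.mem_ofFn] at hE ⊢
    rcases hE with rfl | ⟨_, ⟨j', rfl⟩, hE⟩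
    · simp only [AC0.and.injEq, reduceCtorEq, or_false] at hf
      obtain ⟨rfl, hf⟩ := hf
      rw [heq_iff_eq] at hf
      subst hf
      exact Or.inr ⟨_, ⟨j, rfl⟩, self_mem_subs _⟩
    · exact Or.inr ⟨_, ⟨j', rfl⟩, ih j' E hE n f hf j⟩
  | or n' f' ih =>
    intro E hE n f hf j
    simp only [subs, List.mem_cons, List.mem_flatten, List.mem_ofFn] at hE ⊢
    rcases hE with rfl | ⟨_, ⟨j', rfl⟩, hE⟩
    · simp only [AC0.or.injEq, reduceCtorEq, false_or] at hf
      obtain ⟨rfl, hf⟩ := hf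
      rw [heq_iff_eq] at hf
      subst hf
      exact Or.inr ⟨_, ⟨j, rfl⟩, self_mem_subs _⟩
    · exact Or.inr ⟨_, ⟨j', rfl⟩, ih j' E hE n f hf j⟩

/-- The full reduction: from AC0 circuits to depth `≤ k` decision trees. -/
theorem circ_full {Jt Bk : Type} [Fintype Jt] [Fintype Bk] {p p2 lam2 : ℝ} (hp : 0 < p) (hp1 : p < 1)
    {N0 : ℕ} (hw : (1 + 4 * p * 2 / (1 - p)) ^ (N0 + 1) ≤ 2)
    (hp2 : 0 < p2) (hp21 : p2 < 1) (hlam2 : 1 ≤ lam2)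
    (hw2 : (1 + 4 * p2 * lam2 / (1 - p2)) ^ (N0 + 1) ≤ 2)
    (C : Jt → AC0 ι) (d : ℕ) (hd : ∀ i, (C i).depth ≤ d)
    (g : (ι → Bool) → ℝ) (hg : ∀ x, |g x| ≤ 1)
    (q : ℕ) (B : Bk → Finset ι) (A a : ℕ → ℕ)
    (hA : ∀ b, A 0 ≤ (B b).card) (k : ℕ)
    (hA' : ∀ t < d, A (t + 1) + q * ((N0 + 2) * (N0 + 1)) ≤ a t + 1)
    (hA'' : 1 + q * ((k + 1) * (N0 + 1)) ≤ a d + 1) {β : ℝ} (hβ : 0 ≤ β)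
    (hgood : ∀ κ, (∀ i, DTlt (k + 1) (fun x => (C i).eval (applyR κ x))) →
      (∀ b, ∃ i ∈ B b, κ i = none) → |Corr g κ| ≤ β) (S : ℕ) (hS : ∑ i, (C i).size ≤ S) :
    |avg g| ≤ (∑ t' ∈ range d, ((S * ((2:ℝ)⁻¹) ^ (N0 + 2)) ^ q +
      Fintype.card Bk * (2 ^ a t' * (1 - p / 2) ^ A t'))) + 
      ((S * (lam2⁻¹) ^ (k + 1)) ^ q + Fintype.card Bk * (2 ^ a d * (1 - p2 / 2) ^ A d) + β) := by
  let I := Σ i : Jt, Fin (subs (C i)).length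
  let C' : I → AC0 ι := fun s => (subs (C s.1)).get s.2
  have hcard : Fintype.card I ≤ S := by
    simp only [I, Fintype.card_sigma, Fintype.card_fin, subs_length]; exact hS
  have hcardR : (Fintype.card I : ℝ) ≤ S := by exact_mod_cast hcard
  have hp2' : 0 ≤ 1 - p2 / 2 := by linarith
  have hp' : 0 ≤ 1 - p / 2 := by linarith
  have hlam0 : (0:ℝ) < lam2 := by linarith
  have htop : ∀ i, ∃ s : I, C' s = C i := by
    intro i
    obtain ⟨n, hn⟩ := List.mem_iff_get.1 (self_mem_subs (C i))
    exact ⟨⟨i, n⟩, hn⟩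
  have hcl : ∀ i, ∀ (n : ℕ) (f : Fin n → AC0 ι), (C' i = AC0.and n f ∨ C' i = AC0.or n f) →
      ∀ j, ∃ i', C' i' = f j := by
    rintro ⟨i, l⟩ n f hf j
    have := subs_closed (C i) _ (List.get_mem _ l) n f hf j
    obtain ⟨n, hn⟩ := List.mem_iff_get.1 this
    exact ⟨⟨i, n⟩, hn⟩
  have h1 := circ_iter hp hp1 hw C' hcl g hg q B A a hA d hA' d le_rfl
    ((Fintype.card I * (lam2⁻¹) ^ (k + 1)) ^ q + 
      Fintype.card Bk * (2 ^ a d * (1 - p2 / 2) ^ A d) + β) (by positivity) (fun κ h1 h2 =>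
      circ_stage hp2 hp21 hlam2 hw2 C' κ g hg hβ (k + 1) q B (A d) (a d) 1
        (fun i => (C' i).depth ≤ d)
        (fun i hi n f hf j => by
          obtain ⟨i', hi'⟩ := hcl i n f hf j
          have hd : (f j).depth ≤ d := by
            have hle := Finset.le_sup (f := fun j => (f j).depth) (mem_univ j)
            rcases hf with hf | hf
            · rw [hf] at hi; simp only [AC0.depth] at hi; omega
            · rw [hf] at hi; simp only [AC0.depth] at hi; omega
          rw [← hi'] at hd ⊢
          exact h1 i' hd) h2 hA'' (fun κ' h3 h4 => hgood κ' (fun i => by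
            obtain ⟨s, hs⟩ := htop i
            rw [← hs]
            exact h3 s (by rw [hs]; exact hd i)) (fun b => by
              obtain ⟨i, hi⟩ := card_pos.1 (lt_of_lt_of_le one_pos (h4 b))
              simp only [freeIn, mem_filter] at hi
              exact ⟨i, hi⟩)))
  refine h1.trans ?_
  gcongr
end
end CB

set_option linter.unusedSectionVars false

namespace CB
section
variable {K : ℕ} {Y : Type} [Fintype Y] [DecidableEq Y]

/-- `f` does not depend on coordinate `j` -/
def Ind {γ : Type} (j : Fin K) (f : (Fin K → Y) → γ) : Prop :=
  ∀ y v, f (Function.update y j v) = f y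

/-- cylinder products -/
def CP (Φ : (Fin K → Y) → ℂ) : Prop :=
  ∃ φ : Fin K → (Fin K → Y) → ℂ, (∀ j, Ind j (φ j)) ∧ (∀ j y, ‖φ j y‖ ≤ 1) ∧
    ∀ y, Φ y = ∏ j, φ j y

def Small (g : (Fin K → Y) → ℂ) (β : ℝ) : Prop := ∀ Φ, CP Φ → ‖∑ y, g y * Φ y‖ ≤ β

def Good (W : ℝ) (G : (Fin K → Y) → ℂ) : Prop :=
  ∀ g β, Small g β → Small (fun y => g y * G y) (W * β)

theorem CP_one : CP (fun _ : Fin K → Y => (1:ℂ)) :=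
  ⟨fun _ _ => 1, fun _ _ _ => rfl, fun _ _ => by simp, fun _ => by simp⟩

theorem CP_mul {Φ Ψ : (Fin K → Y) → ℂ} (h1 : CP Φ) (h2 : CP Ψ) : CP (fun y => Φ y * Ψ y) := by
  obtain ⟨φ, a1, a2, a3⟩ := h1
  obtain ⟨ψ, b1, b2, b3⟩ := h2
  refine ⟨fun j y => φ j y * ψ j y, fun j y v => ?_, fun j y => ?_, fun y => ?_⟩
  · simp only [a1 j y v, b1 j y v]
  · rw [norm_mul]
    exact mul_le_one₀ (a2 j y) (norm_nonneg _) (b2 j y)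
  · simp only [a3, b3, prod_mul_distrib]

theorem Small_nonneg {g : (Fin K → Y) → ℂ} {β : ℝ} (h : Small g β) : 0 ≤ β :=
  (norm_nonneg _).trans (h _ CP_one)

theorem Good_mono {W W' : ℝ} (hW : W ≤ W') {G : (Fin K → Y) → ℂ} (h : Good W G) : Good W' G := by
  intro g β hg Φ hΦ
  exact (h g β hg Φ hΦ).trans (mul_le_mul_of_nonneg_right hW (Small_nonneg hg))

theorem Good_CP {Φ : (Fin K → Y) → ℂ} (h : CP Φ) : Good 1 Φ := by
  intro g β hg Ψ hΨ
  have := hg _ (CP_mul h hΨ)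
  simpa [mul_assoc] using this

theorem Good_mul {W1 W2 : ℝ} {G1 G2 : (Fin K → Y) → ℂ} (h1 : Good W1 G1) (h2 : Good W2 G2) :
    Good (W1 * W2) (fun y => G1 y * G2 y) := by
  intro g β hg
  have := h2 _ _ (h1 g β hg)
  simp only [mul_assoc] at this
  rwa [← mul_assoc, mul_comm W2 W1] at this

theorem Good_add {W1 W2 : ℝ} {G1 G2 : (Fin K → Y) → ℂ} (h1 : Good W1 G1) (h2 : Good W2 G2) :
    Good (W1 + W2) (fun y => G1 y + G2 y) := by
  intro g β hg Φ hΦ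
  have a1 := h1 g β hg Φ hΦ
  have a2 := h2 g β hg Φ hΦ
  have : ∑ y, g y * (G1 y + G2 y) * Φ y = ∑ y, g y * G1 y * Φ y + ∑ y, g y * G2 y * Φ y := by
    rw [← sum_add_distrib]
    exact sum_congr rfl fun y _ => by ring
  rw [this, add_mul]
  exact (norm_add_le _ _).trans (add_le_add a1 a2)

theorem Good_smul {W : ℝ} {G : (Fin K → Y) → ℂ} (h : Good W G) (c : ℂ) :
    Good (‖c‖ * W) (fun y => c * G y) := by
  intro g β hg Φ hΦ
  have a1 := h g β hg Φ hΦ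
  have : ∑ y, g y * (c * G y) * Φ y = c * ∑ y, g y * G y * Φ y := by
    rw [mul_sum]
    exact sum_congr rfl fun y _ => by ring
  rw [this, norm_mul, mul_assoc]
  exact mul_le_mul_of_nonneg_left a1 (norm_nonneg _)

theorem Good_zero : Good 0 (fun _ : Fin K → Y => (0:ℂ)) := by
  intro g β hg Φ hΦ
  simp

theorem Good_sum {κ : Type} (s : Finset κ) (W : κ → ℝ) (G : κ → (Fin K → Y) → ℂ)
    (h : ∀ i ∈ s, Good (W i) (G i)) : Good (∑ i ∈ s, W i) (fun y => ∑ i ∈ s, G i y) := by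
  classical
  induction s using Finset.induction_on with
  | empty => simpa using Good_zero
  | insert a s ha ih =>
    simp only [sum_insert ha]
    exact Good_add (h a (mem_insert_self _ _)) (ih fun i hi => h i (mem_insert_of_mem hi))

theorem Good_prod {κ : Type} (s : Finset κ) (W : κ → ℝ) (G : κ → (Fin K → Y) → ℂ)
    (h : ∀ i ∈ s, Good (W i) (G i)) : Good (∏ i ∈ s, W i) (fun y => ∏ i ∈ s, G i y) := by
  classical
  induction s using Finset.induction_on with
  | empty => simpa using Good_CP CP_one
  | insert a s ha ih =>
    simp only [prod_insert ha]
    exact Good_mul (h a (mem_insert_self _ _)) (ih fun i hi => h i (mem_insert_of_mem hi))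

theorem addChar_sum {R κ : Type} [AddCommMonoid R] (ψ : AddChar R ℂ) (s : Finset κ) (f : κ → R) :
    ψ (∑ j ∈ s, f j) = ∏ j ∈ s, ψ (f j) := by
  classical
  induction s using Finset.induction_on with
  | empty => simp
  | insert a s ha ih => rw [sum_insert ha, prod_insert ha, AddChar.map_add_eq_mul, ih]

theorem Good_eq (D : Fin K → (Fin K → Y) → ℤ) (hD : ∀ j, Ind j (D j)) (c : ℤ) :
    Good 1 (fun y => if ∑ j, D j y = c then (1:ℂ) else 0) := by
  classical
  obtain ⟨N, hN⟩ : ∃ N : ℕ, ∀ y, |∑ j, D j y - c| < N := by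
    refine ⟨(∑ y, |∑ j, D j y - c|).toNat + 1, fun y => ?_⟩
    have := single_le_sum (f := fun y => |∑ j, D j y - c|) (fun _ _ => abs_nonneg _) (mem_univ y)
    push_cast
    have h2 := Int.self_le_toNat (∑ y, |∑ j, D j y - c|)
    linarith
  have hN1 : ∀ y : Fin K → Y, ((∑ j, D j y - c : ℤ) : ZMod (N + 1)) = 0 ↔ ∑ j, D j y = c := by
    intro y
    rw [ZMod.intCast_zmod_eq_zero_iff_dvd]
    constructor
    · intro h
      have := Int.eq_zero_of_abs_lt_dvd h (by push_cast; linarith [hN y])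
      linarith
    · intro h; simp [h]
  have key : ∀ y, (if ∑ j, D j y = c then (1:ℂ) else 0) = ∑ a : ZMod (N + 1),
      ((N + 1 : ℂ)⁻¹ * ZMod.stdAddChar (a * ((-c : ℤ) : ZMod (N + 1)))) * 
        ∏ j, ZMod.stdAddChar (a * (D j y : ZMod (N + 1))) := by
    intro y
    have h1 := AddChar.sum_mulShift (R := ZMod (N + 1)) (R' := ℂ) (ψ := ZMod.stdAddChar)
      ((∑ j, D j y - c : ℤ) : ZMod (N + 1)) (ZMod.isPrimitive_stdAddChar (N + 1))
    have h2 : ∀ a : ZMod (N + 1), ((N + 1 : ℂ)⁻¹ * ZMod.stdAddChar (a * ((-c : ℤ) : ZMod (N + 1)))) * 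
        ∏ j, ZMod.stdAddChar (a * (D j y : ZMod (N + 1))) = 
        (N + 1 : ℂ)⁻¹ * ZMod.stdAddChar (a * ((∑ j, D j y - c : ℤ) : ZMod (N + 1))) := by
      intro a
      rw [← addChar_sum, mul_assoc, ← AddChar.map_add_eq_mul, ← mul_sum, ← mul_add]
      congr 3
      push_cast
      ring
    rw [sum_congr rfl fun a _ => h2 a, ← mul_sum, h1]
    simp only [hN1]
    split_ifs
    · rw [ZMod.card]
      push_cast
      rw [inv_mul_cancel₀]
      exact_mod_cast Nat.succ_ne_zero N
    · simp
  have := Good_sum (univ : Finset (ZMod (N + 1))) (fun _ => ((N:ℝ) + 1)⁻¹ * 1) (fun a y =>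
    ((N + 1 : ℂ)⁻¹ * ZMod.stdAddChar (a * ((-c : ℤ) : ZMod (N + 1)))) * 
        ∏ j, ZMod.stdAddChar (a * (D j y : ZMod (N + 1)))) (fun a _ => by
      have hn : ‖(N + 1 : ℂ)⁻¹ * ZMod.stdAddChar (a * ((-c : ℤ) : ZMod (N + 1)))‖ = ((N:ℝ) + 1)⁻¹ := by
        rw [norm_mul, AddChar.norm_apply, mul_one, norm_inv]
        congr 1
        have : ((N:ℂ) + 1) = ((N + 1 : ℕ) : ℂ) := by push_cast; rfl
        rw [this, Complex.norm_natCast]; push_cast; rfl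
      rw [← hn]
      apply Good_smul
      apply Good_CP
      refine ⟨fun j y => ZMod.stdAddChar (a * (D j y : ZMod (N + 1))), fun j y v => ?_,
        fun j y => ?_, fun y => rfl⟩
      · simp only [hD j y v]
      · rw [AddChar.norm_apply])
  simp only [← key] at this
  convert this using 1
  simp only [mul_one, sum_const, card_univ, ZMod.card, nsmul_eq_mul]
  push_cast
  rw [mul_inv_cancel₀]
  positivity

/-- symmetric functions of sums -/
theorem Good_sym (D : Fin K → (Fin K → Y) → ℤ) (hD : ∀ j, Ind j (D j)) (a : ℕ)
    (h0 : ∀ y, ∃ c ≤ a, ∑ j, D j y = (c : ℤ)) (F : ℕ → ℂ) (hF : ∀ c, ‖F c‖ ≤ 1) :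
    Good (a + 1) (fun y => F (∑ j, D j y).toNat) := by
  have := Good_sum (range (a + 1)) (fun c => ‖F c‖ * 1) (fun c y => F c * 
    (if ∑ j, D j y = (c:ℤ) then (1:ℂ) else 0)) (fun c _ => Good_smul (Good_eq D hD c) (F c))
  have h2 : (fun y => F (∑ j, D j y).toNat) = fun y => ∑ c ∈ range (a + 1), F c * 
    (if ∑ j, D j y = (c:ℤ) then (1:ℂ) else 0) := by
    funext y
    obtain ⟨c, hc, hc2⟩ := h0 y
    rw [hc2]
    rw [sum_eq_single c]
    · simp
    · intro b _ hb
      have : ¬ ((c:ℤ) = b) := fun h => hb (by exact_mod_cast h.symm)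
      simp [this]
    · intro h; exact absurd (mem_range.2 (by omega)) h
  rw [h2]
  refine Good_mono ?_ this
  refine (sum_le_sum (fun c _ => show ‖F c‖ * 1 ≤ 1 by rw [mul_one]; exact hF c)).trans ?_
  simp
end
end CB

set_option linter.unusedSectionVars false

namespace CB

theorem superinc_sum (v : ℤ → ℝ) (T : Finset ℤ)
    (hv : ∀ e ∈ T, ∀ e' ∈ T, e < e' → 2 * v e < v e') :
    ∀ c : ℝ, 0 < c → (∀ e ∈ T, 2 * v e < c) → ∑ e ∈ T, v e < c := by
  induction T using Finset.induction_on_max with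
  | empty => intro c hc _; simpa using hc
  | insert e0 T hmax ih =>
    intro c hc h
    have hn : e0 ∉ T := fun h => lt_irrefl _ (hmax e0 h)
    rw [sum_insert hn]
    have h0 := h e0 (mem_insert_self _ _)
    by_cases hv0 : 0 < v e0
    · have := ih (fun e he e' he' => hv e (mem_insert_of_mem he) e' (mem_insert_of_mem he')) (v e0) hv0
        (fun e he => hv e (mem_insert_of_mem he) e0 (mem_insert_self _ _) (hmax e he))
      linarith
    · have := ih (fun e he e' he' => hv e (mem_insert_of_mem he) e' (mem_insert_of_mem he')) c hc
        (fun e he => h e (mem_insert_of_mem he))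
      linarith

theorem superinc_inj (v : ℤ → ℝ) (T : Finset ℤ) (hpos : ∀ e ∈ T, 0 < v e)
    (hv : ∀ e ∈ T, ∀ e' ∈ T, e < e' → 2 * v e < v e') {P Q : Finset ℤ} (hP : P ⊆ T) (hQ : Q ⊆ T)
    (h : ∑ e ∈ P, v e = ∑ e ∈ Q, v e) : P = Q := by
  by_contra hne
  have hd : ∑ e ∈ P \ Q, v e = ∑ e ∈ Q \ P, v e := by
    have h1 := sum_sdiff_sub_sum_sdiff (s₁ := P) (s₂ := Q) (f := v)
    linarith
  have hsub : ∀ P Q : Finset ℤ, P ⊆ T → Q ⊆ T → ∑ e ∈ P \ Q, v e = ∑ e ∈ Q \ P, v e →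
      ∀ e0 ∈ P \ Q, (∀ e ∈ Q \ P, e ≤ e0) → False := by
    intro P Q hP hQ hd e0 he0 hmax
    have he0T := hP (mem_sdiff.1 he0).1
    have h1 : v e0 ≤ ∑ e ∈ P \ Q, v e :=
      single_le_sum (f := v) (fun e he => (hpos e (hP (mem_sdiff.1 he).1)).le) he0
    have h2 := superinc_sum v (Q \ P) (fun e he e' he' => hv e (hQ (mem_sdiff.1 he).1) e'
      (hQ (mem_sdiff.1 he').1)) (v e0) (hpos e0 he0T) (fun e he => by
        refine hv e (hQ (mem_sdiff.1 he).1) e0 he0T (lt_of_le_of_ne (hmax e he) ?_)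
        rintro rfl
        exact (mem_sdiff.1 he).2 (mem_sdiff.1 he0).1)
    linarith
  have hU : ((P \ Q) ∪ (Q \ P)).Nonempty := by
    by_contra hU
    rw [not_nonempty_iff_eq_empty, union_eq_empty, sdiff_eq_empty_iff_subset,
      sdiff_eq_empty_iff_subset] at hU
    exact hne (Subset.antisymm hU.1 hU.2)
  have hm := max'_mem _ hU
  rcases mem_union.1 hm with hm | hm
  · exact hsub P Q hP hQ hd _ hm (fun e he => le_max' _ _ (mem_union_right _ he))
  · exact hsub Q P hQ hP hd.symm _ hm (fun e he => le_max' _ _ (mem_union_left _ he))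

theorem superinc_card {a : ℕ} (w : Fin a → ℝ) (θ : ℝ) (s : ℤ → Fin a → Bool) (T : Finset ℤ)
    (hpos : ∀ e ∈ T, 0 < (∑ i, if s e i then w i else 0) - θ)
    (hv : ∀ e ∈ T, ∀ e' ∈ T, e < e' → 2 * ((∑ i, if s e i then w i else 0) - θ) <
      (∑ i, if s e' i then w i else 0) - θ) : T.card < (a + 1) * (a + 4) := by
  by_contra hlt
  push Not at hlt
  obtain ⟨T', hT', hc⟩ := exists_subset_card_eq hlt
  let v : ℤ → ℝ := fun e => (∑ i, if s e i then w i else 0) - θ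
  let F : Finset ℤ → (Option (Fin a) → ℕ) := fun P o => match o with
    | none => P.card
    | some i => (P.filter fun e => s e i = true).card
  have hinj : Set.InjOn F (T'.powerset : Finset (Finset ℤ)) := by
    intro P hP Q hQ h
    rw [mem_coe, mem_powerset] at hP hQ
    have hsum : ∀ P : Finset ℤ, ∑ e ∈ P, v e = (∑ i, (F P (some i) : ℝ) * w i) - F P none * θ := by
      intro P
      simp only [v, F, sum_sub_distrib, sum_const, nsmul_eq_mul]
      rw [sum_comm]
      congr 1
      apply sum_congr rfl
      intro i _
      rw [← sum_filter, sum_const, nsmul_eq_mul]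
    apply superinc_inj v T' (fun e he => hpos e (hT' he))
      (fun e he e' he' => hv e (hT' he) e' (hT' he')) hP hQ
    rw [hsum, hsum, h]
  have hmaps : ∀ P ∈ T'.powerset, F P ∈ Fintype.piFinset fun _ : Option (Fin a) => range (T'.card + 1) := by
    intro P hP
    rw [mem_powerset] at hP
    rw [Fintype.mem_piFinset]
    intro o
    rw [mem_range]
    have := card_le_card hP
    cases o with
    | none => simp only [F]; omega
    | some i =>
      simp only [F]
      have := card_filter_le P (fun e => s e i = true)
      omega
  have hcard := card_le_card_of_injOn F hmaps hinj
  rw [card_powerset, Fintype.card_piFinset] at hcard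
  simp only [card_range, prod_const, card_univ, Fintype.card_option, Fintype.card_fin] at hcard
  rw [hc, mul_comm (a + 1) (a + 4), pow_mul] at hcard
  have : (a + 4) * (a + 1) + 1 < 2 ^ (a + 4) := by
    clear * -
    induction a with
    | zero => norm_num
    | succ a ih =>
      rw [show a + 1 + 4 = a + 4 + 1 by ring, pow_succ]
      nlinarith
  have := Nat.pow_lt_pow_left this (Nat.succ_ne_zero a)
  exact absurd hcard (not_le.2 this)

theorem E_card {a K : ℕ} (w : Fin a → ℝ) (θ : ℝ) (s : ℤ → Fin a → Bool) (E : Finset ℤ)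
    (hlo : ∀ e ∈ E, (2:ℝ) ^ e ≤ (∑ i, if s e i then w i else 0) - θ)
    (hhi : ∀ e ∈ E, (∑ i, if s e i then w i else 0) - θ < K * (2:ℝ) ^ (e + 1)) :
    E.card ≤ (K + 2) * ((a + 1) * (a + 4)) := by
  by_contra hlt
  push Not at hlt
  have hmaps : ∀ e ∈ E, e % ((K + 2 : ℕ) : ℤ) ∈ (range (K + 2)).image (fun n : ℕ => (n : ℤ)) := by
    intro e _
    rw [mem_image]
    have h1 := Int.emod_nonneg e (b := ((K + 2 : ℕ) : ℤ)) (by positivity)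
    have h2 := Int.emod_lt_of_pos e (b := ((K + 2 : ℕ) : ℤ)) (by positivity)
    refine ⟨(e % ((K + 2 : ℕ) : ℤ)).toNat, ?_, ?_⟩
    · rw [mem_range]; omega
    · omega
  obtain ⟨c, _, hc⟩ := exists_lt_card_fiber_of_mul_lt_card_of_maps_to hmaps
    (n := (a + 1) * (a + 4)) (by
      rw [card_image_of_injective _ Nat.cast_injective, card_range]; exact hlt)
  have := superinc_card w θ s (E.filter fun e => e % ((K + 2 : ℕ) : ℤ) = c) (fun e he =>
    lt_of_lt_of_le (by positivity) (hlo e (mem_filter.1 he).1)) (fun e he e' he' hee => by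
      have h1 := hhi e (mem_filter.1 he).1
      have h2 := hlo e' (mem_filter.1 he').1
      have h3 : e + (K + 2 : ℕ) ≤ e' := by
        have a1 := (mem_filter.1 he).2
        have a2 := (mem_filter.1 he').2
        have hdvd : ((K + 2 : ℕ) : ℤ) ∣ e' - e := by
          apply Int.dvd_of_emod_eq_zero
          rw [Int.sub_emod, a1, a2]; simp
        have := Int.le_of_dvd (by omega) hdvd
        omega
      have h4 : (2:ℝ) ^ (e + (K + 2 : ℕ)) ≤ 2 ^ e' := zpow_le_zpow_right₀ (by norm_num) h3
      rw [zpow_add₀ (by norm_num), zpow_natCast, pow_add] at h4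
      rw [zpow_add₀ (by norm_num), zpow_one] at h1
      have h5 : (K:ℝ) ≤ 2 ^ K := by exact_mod_cast Nat.lt_two_pow_self.le
      have h6 : (0:ℝ) < 2 ^ e := by positivity
      nlinarith)
  omega

section
variable {K : ℕ} {Y : Type} [Fintype Y] [DecidableEq Y]

noncomputable def De (A : Fin K → (Fin K → Y) → ℝ) (e : ℤ) (y : Fin K → Y) : ℤ :=
  ∑ j, ⌊A j y / (2:ℝ) ^ e⌋

theorem De_le (A : Fin K → (Fin K → Y) → ℝ) (e : ℤ) (y : Fin K → Y) :
    (De A e y : ℝ) ≤ (∑ j, A j y) / 2 ^ e := by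
  rw [De, sum_div]; push_cast
  exact sum_le_sum fun j _ => Int.floor_le _

theorem De_gt (A : Fin K → (Fin K → Y) → ℝ) (e : ℤ) (y : Fin K → Y) :
    (∑ j, A j y) / 2 ^ e ≤ De A e y + K := by
  rw [De, sum_div]; push_cast
  have : ∑ j : Fin K, A j y / 2 ^ e ≤ ∑ j : Fin K, ((⌊A j y / 2 ^ e⌋ : ℝ) + 1) :=
    sum_le_sum fun j _ => (Int.lt_floor_add_one _).le
  rw [sum_add_distrib] at this
  simpa using this

theorem De_gt' (hK : 0 < K) (A : Fin K → (Fin K → Y) → ℝ) (e : ℤ) (y : Fin K → Y) :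
    (∑ j, A j y) / 2 ^ e < De A e y + K := by
  rw [De, sum_div]; push_cast
  have : ∑ j : Fin K, A j y / 2 ^ e < ∑ j : Fin K, ((⌊A j y / 2 ^ e⌋ : ℝ) + 1) :=
    sum_lt_sum_of_nonempty ⟨⟨0, hK⟩, mem_univ _⟩ fun j _ => (Int.lt_floor_add_one _)
  rw [sum_add_distrib] at this
  simpa using this

theorem De_mono (A : Fin K → (Fin K → Y) → ℝ) (e : ℤ) (n : ℕ) (y : Fin K → Y) :
    2 ^ n * De A (e + n) y ≤ De A e y := by
  rw [De, De, mul_sum]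
  apply sum_le_sum
  intro j _
  rw [Int.le_floor]
  push_cast
  have h1 := Int.floor_le (A j y / (2:ℝ) ^ (e + n))
  have h2 : A j y / (2:ℝ) ^ e = 2 ^ n * (A j y / (2:ℝ) ^ (e + n)) := by
    rw [zpow_add₀ (by norm_num), zpow_natCast]
    field_simp
  rw [h2]
  exact mul_le_mul_of_nonneg_left h1 (by positivity)

theorem De_step (A : Fin K → (Fin K → Y) → ℝ) (e : ℤ) (y : Fin K → Y) :
    De A e y ≤ 2 * De A (e + 1) y + K := by
  rw [De, De, mul_sum]
  have : ∑ j : Fin K, ⌊A j y / 2 ^ e⌋ ≤ ∑ j : Fin K, (2 * ⌊A j y / (2:ℝ) ^ (e + 1)⌋ + 1) := by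
    apply sum_le_sum
    intro j _
    rw [← Int.lt_add_one_iff, Int.floor_lt]
    push_cast
    have h1 := Int.lt_floor_add_one (A j y / (2:ℝ) ^ (e + 1))
    have h2 : A j y / (2:ℝ) ^ e = 2 * (A j y / (2:ℝ) ^ (e + 1)) := by
      rw [zpow_add₀ (by norm_num), zpow_one]
      field_simp
    rw [h2]; linarith
  rw [sum_add_distrib] at this
  simpa using this

theorem exists_e (A : Fin K → (Fin K → Y) → ℝ) (y : Fin K → Y) (hv : 0 < ∑ j, A j y) :
    ∃ e : ℤ, 1 ≤ De A e y ∧ De A (e + 1) y ≤ 0 := by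
  obtain ⟨n, hn⟩ := pow_unbounded_of_one_lt (∑ j, A j y) (one_lt_two (α := ℝ))
  obtain ⟨n', hn'⟩ := pow_unbounded_of_one_lt ((K + 1 : ℝ) / ∑ j, A j y) (one_lt_two (α := ℝ))
  obtain ⟨e, he, hmax⟩ := Int.exists_greatest_of_bdd (P := fun e => 1 ≤ De A e y) ⟨n, fun z hz => by
    by_contra hlt
    push Not at hlt
    have h1 := De_le A z y
    have h2 : (1:ℝ) ≤ De A z y := by exact_mod_cast hz
    have h3 : (1:ℝ) ≤ (∑ j, A j y) / 2 ^ z := h2.trans h1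
    rw [le_div_iff₀ (by positivity), one_mul] at h3
    have h4 : (2:ℝ) ^ (n:ℤ) ≤ 2 ^ z := zpow_le_zpow_right₀ (by norm_num) hlt.le
    rw [zpow_natCast] at h4
    linarith⟩ ⟨-n', by
    have h1 := De_gt A (-n') y
    rw [zpow_neg, div_inv_eq_mul, zpow_natCast] at h1
    rw [div_lt_iff₀ hv] at hn'
    have : (1:ℝ) ≤ De A (-n') y := by linarith
    exact_mod_cast this⟩
  refine ⟨e, he, ?_⟩
  by_contra h
  have := hmax (e + 1) (by omega)
  omega

theorem Good_thr [Nonempty Y] (hK : 0 < K) {a : ℕ} (w : Fin a → ℝ) (θ : ℝ) (s : (Fin K → Y) → Fin a → Bool)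
    (A : Fin K → (Fin K → Y) → ℝ) (hA : ∀ j, Ind j (A j))
    (hs : ∀ y, ∑ j, A j y = (∑ i, if s y i then w i else 0) - θ) :
    Good (((K + 2) * ((a + 1) * (a + 4)) : ℕ) * (K * (K + 1) : ℝ))
      (fun y => if 0 < ∑ j, A j y then (1:ℂ) else 0) := by
  classical
  have hex : ∀ y, ∃ e : ℤ, 0 < ∑ j, A j y → (1 ≤ De A e y ∧ De A (e + 1) y ≤ 0) := by
    intro y
    by_cases h : 0 < ∑ j, A j y
    · obtain ⟨e, he⟩ := exists_e A y h
      exact ⟨e, fun _ => he⟩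
    · exact ⟨0, fun h' => absurd h' h⟩
  choose ee hee using hex
  let E := (univ.filter fun y : Fin K → Y => 0 < ∑ j, A j y).image ee
  have hrep : ∀ e, ∃ y, e ∈ E → (0 < ∑ j, A j y ∧ ee y = e) := by
    intro e
    by_cases he : e ∈ E
    · obtain ⟨y, hy, hy2⟩ := mem_image.1 he
      exact ⟨y, fun _ => ⟨(mem_filter.1 hy).2, hy2⟩⟩
    · exact ⟨fun _ => Classical.arbitrary Y, fun h => absurd h he⟩
  choose yy hyy using hrep
  have hEc : E.card ≤ (K + 2) * ((a + 1) * (a + 4)) := by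
    apply E_card w θ (fun e => s (yy e)) E
    · intro e he
      obtain ⟨h1, h2⟩ := hyy e he
      have h3 := (hee (yy e) h1).1
      rw [h2] at h3
      rw [← hs]
      have h4 := De_le A e (yy e)
      have h5 : (1:ℝ) ≤ De A e (yy e) := by exact_mod_cast h3
      have h6 := h5.trans h4
      rwa [le_div_iff₀ (by positivity), one_mul] at h6
    · intro e he
      obtain ⟨h1, h2⟩ := hyy e he
      have h3 := (hee (yy e) h1).2
      rw [h2] at h3
      rw [← hs]
      have h4 := De_gt' hK A (e + 1) (yy e)
      have h5 : (De A (e + 1) (yy e) : ℝ) ≤ 0 := by exact_mod_cast h3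
      rw [div_lt_iff₀ (by positivity)] at h4
      refine h4.trans_le ?_
      apply mul_le_mul_of_nonneg_right _ (by positivity)
      linarith
  have hInd : ∀ (e : ℤ) j, Ind j (fun y => ⌊A j y / (2:ℝ) ^ e⌋) := fun e j y v => by simp only [hA j y v]
  have hg1 : ∀ e, Good (K : ℝ) (fun y => ∑ c ∈ Icc (1:ℤ) K, if De A e y = c then (1:ℂ) else 0) := by
    intro e
    have := Good_sum (Icc (1:ℤ) K) (fun _ => 1) _ (fun c _ => Good_eq _ (hInd e) c)
    exact Good_mono (by simp) this
  have hg2 : ∀ e, Good (K + 1 : ℝ)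
      (fun y => ∑ c ∈ Icc (-K:ℤ) 0, if De A e y = c then (1:ℂ) else 0) := by
    intro e
    have := Good_sum (Icc (-K:ℤ) 0) (fun _ => 1) _ (fun c _ => Good_eq _ (hInd e) c)
    have h2 : ((1:ℤ) + K).toNat = K + 1 := by omega
    exact Good_mono (by simp [h2]) this
  have hg := Good_sum E (fun _ => (K : ℝ) * (K + 1)) _ (fun e _ => Good_mul (hg1 e) (hg2 (e + 1)))
  have hfun : (fun y => ∑ e ∈ E, (∑ c ∈ Icc (1:ℤ) K, if De A e y = c then (1:ℂ) else 0) *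
      ∑ c ∈ Icc (-K:ℤ) 0, if De A (e + 1) y = c then (1:ℂ) else 0) =
      fun y => if 0 < ∑ j, A j y then (1:ℂ) else 0 := by
    funext y
    simp only [sum_ite_eq]
    by_cases hy : 0 < ∑ j, A j y
    · rw [if_pos hy]
      obtain ⟨h1, h2⟩ := hee y hy
      have hE : ee y ∈ E := mem_image.2 ⟨y, by simp [hy], rfl⟩
      rw [sum_eq_single (ee y)]
      · have h3 := De_step A (ee y) y
        have h4 : De A (ee y) y ∈ Icc (1:ℤ) K := mem_Icc.2 ⟨h1, by linarith⟩
        have h5 : De A (ee y + 1) y ∈ Icc (-K:ℤ) 0 := mem_Icc.2 ⟨by linarith, h2⟩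
        rw [if_pos h4, if_pos h5, mul_one]
      · intro e he hne
        by_contra hc
        have h4 : De A e y ∈ Icc (1:ℤ) K := by
          by_contra h; rw [if_neg h, zero_mul] at hc; exact hc rfl
        have h5 : De A (e + 1) y ∈ Icc (-K:ℤ) 0 := by
          by_contra h; rw [if_neg h, mul_zero] at hc; exact hc rfl
        rw [mem_Icc] at h4 h5
        have key : ∀ e e' : ℤ, e < e' → De A (e + 1) y ≤ 0 → 1 ≤ De A e' y → False := by
          intro e e' h a1 a2
          have := De_mono A (e + 1) (e' - (e + 1)).toNat y
          rw [show e + 1 + ((e' - (e + 1)).toNat : ℤ) = e' by omega] at this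
          have h7 : (0:ℤ) < 2 ^ (e' - (e + 1)).toNat := by positivity
          nlinarith
        rcases lt_or_gt_of_ne hne with h | h
        · exact key _ _ h h5.2 h1
        · exact key _ _ h h2 h4.1
      · intro h; exact absurd hE h
    · rw [if_neg hy]
      apply sum_eq_zero
      intro e _
      have h4 : ¬ De A e y ∈ Icc (1:ℤ) K := by
        intro h
        have h1 := De_le A e y
        have h2 : (1:ℝ) ≤ De A e y := by exact_mod_cast (mem_Icc.1 h).1
        have h3 : (∑ j, A j y) / (2:ℝ) ^ e ≤ 0 := div_nonpos_of_nonpos_of_nonneg (not_lt.1 hy) (by positivity)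
        linarith
      rw [if_neg h4, zero_mul]
  rw [hfun] at hg
  refine Good_mono ?_ hg
  rw [sum_const, nsmul_eq_mul]
  apply mul_le_mul_of_nonneg_right _ (by positivity)
  exact_mod_cast hEc
end
end CB

set_option linter.unusedSectionVars false

namespace CB

noncomputable def th : ℕ → ℝ
  | 0 => 0
  | k + 1 => Real.sqrt ((1 + th k) / 2)

theorem th_nonneg (k : ℕ) : 0 ≤ th k := by
  cases k with
  | zero => simp [th]
  | succ k => exact Real.sqrt_nonneg _

theorem th_le (k : ℕ) : th k ≤ 1 - (1/4 : ℝ) ^ k := by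
  induction k with
  | zero => simp [th]
  | succ k ih =>
    rw [th]
    have h1 : (1/4 : ℝ) ^ k ≤ 1 := pow_le_one₀ (by norm_num) (by norm_num)
    have h0 : 0 < (1/4 : ℝ) ^ k := by positivity
    apply Real.sqrt_le_iff.2
    constructor
    · rw [pow_succ]; linarith
    · have : (1/4 : ℝ) ^ (k + 1) = (1/4 : ℝ) ^ k * (1/4) := pow_succ _ _
      rw [this]; nlinarith

section
variable {m : ℕ} {Y : Type} [Fintype Y] [DecidableEq Y]

def Unif (b : Y → Fin m → Bool) : Prop := ∀ F : (Fin m → Bool) → ℝ,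
  ∑ y, F (b y) = Fintype.card Y / 2 ^ m * ∑ v, F v

theorem unif_prod {b : Y → Fin m → Bool} (hb : Unif b) (z : Finset (Fin m)) (f : Fin m → Bool → ℝ) :
    ∑ y, ∏ i ∈ z, f i (b y i) = Fintype.card Y * ∏ i ∈ z, ((f i true + f i false) / 2) := by
  have h1 := hb (fun v => ∏ i, if i ∈ z then f i (v i) else 1)
  have h2 : ∀ v : Fin m → Bool, (∏ i, if i ∈ z then f i (v i) else 1) = ∏ i ∈ z, f i (v i) := by
    intro v; simp [prod_ite_mem]
  have h3 := Finset.prod_univ_sum (fun _ : Fin m => (univ : Finset Bool))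
    (fun i x => if i ∈ z then f i x else 1)
  rw [Fintype.piFinset_univ] at h3
  rw [← h3] at h1
  simp only [h2] at h1
  rw [h1, div_mul_eq_mul_div, mul_div_assoc]
  congr 1
  have h4 : ∀ i, (∑ x : Bool, if i ∈ z then f i x else 1) = 2 * if i ∈ z then (f i true + f i false) / 2 else 1 := by
    intro i
    split_ifs <;> simp
    ring
  rw [prod_congr rfl fun i _ => h4 i, prod_mul_distrib, prod_const, card_univ, Fintype.card_fin,
    mul_div_cancel_left₀ _ (by positivity)]
  simp [prod_ite_mem]

noncomputable def sgn {K : ℕ} (b : Fin K → Y → Fin m → Bool) (z : Finset (Fin m)) (y : Fin K → Y) : ℝ :=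
  ∏ i ∈ z, if ∀ j, b j (y j) i = true then (-1 : ℝ) else 1

theorem sgn_abs {K : ℕ} (b : Fin K → Y → Fin m → Bool) (z : Finset (Fin m)) (y : Fin K → Y) :
    |sgn b z y| = 1 := by
  rw [sgn, abs_prod]
  apply prod_eq_one
  intro i _
  split_ifs <;> simp

theorem sgn_mul {K : ℕ} (b : Fin (K + 1) → Y → Fin m → Bool) (z : Finset (Fin m)) (y0 y1 : Y)
    (y : Fin K → Y) : sgn b z (Fin.cons y0 y) * sgn b z (Fin.cons y1 y) =
      sgn (fun j => b j.succ) (z.filter fun i => b 0 y0 i ≠ b 0 y1 i) y := by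
  rw [sgn, sgn, sgn, ← prod_mul_distrib, prod_filter]
  apply prod_congr rfl
  intro i _
  simp only [Fin.forall_fin_succ, Fin.cons_zero, Fin.cons_succ]
  by_cases hR : ∀ j : Fin K, b j.succ (y j) i = true
  · cases b 0 y0 i <;> cases b 0 y1 i <;> simp [hR]
  · simp only [hR, and_false, if_false, mul_one, ite_self]

theorem diff_sum {b : Y → Fin m → Bool} (hb : Unif b) (z : Finset (Fin m)) (t : ℝ) (y1 : Y) :
    ∑ y0, t ^ (z.filter fun i => b y0 i ≠ b y1 i).card = Fintype.card Y * ((1 + t) / 2) ^ z.card := by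
  have := unif_prod hb z (fun i x => if x ≠ b y1 i then t else 1)
  have h2 : ∀ y0, t ^ (z.filter fun i => b y0 i ≠ b y1 i).card =
      ∏ i ∈ z, if b y0 i ≠ b y1 i then t else 1 := by
    intro y0
    rw [← prod_filter, prod_const]
  simp only [h2]
  rw [this]
  congr 1
  rw [← prod_const]
  apply prod_congr rfl
  intro i _
  cases b y1 i <;> simp
  ring

theorem gip (k : ℕ) : ∀ (b : Fin (k + 1) → Y → Fin m → Bool) (_ : ∀ j, Unif (b j))
    (z : Finset (Fin m)) (φ : Fin (k + 1) → (Fin (k + 1) → Y) → ℂ) (_ : ∀ j, Ind j (φ j))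
    (_ : ∀ j y, ‖φ j y‖ ≤ 1),
    ‖∑ y, ((sgn b z y : ℝ) : ℂ) * ∏ j, φ j y‖ ≤ th k ^ z.card * (Fintype.card Y : ℝ) ^ (k + 1) := by
  induction k with
  | zero =>
    intro b hb z φ hφ hφ1
    by_cases hY : IsEmpty Y
    · have : IsEmpty (Fin (0 + 1) → Y) := ⟨fun y => hY.false (y 0)⟩
      simp only [univ_eq_empty, sum_empty, norm_zero]
      exact mul_nonneg (pow_nonneg (th_nonneg _) _) (by positivity)
    rw [not_isEmpty_iff] at hY
    obtain ⟨y₀⟩ := hY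
    have hc : ∀ y : Fin 1 → Y, φ 0 y = φ 0 (fun _ => y₀) := by
      intro y
      rw [← hφ 0 y y₀]
      congr 1
      funext j
      rw [Fin.fin_one_eq_zero j]; simp
    have h1 : ∑ y : Fin 1 → Y, sgn b z y = ∑ y : Y, ∏ i ∈ z, if b 0 y i = true then (-1:ℝ) else 1 := by
      apply Fintype.sum_equiv (Equiv.funUnique (Fin 1) Y)
      intro y
      simp [sgn]
    have h2 := unif_prod (hb 0) z (fun i x => if x = true then (-1:ℝ) else 1)
    rw [h2] at h1
    have h3 : ∑ y : Fin (0 + 1) → Y, ((sgn b z y : ℝ) : ℂ) * ∏ j, φ j y = 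
        ((∑ y : Fin 1 → Y, sgn b z y : ℝ) : ℂ) * φ 0 (fun _ => y₀) := by
      push_cast
      rw [sum_mul]
      apply sum_congr rfl
      intro y _
      simp only [Nat.reduceAdd, univ_unique, Fin.default_eq_zero, Fin.isValue, prod_singleton, hc y]
    rw [h3, h1, norm_mul, Complex.norm_real, Real.norm_eq_abs]
    have hth : th 0 = 0 := rfl
    have h4 : |(Fintype.card Y * ∏ i ∈ z, (((if true = true then (-1:ℝ) else 1) + if false = true then (-1:ℝ) else 1) / 2) : ℝ)|
        = th 0 ^ z.card * (Fintype.card Y : ℝ) ^ (0 + 1) := by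
      rw [hth, ← prod_const]
      simp only [if_true, Bool.false_eq_true, if_false, neg_add_cancel, zero_div, zero_add, pow_one]
      rw [mul_comm, abs_of_nonneg]
      exact mul_nonneg (prod_nonneg fun _ _ => le_rfl) (by positivity)
    rw [h4]
    exact mul_le_of_le_one_right (by rw [hth]; positivity) (hφ1 _ _)
  | succ k ih =>
    intro b hb z φ hφ hφ1
    by_cases hY : IsEmpty Y
    · have : IsEmpty (Fin (k + 1 + 1) → Y) := ⟨fun y => hY.false (y 0)⟩
      simp only [univ_eq_empty, sum_empty, norm_zero]
      exact mul_nonneg (pow_nonneg (th_nonneg _) _) (by positivity)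
    rw [not_isEmpty_iff] at hY
    obtain ⟨y₀⟩ := hY
    set n : ℝ := (Fintype.card Y : ℝ) with hn
    have hn0 : 0 ≤ n := by positivity
    let ψ : Y → (Fin (k + 1) → Y) → ℂ := fun y0 y' => 
      ((sgn b z (Fin.cons y0 y' : Fin (k + 2) → Y) : ℝ) : ℂ) * ∏ j : Fin (k + 1), φ j.succ (Fin.cons y0 y' : Fin (k + 2) → Y)
    have hc : ∀ y0 y', φ 0 (Fin.cons y0 y' : Fin (k + 2) → Y) = φ 0 (Fin.cons y₀ y' : Fin (k + 2) → Y) := by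
      intro y0 y'
      rw [← hφ 0 (Fin.cons y0 y' : Fin (k + 2) → Y) y₀]
      congr 1
      rw [Fin.update_cons_zero]
    have hsum : ∑ y, ((sgn b z y : ℝ) : ℂ) * ∏ j, φ j y = 
        ∑ y' : Fin (k + 1) → Y, φ 0 (Fin.cons y₀ y' : Fin (k + 2) → Y) * ∑ y0, ψ y0 y' := by
      rw [← (Fin.consEquiv (fun _ : Fin (k + 2) => Y)).sum_comp, Fintype.sum_prod_type, sum_comm]
      apply sum_congr rfl
      intro y' _
      rw [mul_sum]
      apply sum_congr rfl
      intro y0 _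
      simp only [Fin.consEquiv, Equiv.coe_fn_mk, ψ]
      rw [Fin.prod_univ_succ, hc]
      ring
    have hcard : (Fintype.card (Fin (k + 1) → Y) : ℝ) = n ^ (k + 1) := by
      rw [Fintype.card_fun, Fintype.card_fin]; push_cast; rfl
    have h1 : ‖∑ y, ((sgn b z y : ℝ) : ℂ) * ∏ j, φ j y‖ ≤ ∑ y', ‖∑ y0, ψ y0 y'‖ := by
      rw [hsum]
      refine (norm_sum_le _ _).trans (sum_le_sum fun y' _ => ?_)
      rw [norm_mul]
      exact mul_le_of_le_one_left (norm_nonneg _) (hφ1 _ _)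
    have h2 : (∑ y', ‖∑ y0, ψ y0 y'‖) ^ 2 ≤ n ^ (k + 1) * ∑ y', ‖∑ y0, ψ y0 y'‖ ^ 2 := by
      have := sq_sum_le_card_mul_sum_sq (s := (univ : Finset (Fin (k + 1) → Y)))
        (f := fun y' => ‖∑ y0, ψ y0 y'‖)
      rwa [card_univ, hcard] at this
    have h3 : ((∑ y', ‖∑ y0, ψ y0 y'‖ ^ 2 : ℝ) : ℂ) =
        ∑ y1, ∑ y0, ∑ y', ψ y0 y' * (starRingEnd ℂ) (ψ y1 y') := by
      push_cast
      have : ∀ y', ((‖∑ y0, ψ y0 y'‖ : ℂ)) ^ 2 = ∑ y1, ∑ y0, ψ y0 y' * (starRingEnd ℂ) (ψ y1 y') := by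
        intro y'
        rw [← Complex.mul_conj', map_sum, mul_sum]
        apply sum_congr rfl
        intro y1 _
        rw [sum_mul]
      rw [sum_congr rfl fun y' _ => this y', sum_comm]
      apply sum_congr rfl
      intro y1 _
      rw [sum_comm]
    have h4 : ∀ y1 y0, ‖∑ y', ψ y0 y' * (starRingEnd ℂ) (ψ y1 y')‖ ≤ 
        th k ^ (z.filter fun i => b 0 y0 i ≠ b 0 y1 i).card * n ^ (k + 1) := by
      intro y1 y0
      have := ih (fun j => b j.succ) (fun j => hb j.succ) (z.filter fun i => b 0 y0 i ≠ b 0 y1 i)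
        (fun j y' => φ j.succ (Fin.cons y0 y' : Fin (k + 2) → Y) *
          (starRingEnd ℂ) (φ j.succ (Fin.cons y1 y' : Fin (k + 2) → Y)))
        (fun j y' v => by
          simp only [Fin.cons_update]
          rw [hφ, hφ])
        (fun j y' => by
          rw [norm_mul, RCLike.norm_conj]
          exact mul_le_one₀ (hφ1 _ _) (norm_nonneg _) (hφ1 _ _))
      convert this using 2
      apply sum_congr rfl
      intro y' _
      rw [← sgn_mul]
      simp only [ψ, map_mul, map_prod, Complex.conj_ofReal, prod_mul_distrib]
      push_cast
      ring
    have h5 : ∑ y', ‖∑ y0, ψ y0 y'‖ ^ 2 ≤ n * (n * ((1 + th k) / 2) ^ z.card) * n ^ (k + 1) := by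
      have e1 : ∑ y', ‖∑ y0, ψ y0 y'‖ ^ 2 = ‖((∑ y', ‖∑ y0, ψ y0 y'‖ ^ 2 : ℝ) : ℂ)‖ := by
        rw [Complex.norm_real, Real.norm_eq_abs, abs_of_nonneg]
        positivity
      rw [e1, h3]
      calc _ ≤ ∑ y1, ∑ y0, ‖∑ y', ψ y0 y' * (starRingEnd ℂ) (ψ y1 y')‖ :=
            (norm_sum_le _ _).trans (sum_le_sum fun y1 _ => norm_sum_le _ _)
        _ ≤ ∑ y1, ∑ y0, th k ^ (z.filter fun i => b 0 y0 i ≠ b 0 y1 i).card * n ^ (k + 1) :=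
            sum_le_sum fun y1 _ => sum_le_sum fun y0 _ => h4 y1 y0
        _ = _ := by
            simp only [← sum_mul, diff_sum (hb 0)]
            rw [sum_const, card_univ, nsmul_eq_mul, ← hn]
            ring
    have h6 : th (k + 1) ^ 2 = (1 + th k) / 2 := by
      rw [th, Real.sq_sqrt]
      have := th_nonneg k
      linarith
    have hpos : 0 ≤ th (k + 1) ^ z.card * n ^ (k + 1 + 1) :=
      mul_nonneg (pow_nonneg (th_nonneg _) _) (by positivity)
    refine h1.trans (abs_le_of_sq_le_sq' ?_ hpos |>.2)
    calc _ ≤ n ^ (k + 1) * ∑ y', ‖∑ y0, ψ y0 y'‖ ^ 2 := h2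
      _ ≤ n ^ (k + 1) * (n * (n * ((1 + th k) / 2) ^ z.card) * n ^ (k + 1)) := by gcongr
      _ = _ := by
        rw [← h6, mul_pow, ← pow_mul, ← pow_mul, ← pow_mul]
        ring
end
end CB

set_option linter.unusedSectionVars false

namespace CB
section
variable {ι : Type} [Fintype ι] [DecidableEq ι]

/-- `f` does not look at the variables of colour `j` -/
def IndC {K : ℕ} {γ : Type} (col : ι → Fin K) (j : Fin K) (f : (ι → Bool) → γ) : Prop :=
  ∀ x x', (∀ v, col v ≠ j → x v = x' v) → f x = f x'

theorem DT_decomp_aux {K : ℕ} (col : ι → Fin K) : ∀ (N : ℕ) (f : (ι → Bool) → Bool), DTlt N f →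
    ∀ (χ : (ι → Bool) → ℤ) (Bs : Finset (Fin K)),
    (∀ x x', (∀ v, col v ∈ Bs → x v = x' v) → χ x = χ x') → Bs.card + N ≤ K →
    ∃ fj : Fin K → (ι → Bool) → ℤ, (∀ j, IndC col j (fj j)) ∧
      ∀ x, χ x * (if f x then 1 else 0) = ∑ j, fj j x := by
  intro N
  induction N with
  | zero => intro f h; exact absurd h (by simp [DTlt])
  | succ N ih =>
    intro f h χ Bs hχ hB
    rcases h with ⟨c, h⟩ | ⟨i, h⟩
    · obtain ⟨j, hj⟩ : ∃ j, j ∉ Bs := by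
        by_contra hcon
        push Not at hcon
        have : Bs = univ := eq_univ_iff_forall.2 hcon
        rw [this, card_univ, Fintype.card_fin] at hB
        omega
      refine ⟨fun j' x => if j' = j then χ x * (if c then 1 else 0) else 0, fun j' x x' hx => ?_, fun x => ?_⟩
      · by_cases hjj : j' = j
        · simp only [hjj, if_true]
          rw [hχ x x' fun v hv => hx v (fun e => hj (by rw [← hjj, ← e]; exact hv))]
        · simp [hjj]
      · simp [h]
    · have hχ' : ∀ b : Bool, ∀ x x', (∀ v, col v ∈ insert (col i) Bs → x v = x' v) →
          (χ x * if x i = b then 1 else 0) = χ x' * if x' i = b then 1 else 0 := by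
        intro b x x' hx
        rw [hχ x x' fun v hv => hx v (mem_insert_of_mem hv), hx i (mem_insert_self _ _)]
      have hB' : (insert (col i) Bs).card + N ≤ K := by
        have := card_insert_le (col i) Bs
        omega
      choose F h1 h2 using fun b => ih _ (h b) _ _ (hχ' b) hB'
      refine ⟨fun j x => F true j x + F false j x, fun j x x' hx => ?_, fun x => ?_⟩
      · simp only [h1 true j x x' hx, h1 false j x x' hx]
      · rw [sum_add_distrib, ← h2, ← h2]
        cases hxi : x i with
        | true =>
          have : Function.update x i true = x := by rw [← hxi]; simp
          simp [this]
        | false =>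
          have : Function.update x i false = x := by rw [← hxi]; simp
          simp [this]

theorem DT_decomp {K : ℕ} (col : ι → Fin K) (f : (ι → Bool) → Bool) (h : DTlt K f) :
    ∃ fj : Fin K → (ι → Bool) → ℤ, (∀ j, IndC col j (fj j)) ∧
      ∀ x, (if f x then 1 else 0) = ∑ j, fj j x := by
  obtain ⟨fj, h1, h2⟩ := DT_decomp_aux col K f h (fun _ => 1) ∅ (fun _ _ _ => rfl) (by simp)
  exact ⟨fj, h1, fun x => by rw [← h2 x, one_mul]⟩
end

theorem bsign {α : Type} [Fintype α] (f : α → Bool) :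
    (if bparity f = true then (-1:ℝ) else 1) = ∏ a, if f a = true then (-1:ℝ) else 1 := by
  classical
  rw [prod_ite, prod_const, prod_const_one, mul_one]
  simp only [bparity, decide_eq_true_eq]
  have : (univ.filter fun a => f a = true).card = (univ.filter fun a => f a = true).card := rfl
  split_ifs with h
  · exact (Odd.neg_one_pow (Nat.odd_iff.2 h)).symm
  · exact (Even.neg_one_pow (Nat.even_iff.2 (by omega))).symm

section
variable {m K r : ℕ}

def join (y : Fin K → (Fin m × Fin r → Bool)) : Fin m × Fin K × Fin r → Bool :=
  fun v => y v.2.1 (v.1, v.2.2)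

def joinEquiv : (Fin K → (Fin m × Fin r → Bool)) ≃ (Fin m × Fin K × Fin r → Bool) where
  toFun := join
  invFun x := fun j p => x (p.1, j, p.2)
  left_inv _ := rfl
  right_inv _ := rfl

theorem Ind_join {γ : Type} {j : Fin K} {f : (Fin m × Fin K × Fin r → Bool) → γ}
    (h : IndC (fun v => v.2.1) j f) : Ind j (fun y => f (join y)) := by
  intro y v
  apply h
  intro p hp
  simp only [join, Function.update_of_ne hp]

/-- block parities under a restriction -/
def bl (κ : Fin m × Fin K × Fin r → Option Bool) (j : Fin K) (y : Fin m × Fin r → Bool) (i : Fin m) : Bool :=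
  bparity fun l : Fin r => (κ (i, j, l)).getD (y (i, l))

theorem bl_unif (κ : Fin m × Fin K × Fin r → Option Bool)
    (hst : ∀ i j, ∃ l, κ (i, j, l) = none) (j : Fin K) : Unif (bl κ j) := by
  choose st hst using fun i => hst i j
  intro F
  let T : (Fin m → Bool) → (Fin m × Fin r → Bool) → (Fin m × Fin r → Bool) :=
    fun v y p => xor (y p) (decide (p.2 = st p.1) && v p.1)
  have hT : ∀ v, Function.Involutive (T v) := by
    intro v y
    funext p
    simp only [T]
    cases y p <;> cases (decide (p.2 = st p.1) && v p.1) <;> rfl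
  have hb : ∀ v y, bl κ j (T v y) = fun i => xor (bl κ j y i) (v i) := by
    intro v y
    funext i
    have h1 := bsign fun l : Fin r => (κ (i, j, l)).getD (T v y (i, l))
    have h2 := bsign fun l : Fin r => (κ (i, j, l)).getD (y (i, l))
    have h3 : (∏ l : Fin r, if (κ (i, j, l)).getD (T v y (i, l)) = true then (-1:ℝ) else 1) =
        (∏ l : Fin r, if (κ (i, j, l)).getD (y (i, l)) = true then (-1:ℝ) else 1) *
        ∏ l : Fin r, if l = st i then (if v i then (-1:ℝ) else 1) else 1 := by
      rw [← prod_mul_distrib]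
      apply prod_congr rfl
      intro l _
      by_cases hl : l = st i
      · subst hl
        simp only [T, hst, Option.getD_none]
        cases y (i, st i) <;> cases v i <;> simp
      · simp [T, hl]
    rw [prod_ite_eq' univ (st i), if_pos (mem_univ _)] at h3
    rw [← h1, ← h2] at h3
    simp only [bl]
    revert h3
    cases (bparity fun l => (κ (i, j, l)).getD (T v y (i, l))) <;>
    cases (bparity fun l => (κ (i, j, l)).getD (y (i, l))) <;>
    cases v i <;> simp <;> norm_num
  have h1 : ∀ v : Fin m → Bool, ∑ y, F (bl κ j y) = ∑ y, F (fun i => xor (bl κ j y i) (v i)) := by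
    intro v
    rw [← Equiv.sum_comp (hT v).toPerm (fun y => F (bl κ j y))]
    apply sum_congr rfl
    intro y _
    rw [← hb]; rfl
  have h2 : ∀ c : Fin m → Bool, ∑ v : Fin m → Bool, F (fun i => xor (c i) (v i)) = ∑ v : Fin m → Bool, F v := by
    intro c
    have hinv : Function.Involutive (fun v : Fin m → Bool => fun i => xor (c i) (v i)) := by
      intro v; funext i; simp
    exact Equiv.sum_comp hinv.toPerm F
  have h3 : (2:ℝ) ^ m * ∑ y, F (bl κ j y) = Fintype.card (Fin m × Fin r → Bool) * ∑ v, F v := by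
    have e1 : ∑ v : Fin m → Bool, ∑ y, F (fun i => xor (bl κ j y i) (v i)) = (2:ℝ) ^ m * ∑ y, F (bl κ j y) := by
      rw [sum_congr rfl fun v _ => (h1 v).symm, sum_const, card_univ]
      simp
    rw [← e1, sum_comm, sum_congr rfl fun y _ => h2 _, sum_const, card_univ, nsmul_eq_mul]
  rw [div_mul_eq_mul_div, ← h3, mul_div_cancel_left₀ _ (by positivity)]
end

section
variable {K : ℕ} {Y : Type} [Fintype Y] [DecidableEq Y]

theorem Good_ind {W : ℝ} {G : (Fin K → Y) → Bool} (h : Good W (fun y => if G y = true then (1:ℂ) else 0))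
    (b : Bool) : Good (W + 1) (fun y => if G y = b then (1:ℂ) else 0) := by
  cases b with
  | true => exact Good_mono (by linarith) h
  | false =>
    have := Good_add (Good_CP (CP_one (K := K) (Y := Y))) (Good_smul h (-1))
    convert Good_mono (W' := W + 1) (by simp [add_comm]) this using 2 with y
    cases G y <;> simp

theorem Good_any {W : ℝ} {u : ℕ} (G : Fin u → (Fin K → Y) → Bool)
    (h : ∀ i, Good W (fun y => if G i y = true then (1:ℂ) else 0)) (H : (Fin u → Bool) → ℝ)
    (hH : ∀ v, |H v| ≤ 1) (hW : 0 ≤ W) :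
    Good ((2 * (W + 1)) ^ u) (fun y => ((H (fun i => G i y) : ℝ) : ℂ)) := by
  have h1 := fun v : Fin u → Bool => Good_smul (Good_prod univ (fun _ => W + 1) _
    (fun i _ => Good_ind (h i) (v i))) (H v : ℂ)
  have h2 := Good_sum univ _ _ (fun v _ => h1 v)
  have h3 : (fun y => ∑ v : Fin u → Bool, (H v : ℂ) * ∏ i, if G i y = v i then (1:ℂ) else 0) =
      fun y => ((H (fun i => G i y) : ℝ) : ℂ) := by
    funext y
    rw [sum_eq_single (fun i => G i y)]
    · simp
    · intro v _ hv
      obtain ⟨i, hi⟩ := Function.ne_iff.1 hv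
      rw [prod_eq_zero (mem_univ i), mul_zero]
      rw [if_neg (fun e => hi e.symm)]
    · simp
  rw [h3] at h2
  refine Good_mono ?_ h2
  calc ∑ v : Fin u → Bool, ‖(H v : ℂ)‖ * ∏ _i : Fin u, (W + 1) 
      ≤ ∑ v : Fin u → Bool, (W + 1) ^ u := by
        apply sum_le_sum
        intro v _
        rw [Complex.norm_real, prod_const, card_univ, Fintype.card_fin]
        exact mul_le_of_le_one_left (by positivity) (hH v)
    _ = _ := by
        rw [sum_const, card_univ, mul_pow]; simp

/-- the goodness constant -/
def Wc (K S : ℕ) : ℕ := 1 + ((K + 2) * ((S + 1) * (S + 4))) * (K * (K + 1))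

theorem Good_symgate (hK : 0 < K) {a S : ℕ} (ha : a ≤ S) (s : (Fin K → Y) → Fin a → Bool)
    (fj : Fin a → Fin K → (Fin K → Y) → ℤ) (hI : ∀ i j, Ind j (fj i j))
    (hs : ∀ i y, (if s y i then 1 else 0) = ∑ j, fj i j y) {g : (Fin a → Bool) → Bool}
    (hg : IsSymFun g) : Good (Wc K S) (fun y => if g (s y) = true then (1:ℂ) else 0) := by
  obtain ⟨F, hF⟩ := hg
  have hsum : ∀ y, ∑ j, ∑ i, fj i j y = ((univ.filter fun i => s y i = true).card : ℤ) := by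
    intro y
    rw [sum_comm, card_filter]
    push_cast
    apply sum_congr rfl
    intro i _
    rw [← hs]
  have := Good_sym (fun j y => ∑ i, fj i j y) (fun j y v => by simp only [hI _ j y v]) a
    (fun y => ⟨_, (card_le_univ _).trans (by simp), hsum y⟩) (fun c => if F c then 1 else 0)
    (fun c => by split_ifs <;> simp)
  simp only [hsum, Int.toNat_natCast] at this
  simp only [hF]
  refine Good_mono ?_ this
  have : a + 1 ≤ Wc K S := by
    rw [Wc]
    have h2 : 1 ≤ (K + 2) := by omega
    have h1 : 1 ≤ K * (K + 1) := Nat.mul_pos hK (by omega)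
    have h3 : a + 1 ≤ (S + 1) * (S + 4) := by nlinarith
    calc a + 1 ≤ 1 * ((S + 1) * (S + 4)) * 1 := by omega
      _ ≤ ((K + 2) * ((S + 1) * (S + 4))) * (K * (K + 1)) := by gcongr
      _ ≤ _ := by omega
  exact_mod_cast this

theorem Good_thrgate [Nonempty Y] (hK : 0 < K) {a S : ℕ} (ha : a ≤ S) (s : (Fin K → Y) → Fin a → Bool)
    (fj : Fin a → Fin K → (Fin K → Y) → ℤ) (hI : ∀ i j, Ind j (fj i j))
    (hs : ∀ i y, (if s y i then 1 else 0) = ∑ j, fj i j y) {g : (Fin a → Bool) → Bool}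
    (hg : IsThrFun g) : Good (Wc K S) (fun y => if g (s y) = true then (1:ℂ) else 0) := by
  obtain ⟨w, θ, hw⟩ := hg
  have hsum : ∀ y, ∑ j : Fin K, ((∑ i, -w i * fj i j y) + if j = ⟨0, hK⟩ then θ else 0) =
      (∑ i, if s y i then -w i else 0) - (-θ) := by
    intro y
    rw [sum_add_distrib, sum_comm, sum_ite_eq' univ, if_pos (mem_univ _), sub_neg_eq_add]
    congr 1
    apply sum_congr rfl
    intro i _
    rw [← mul_sum]
    have : ((∑ j, fj i j y : ℤ) : ℝ) = if s y i then 1 else 0 := by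
      rw [← hs]; push_cast; rfl
    push_cast at this
    rw [this]
    split_ifs <;> simp
  have h1 := Good_thr hK (fun i => -w i) (-θ) s
    (fun j y => (∑ i, -w i * fj i j y) + if j = ⟨0, hK⟩ then θ else 0)
    (fun j y v => by simp only [hI _ j y v]) hsum
  have h2 := Good_add (Good_CP (CP_one (K := K) (Y := Y))) (Good_smul h1 (-1))
  convert Good_mono (W' := (Wc K S : ℝ)) ?_ h2 using 2 with y
  · rw [hw, hsum]
    have : (∑ i, if s y i then -w i else 0) = -∑ i, if s y i = true then w i else 0 := by
      rw [← sum_neg_distrib]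
      apply sum_congr rfl
      intro i _
      split_ifs <;> simp
    rw [this]
    simp only [decide_eq_true_eq]
    by_cases hc : θ ≤ ∑ i, if s y i = true then w i else 0
    · rw [if_pos hc, if_neg (by linarith)]; simp
    · rw [if_neg hc, if_pos (by linarith)]; simp
  · have : 1 + 1 * ((K + 2) * ((a + 1) * (a + 4)) * (K * (K + 1))) ≤ Wc K S := by
      rw [Wc, one_mul]
      gcongr
    simp only [norm_neg, norm_one]
    exact_mod_cast this
end
end CB

set_option linter.unusedSectionVars false

namespace CB
theorem good_gate {m k r : ℕ} {S : ℕ} (κ : Fin m × Fin (k+1) × Fin r → Option Bool)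
    {a : ℕ} {g : (Fin a → Bool) → Bool} (hg : IsSymFun g ∨ IsThrFun g) (ha : a ≤ S)
    (C : Fin a → AC0 (Fin m × Fin (k+1) × Fin r))
    (hC : ∀ c, DTlt (k+1) (fun x => (C c).eval (applyR κ x))) :
    Good (Wc (k+1) S) (fun y : Fin (k+1) → (Fin m × Fin r → Bool) =>
      if g (fun c => (C c).eval (applyR κ (join y))) = true then (1:ℂ) else 0) := by
  choose fj h1 h2 using fun c => DT_decomp (K := k+1) (fun v : Fin m × Fin (k+1) × Fin r => v.2.1) _ (hC c)
  rcases hg with hg | hg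
  · exact Good_symgate (Nat.succ_pos k) ha (fun y c => (C c).eval (applyR κ (join y)))
      (fun c j y => fj c j (join y)) (fun c j => Ind_join (h1 c j)) (fun c y => h2 c (join y)) hg
  · exact Good_thrgate (Nat.succ_pos k) ha (fun y c => (C c).eval (applyR κ (join y)))
      (fun c j y => fj c j (join y)) (fun c j => Ind_join (h1 c j)) (fun c y => h2 c (join y)) hg

theorem RW_sign {m k r : ℕ} (κ : Fin m × Fin (k+1) × Fin r → Option Bool)
    (y : Fin (k+1) → (Fin m × Fin r → Bool)) :
    (if RW m k r (applyR κ (join y)) = true then (-1:ℝ) else 1) = sgn (bl κ) univ y := by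
  rw [RW, bsign, sgn]
  apply prod_congr rfl
  intro i _
  simp only [decide_eq_true_eq]
  rfl

theorem at_kappa {m k r u S : ℕ} (κ : Fin m × Fin (k+1) × Fin r → Option Bool)
    (hst : ∀ i j, ∃ l, κ (i, j, l) = none) (h : (Fin u → Bool) → Bool)
    (a : Fin u → ℕ) (g : ∀ i, (Fin (a i) → Bool) → Bool) (hg : ∀ i, IsSymFun (g i) ∨ IsThrFun (g i))
    (ha : ∀ i, a i ≤ S) (C : ∀ i, Fin (a i) → AC0 (Fin m × Fin (k+1) × Fin r))
    (hC : ∀ i c, DTlt (k+1) (fun x => (C i c).eval (applyR κ x))) :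
    |Corr (fun x => (if h (fun i => g i fun c => (C i c).eval x) = true then (-1:ℝ) else 1) *
      (if RW m k r x = true then (-1:ℝ) else 1)) κ| ≤ (2 * ((Wc (k+1) S : ℝ) + 1)) ^ u * th k ^ m := by
  have hsm : Small (fun y => ((sgn (bl κ) univ y : ℝ) : ℂ))
      (th k ^ m * (Fintype.card (Fin m × Fin r → Bool) : ℝ) ^ (k + 1)) := by
    rintro Φ ⟨φ, h1, h2, h3⟩
    simp only [h3]
    have := gip k (bl κ) (bl_unif κ hst) univ φ h1 h2
    rwa [card_univ, Fintype.card_fin] at this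
  have hgd := Good_any (fun i (y : Fin (k+1) → (Fin m × Fin r → Bool)) => g i fun c => (C i c).eval (applyR κ (join y)))
    (fun i => good_gate κ (hg i) (ha i) (C i) (hC i)) (fun v => if h v = true then (-1:ℝ) else 1)
    (fun v => by split_ifs <;> simp) (by positivity)
  have := hgd _ _ hsm _ CP_one
  rw [Corr, avg, ← Equiv.sum_comp joinEquiv]
  have e1 : ∀ y, (if h (fun i => g i fun c => (C i c).eval (applyR κ (joinEquiv y))) = true then (-1:ℝ) else 1) *
      (if RW m k r (applyR κ (joinEquiv y)) = true then (-1:ℝ) else 1) =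
      sgn (bl κ) univ y * (if h (fun i => g i fun c => (C i c).eval (applyR κ (join y))) = true then (-1:ℝ) else 1) := by
    intro y
    have : joinEquiv y = join y := rfl
    rw [this, RW_sign, mul_comm]
  rw [sum_congr rfl fun y _ => e1 y, abs_div]
  have hc : ((Fintype.card (Fin m × Fin r → Bool) : ℝ)) ^ (k + 1) = 2 ^ Fintype.card (Fin m × Fin (k+1) × Fin r) := by
    have := Fintype.card_congr (joinEquiv (m := m) (K := k+1) (r := r))
    rw [Fintype.card_fun, Fintype.card_fun (α := Fin m × Fin (k+1) × Fin r), Fintype.card_fin, Fintype.card_bool] at this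
    exact_mod_cast this
  rw [div_le_iff₀ (by positivity), abs_of_pos (a := (2:ℝ) ^ _) (by positivity), ← hc, mul_assoc]
  refine le_trans (le_of_eq ?_) this
  rw [← Real.norm_eq_abs, ← Complex.norm_real]
  congr 1
  push_cast
  simp

theorem agree_le {ι : Type} [Fintype ι] [DecidableEq ι] (F H : (ι → Bool) → Bool) :
    agreePr F H ≤ 1/2 + |avg (fun x => (if F x = true then (-1:ℝ) else 1) * (if H x = true then (-1:ℝ) else 1))| := by
  have h1 : ∀ x, (if F x = true then (-1:ℝ) else 1) * (if H x = true then (-1:ℝ) else 1) =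
      2 * (if F x = H x then 1 else 0) - 1 := by
    intro x
    cases F x <;> cases H x <;> norm_num
  have h2 : avg (fun x => (if F x = true then (-1:ℝ) else 1) * (if H x = true then (-1:ℝ) else 1)) =
      2 * agreePr F H - 1 := by
    rw [avg, agreePr, sum_congr rfl fun x _ => h1 x, sum_sub_distrib, ← mul_sum, card_filter]
    push_cast
    simp
    field_simp
  rw [h2]
  have := le_abs_self (2 * agreePr F H - 1)
  have := abs_nonneg (2 * agreePr F H - 1)
  linarith

theorem size_pos {ι : Type} (C : AC0 ι) : 1 ≤ C.size := by
  cases C <;> simp [AC0.size]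

/-- the full combinatorial bound -/
theorem main_comb {m k u S : ℕ} {s : ℝ} {d : ℕ} (h : (Fin u → Bool) → Bool)
    (Fi : Fin u → (Fin m × Fin (k + 1) × Fin m → Bool) → Bool)
    (hFi : ∀ i, SymOnAC0 s d (Fi i) ∨ ThrOnAC0 s d (Fi i)) (hS : s ≤ S)
    {p p2 lam2 : ℝ} (hp : 0 < p) (hp1 : p < 1) {N0 : ℕ}
    (hw : (1 + 4*p*2/(1-p))^(N0+1) ≤ 2) (hp2 : 0 < p2) (hp21 : p2 < 1) (hlam2 : 1 ≤ lam2)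
    (hw2 : (1 + 4*p2*lam2/(1-p2))^(N0+1) ≤ 2) (q : ℕ) (A a : ℕ → ℕ) (hA : A 0 ≤ m)
    (hA' : ∀ t < d, A (t+1) + q*((N0+2)*(N0+1)) ≤ a t + 1) (hA'' : 1 + q*((k+1)*(N0+1)) ≤ a d + 1) :
    agreePr (fun x => h fun i => Fi i x) (RW m k m) ≤ 1/2 +
      ((∑ t' ∈ range d, ((((u * S : ℕ) : ℝ)*((2:ℝ)⁻¹)^(N0+2))^q + ((m * (k+1) : ℕ) : ℝ) * (2^a t' * (1-p/2)^A t'))) +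
      ((((u * S : ℕ) : ℝ)*(lam2⁻¹)^(k+1))^q + ((m * (k+1) : ℕ) : ℝ) * (2^a d * (1-p2/2)^A d) +
       (2 * ((Wc (k+1) S : ℝ) + 1)) ^ u * th k ^ m)) := by
  have h1 : ∀ i, ∃ (a : ℕ) (g : (Fin a → Bool) → Bool) (C : Fin a → AC0 (Fin m × Fin (k + 1) × Fin m)),
    (IsSymFun g ∨ IsThrFun g) ∧ (∀ i, (C i).depth ≤ d) ∧ (((1 + ∑ i, (C i).size : ℕ) : ℝ) ≤ s) ∧
    ∀ x, Fi i x = g fun i => (C i).eval x := by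
    intro i
    rcases hFi i with ⟨a, g, C, h1, h2⟩ | ⟨a, g, C, h1, h2⟩
    · exact ⟨a, g, C, Or.inl h1, h2⟩
    · exact ⟨a, g, C, Or.inr h1, h2⟩
  choose b g C hg hd hs hF using h1
  have hs' : ∀ i, ∑ c, (C i c).size ≤ S := by
    intro i
    have : ((1 + ∑ c, (C i c).size : ℕ) : ℝ) ≤ (S : ℝ) := (hs i).trans hS
    have : 1 + ∑ c, (C i c).size ≤ S := by exact_mod_cast this
    omega
  have hb : ∀ i, b i ≤ S := by
    intro i
    refine le_trans ?_ (hs' i)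
    calc b i = ∑ c : Fin (b i), 1 := by simp
      _ ≤ _ := sum_le_sum fun c _ => size_pos _
  refine (agree_le _ _).trans ?_
  gcongr
  have hx : (fun x => (if (h fun i => Fi i x) = true then (-1:ℝ) else 1) * (if RW m k m x = true then (-1:ℝ) else 1)) =
    (fun x => (if h (fun i => g i fun c => (C i c).eval x) = true then (-1:ℝ) else 1) *
      (if RW m k m x = true then (-1:ℝ) else 1)) := by
    funext x
    simp only [hF]
  rw [hx]
  have key := circ_full (Jt := Σ i : Fin u, Fin (b i)) (Bk := Fin m × Fin (k+1)) hp hp1 hw hp2 hp21 hlam2 hw2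
    (fun c => C c.1 c.2) d (fun c => hd c.1 c.2)
    (fun x => (if h (fun i => g i fun c => (C i c).eval x) = true then (-1:ℝ) else 1) *
      (if RW m k m x = true then (-1:ℝ) else 1))
    (fun x => by split_ifs <;> simp) q
    (fun v => univ.image fun l : Fin m => (v.1, v.2, l)) A a
    (fun v => by
      rw [card_image_of_injective _ (fun l l' e => by simpa using e)]
      simpa using hA) k hA' hA'' (β := (2 * ((Wc (k+1) S : ℝ) + 1)) ^ u * th k ^ m)
    (mul_nonneg (by positivity) (pow_nonneg (th_nonneg k) _))
    (fun κ h1 h2 => at_kappa κ (fun i j => by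
      obtain ⟨v, hv, hk⟩ := h2 (i, j)
      obtain ⟨l, _, rfl⟩ := mem_image.1 hv
      exact ⟨l, hk⟩) h b g hg hb C (fun i c => h1 ⟨i, c⟩)) (u * S)
    (by
      rw [Fintype.sum_sigma]
      calc _ ≤ ∑ i : Fin u, S := sum_le_sum fun i _ => hs' i
        _ = _ := by simp)
  simpa using key
end CB

set_option linter.unusedSectionVars false

namespace CB
theorem pow_half {X : ℝ} (h0 : 0 ≤ X) (h1 : X ≤ 1/2) (q : ℕ) : X ^ q ≤ Real.exp (-(q/2 : ℝ)) := by
  have h2 : X ≤ Real.exp (-(1/2)) := by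
    have := Real.add_one_le_exp (-(1/2) : ℝ)
    linarith
  calc X ^ q ≤ (Real.exp (-(1/2))) ^ q := by gcongr
    _ = _ := by rw [← Real.exp_nat_mul]; congr 1; ring

theorem conc {p : ℝ} (hp : 0 < p) (hp1 : p < 1) {a A : ℕ} (h : (a : ℝ) ≤ p * A / 4) :
    2 ^ a * (1 - p/2) ^ A ≤ Real.exp (-(a : ℝ)) := by
  have h1 : (2:ℝ) ≤ Real.exp 1 := by
    have := Real.add_one_le_exp (1 : ℝ)
    linarith
  have h2 : 1 - p/2 ≤ Real.exp (-(p/2)) := by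
    have := Real.add_one_le_exp (-(p/2) : ℝ)
    linarith
  calc (2:ℝ) ^ a * (1 - p/2) ^ A ≤ (Real.exp 1) ^ a * (Real.exp (-(p/2))) ^ A := by
        have : 0 ≤ 1 - p/2 := by linarith
        gcongr
    _ = Real.exp (a - p/2*A) := by
        rw [← Real.exp_nat_mul, ← Real.exp_nat_mul, ← Real.exp_add]; congr 1; ring
    _ ≤ _ := by
        apply Real.exp_le_exp.2
        linarith

theorem wt {p lam : ℝ} (hp : 0 < p) (hp1 : p ≤ 1/2) (hl : 0 ≤ lam) {N : ℕ} (hN : 1 ≤ N)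
    (h : p * lam * (16 * N) ≤ 1) : (1 + 4*p*lam/(1-p)) ^ N ≤ 2 := by
  have hN' : (1:ℝ) ≤ N := by exact_mod_cast hN
  have h1 : 4*p*lam/(1-p) ≤ 1/(2*N) := by
    rw [div_le_div_iff₀ (by linarith) (by positivity)]
    nlinarith
  have h0 : 0 ≤ 4*p*lam/(1-p) := div_nonneg (by positivity) (by linarith)
  have h2 : 1 + 4*p*lam/(1-p) ≤ Real.exp (1/(2*N)) := by
    have := Real.add_one_le_exp (1/(2*N) : ℝ)
    linarith
  calc (1 + 4*p*lam/(1-p)) ^ N ≤ (Real.exp (1/(2*N))) ^ N := by gcongr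
    _ = Real.exp (1/2) := by rw [← Real.exp_nat_mul]; congr 1; field_simp
    _ ≤ 2 := by
      have h3 : Real.exp (1/2) * Real.exp (1/2) = Real.exp 1 := by rw [← Real.exp_add]; norm_num
      have := Real.exp_one_lt_d9
      have := Real.exp_pos (1/2)
      nlinarith

theorem th_exp (k m : ℕ) : th k ^ m ≤ Real.exp (-(m * (1/4)^k)) := by
  have h2 : th k ≤ Real.exp (-((1/4)^k)) := by
    have := Real.add_one_le_exp (-((1/4)^k) : ℝ)
    have := th_le k
    linarith
  calc th k ^ m ≤ _ := pow_le_pow_left₀ (th_nonneg k) h2 m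
    _ = _ := by rw [← Real.exp_nat_mul]; congr 1; ring

theorem ev (C ε : ℝ) (hε : 0 < ε) (j : ℕ) :
    ∀ᶠ m : ℕ in Filter.atTop, C * (Real.logb 2 (m:ℝ)) ^ j ≤ (m:ℝ) ^ ε := by
  have h1 := (isLittleO_log_rpow_rpow_atTop (j : ℝ) hε).comp_tendsto tendsto_natCast_atTop_atTop
  have hc : 0 < (|C| / (Real.log 2) ^ j + 1)⁻¹ := by
    have : 0 < Real.log 2 := Real.log_pos (by norm_num)
    positivity
  filter_upwards [h1.bound hc, Filter.eventually_ge_atTop 1] with m hm hm1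
  have hm1' : (1:ℝ) ≤ m := by exact_mod_cast hm1
  simp only [Function.comp, Real.rpow_natCast, Real.norm_eq_abs] at hm
  have hl : 0 ≤ Real.log m := Real.log_nonneg hm1'
  have hl2 : 0 < Real.log 2 := Real.log_pos (by norm_num)
  rw [abs_of_nonneg (a := Real.log m ^ j) (by positivity), abs_of_nonneg (a := (m:ℝ) ^ ε) (by positivity), le_inv_mul_iff₀ (by positivity)] at hm
  rw [Real.logb, div_pow]
  calc C * (Real.log m ^ j / Real.log 2 ^ j) ≤ |C| * (Real.log m ^ j / Real.log 2 ^ j) := by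
        gcongr; exact le_abs_self C
    _ = |C| / Real.log 2 ^ j * Real.log m ^ j := by ring
    _ ≤ (|C| / Real.log 2 ^ j + 1) * Real.log m ^ j := by
        gcongr; linarith
    _ ≤ _ := hm

/-- all largeness conditions -/
structure Big (d m : ℕ) (L : ℝ) : Prop where
  hL : (2:ℝ) ^ L = m
  hL1 : 10^6 ≤ L
  h1 : 32 * L^2 ≤ (m:ℝ)^(0.01:ℝ)
  h2 : 64 * L^4 * (512 * L^2)^d ≤ (m:ℝ)^(0.1:ℝ)
  h3 : 2 * L ≤ (m:ℝ)^(0.001:ℝ)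
  h4 : 4 * (d + 1) ≤ (m:ℝ)
  h5 : 14 * L^2 ≤ (m:ℝ)^(0.5:ℝ)

theorem big_ev (d : ℕ) : ∀ᶠ m : ℕ in Filter.atTop, Big d m (Real.logb 2 m) := by
  have hlog : Filter.Tendsto (fun m : ℕ => Real.logb 2 (m:ℝ)) Filter.atTop Filter.atTop :=
    (Real.tendsto_logb_atTop (by norm_num)).comp tendsto_natCast_atTop_atTop
  filter_upwards [ev 32 0.01 (by norm_num) 2, ev (64 * 512^d) 0.1 (by norm_num) (4 + 2*d),
    ev 2 0.001 (by norm_num) 1, ev 14 0.5 (by norm_num) 2, Filter.eventually_ge_atTop (4 * (d+1)),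
    hlog.eventually_ge_atTop (10^6)] with m h1 h2 h3 h5 h4 h6
  have h4' : 4 * ((d:ℝ) + 1) ≤ m := by exact_mod_cast h4
  refine ⟨Real.rpow_logb (by norm_num) (by norm_num) ?_, h6, h1, ?_, by simpa using h3, h4', h5⟩
  · have : (0:ℝ) ≤ d := by positivity
    linarith
  · calc _ = _ := by ring
      _ ≤ _ := h2
end CB

set_option linter.unusedSectionVars false

namespace CB
section
variable {d m k : ℕ} {L : ℝ}

theorem Big.x1 (hB : Big d m L) : (1:ℝ) ≤ m := by
  rw [← hB.hL]
  exact Real.one_le_rpow (by norm_num) (by linarith [hB.hL1])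

theorem Big.mpow (hB : Big d m L) (e : ℝ) : (m:ℝ) ^ e = (2:ℝ) ^ (e * L) := by
  rw [← hB.hL, ← Real.rpow_mul (by norm_num), mul_comm]

theorem Big.madd (hB : Big d m L) (e f : ℝ) : (m:ℝ) ^ e * (m:ℝ) ^ f = (m:ℝ) ^ (e + f) :=
  (Real.rpow_add (by linarith [hB.x1]) e f).symm

theorem Big.kL (hB : Big d m L) (hk : k = ⌊(0.0005:ℝ) * L⌋₊) :
    (k:ℝ) ≤ 0.0005 * L ∧ 0.0005 * L ≤ (k:ℝ) + 1 ∧ (k:ℝ) + 1 ≤ L ∧ (k:ℝ) + 1 ≤ m := by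
  have hL1 := hB.hL1
  have a1 : (k:ℝ) ≤ 0.0005 * L := by rw [hk]; exact Nat.floor_le (by linarith)
  have a2 : 0.0005 * L ≤ (k:ℝ) + 1 := by rw [hk]; exact (Nat.lt_floor_add_one _).le
  refine ⟨a1, a2, by linarith, ?_⟩
  have h3 := hB.h3
  have : (m:ℝ) ^ (0.001:ℝ) ≤ (m:ℝ) ^ (1:ℝ) := Real.rpow_le_rpow_of_exponent_le hB.x1 (by norm_num)
  rw [Real.rpow_one] at this
  linarith

/-- bound on `n ^ 0.249` -/
theorem Big.nU (hB : Big d m L) (hk : k = ⌊(0.0005:ℝ) * L⌋₊) :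
    ((m * (k+1) * m : ℕ) : ℝ) ^ (0.249:ℝ) ≤ (m:ℝ) ^ (0.499:ℝ) := by
  obtain ⟨a1, a2, a3, a4⟩ := hB.kL hk
  have hx := hB.x1
  have hL1 := hB.hL1
  have hk1 : (1:ℝ) ≤ (k:ℝ) + 1 := by linarith [(Nat.cast_nonneg k : (0:ℝ) ≤ k)]
  push_cast
  have e : (m:ℝ) * ((k:ℝ) + 1) * m = (m:ℝ)^(2:ℝ) * ((k:ℝ)+1) := by
    rw [show (2:ℝ) = ((2:ℕ):ℝ) by norm_num, Real.rpow_natCast]; ring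
  rw [e, Real.mul_rpow (by positivity) (by positivity), ← Real.rpow_mul (by positivity)]
  have h1 : ((k:ℝ)+1) ^ (0.249:ℝ) ≤ (m:ℝ) ^ (0.001:ℝ) := by
    calc ((k:ℝ)+1) ^ (0.249:ℝ) ≤ ((k:ℝ)+1) ^ (1:ℝ) := Real.rpow_le_rpow_of_exponent_le hk1 (by norm_num)
      _ ≤ _ := by rw [Real.rpow_one]; linarith [hB.h3]
  calc _ ≤ (m:ℝ) ^ ((2:ℝ) * 0.249) * (m:ℝ) ^ (0.001:ℝ) := by gcongr
    _ = _ := by rw [hB.madd]; norm_num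

theorem Big.sS (hB : Big d m L) (hk : k = ⌊(0.0005:ℝ) * L⌋₊) {s : ℝ}
    (hs : s = ((m * (k+1) * m : ℕ) : ℝ) ^ ((0.000001:ℝ) * Real.logb 2 ((m * (k+1) * m : ℕ) : ℝ))) :
    (⌈s⌉₊ : ℝ) ≤ 2 ^ ((0.00001:ℝ) * L^2 + 1) := by
  obtain ⟨a1, a2, a3, a4⟩ := hB.kL hk
  have hx := hB.x1
  have hL1 := hB.hL1
  set n : ℝ := ((m * (k+1) * m : ℕ) : ℝ) with hn
  have hn1 : 1 ≤ n := by
    rw [hn]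
    have : 1 ≤ m * (k+1) * m := by
      have : 1 ≤ m := by exact_mod_cast hx
      exact Nat.mul_pos (Nat.mul_pos this (Nat.succ_pos k)) this
    exact_mod_cast this
  have hn3 : n ≤ (2:ℝ) ^ (3 * L) := by
    rw [← hB.mpow, show (3:ℝ) = ((3:ℕ):ℝ) by norm_num, Real.rpow_natCast, hn]
    push_cast
    calc (m:ℝ) * ((k:ℝ)+1) * m ≤ m * m * m := by gcongr
      _ = _ := by ring
  have hl3 : Real.logb 2 n ≤ 3 * L := by
    rw [Real.logb_le_iff_le_rpow (by norm_num) (by linarith)]; exact hn3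
  have hl0 : 0 ≤ Real.logb 2 n := Real.logb_nonneg (by norm_num) hn1
  have hs1 : s ≤ 2 ^ ((0.00001:ℝ) * L^2) := by
    rw [hs]
    calc n ^ ((0.000001:ℝ) * Real.logb 2 n) ≤ ((2:ℝ) ^ (3*L)) ^ ((0.000001:ℝ) * Real.logb 2 n) := by
          apply Real.rpow_le_rpow (by linarith) hn3; positivity
      _ = (2:ℝ) ^ (3*L * ((0.000001:ℝ) * Real.logb 2 n)) := by rw [← Real.rpow_mul (by norm_num)]
      _ ≤ _ := by
          apply Real.rpow_le_rpow_of_exponent_le (by norm_num)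
          nlinarith
  have hs0 : 1 ≤ (2:ℝ) ^ ((0.00001:ℝ) * L^2) := Real.one_le_rpow (by norm_num) (by positivity)
  have hs2 : 0 ≤ s := by rw [hs]; positivity
  have := (Nat.ceil_lt_add_one hs2).le
  rw [Real.rpow_add (by norm_num), Real.rpow_one]
  linarith

theorem rpow2_half {e : ℝ} (h : e ≤ -1) : (2:ℝ) ^ e ≤ 1/2 := by
  calc (2:ℝ) ^ e ≤ 2 ^ (-1:ℝ) := Real.rpow_le_rpow_of_exponent_le (by norm_num) h
    _ = _ := by rw [Real.rpow_neg_one]; norm_num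

theorem Big.X1 (hB : Big d m L) {u S N : ℕ} (hu : u ≤ m) (hS : (S:ℝ) ≤ 2 ^ ((0.00001:ℝ) * L^2 + 1))
    (hN : L^2 ≤ N) : ((u * S : ℕ) : ℝ)*((2:ℝ)⁻¹)^(N+1) ≤ 1/2 := by
  have hu' : (u:ℝ) ≤ 2^L := by rw [hB.hL]; exact_mod_cast hu
  have hL1 := hB.hL1
  have h1 : ((2:ℝ)⁻¹)^(N+1) = 2 ^ (-((N:ℝ)+1)) := by
    rw [Real.rpow_neg (by norm_num), inv_pow]; congr 1; exact_mod_cast (Real.rpow_natCast 2 (N+1)).symm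
  rw [h1]
  push_cast
  calc (u:ℝ) * S * 2 ^ (-((N:ℝ)+1)) ≤ 2^L * 2 ^ ((0.00001:ℝ) * L^2 + 1) * 2 ^ (-((N:ℝ)+1)) := by gcongr
    _ = 2 ^ (L + ((0.00001:ℝ) * L^2 + 1) + -((N:ℝ)+1)) := by
      rw [Real.rpow_add (by norm_num) (L + _), Real.rpow_add (by norm_num) L]
    _ ≤ _ := rpow2_half (by nlinarith)

theorem Big.X2 (hB : Big d m L) (hk : k = ⌊(0.0005:ℝ) * L⌋₊) {u S : ℕ} (hu : u ≤ m)
    (hS : (S:ℝ) ≤ 2 ^ ((0.00001:ℝ) * L^2 + 1)) {lam : ℝ} (hlam : (m:ℝ)^(0.39:ℝ) ≤ lam) :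
    ((u * S : ℕ) : ℝ)*(lam⁻¹)^(k+1) ≤ 1/2 := by
  obtain ⟨a1, a2, a3, a4⟩ := hB.kL hk
  have hu' : (u:ℝ) ≤ 2^L := by rw [hB.hL]; exact_mod_cast hu
  have hL1 := hB.hL1
  have h0 : 0 < (m:ℝ)^(0.39:ℝ) := by rw [hB.mpow]; positivity
  have hli : 0 ≤ lam⁻¹ := inv_nonneg.2 (by linarith)
  have h1 : (lam⁻¹)^(k+1) ≤ 2 ^ (-(0.39 * L * ((k:ℝ)+1))) := by
    calc (lam⁻¹)^(k+1) ≤ (((m:ℝ)^(0.39:ℝ))⁻¹)^(k+1) := by gcongr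
      _ = _ := by
        rw [hB.mpow, ← Real.rpow_neg (by norm_num), ← Real.rpow_natCast, ← Real.rpow_mul (by norm_num)]
        congr 1; push_cast; ring
  push_cast
  calc (u:ℝ) * S * (lam⁻¹)^(k+1) ≤ 2^L * 2 ^ ((0.00001:ℝ) * L^2 + 1) * 2 ^ (-(0.39 * L * ((k:ℝ)+1))) := by
        have : 0 ≤ lam := by linarith
        gcongr
    _ = 2 ^ (L + ((0.00001:ℝ) * L^2 + 1) + -(0.39 * L * ((k:ℝ)+1))) := by
      rw [Real.rpow_add (by norm_num) (L + _), Real.rpow_add (by norm_num) L]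
    _ ≤ _ := rpow2_half (by
      have : 0.39 * L * (0.0005 * L) ≤ 0.39 * L * ((k:ℝ)+1) := by gcongr
      nlinarith)

theorem Big.beta (hB : Big d m L) (hk : k = ⌊(0.0005:ℝ) * L⌋₊) {u S : ℕ} (hu : (u:ℝ) ≤ (m:ℝ)^(0.499:ℝ))
    (hS : (S:ℝ) ≤ 2 ^ ((0.00001:ℝ) * L^2 + 1)) (hS1 : 1 ≤ S) :
    (2 * ((Wc (k+1) S : ℝ) + 1)) ^ u * th k ^ m ≤ Real.exp (-((m:ℝ)^(0.499:ℝ))) / 2 := by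
  obtain ⟨a1, a2, a3, a4⟩ := hB.kL hk
  have hL1 := hB.hL1
  have hS1' : (1:ℝ) ≤ S := by exact_mod_cast hS1
  have hW : 2 * ((Wc (k+1) S : ℝ) + 1) ≤ 128 * ((k:ℝ)+1)^3 * S^2 := by
    have hN : 2 * (Wc (k+1) S + 1) ≤ 128 * (k+1)^3 * S^2 := by
      rw [Wc]
      have b1 : k + 1 + 2 ≤ 3 * (k+1) := by omega
      have b2 : S + 1 ≤ 2 * S := by omega
      have b3 : S + 4 ≤ 5 * S := by omega
      have b4 : k + 1 + 1 ≤ 2 * (k+1) := by omega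
      have b5 : 1 ≤ (k+1)^3 * S^2 := Nat.mul_pos (by positivity) (by positivity)
      calc 2 * (1 + (k + 1 + 2) * ((S + 1) * (S + 4)) * ((k + 1) * (k + 1 + 1)) + 1)
          ≤ 2 * (1 + (3 * (k+1)) * ((2*S) * (5*S)) * ((k + 1) * (2*(k+1))) + 1) := by gcongr
        _ = 4 + 120 * ((k+1)^3 * S^2) := by ring
        _ ≤ 128 * ((k+1)^3 * S^2) := by omega
        _ = _ := by ring
    exact_mod_cast hN
  have hW2 : 128 * ((k:ℝ)+1)^3 * S^2 ≤ Real.exp (12 * L^2) := by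
    have e1 : (k:ℝ) + 1 ≤ 2 ^ L := by rw [hB.hL]; exact a4
    have e2 : (S:ℝ) ≤ 2 ^ (L^2) := hS.trans (Real.rpow_le_rpow_of_exponent_le (by norm_num) (by nlinarith))
    calc 128 * ((k:ℝ)+1)^3 * S^2 ≤ 128 * (2 ^ L)^3 * (2 ^ (L^2))^2 := by gcongr
      _ = (2:ℝ) ^ (7 + L * 3 + L^2 * 2) := by
        rw [Real.rpow_add (by norm_num), Real.rpow_add (by norm_num), Real.rpow_mul (by norm_num),
          Real.rpow_mul (by norm_num)]
        norm_cast
      _ ≤ (2:ℝ) ^ (12 * L^2) := Real.rpow_le_rpow_of_exponent_le (by norm_num) (by nlinarith)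
      _ ≤ (Real.exp 1) ^ (12 * L^2) := by
        apply Real.rpow_le_rpow (by norm_num) _ (by positivity)
        linarith [Real.add_one_le_exp (1:ℝ)]
      _ = _ := by rw [← Real.exp_mul, one_mul]
  have h4 : (m:ℝ)^(0.999:ℝ) ≤ m * (1/4:ℝ)^k := by
    have : (m:ℝ) ^ (-0.001:ℝ) ≤ (1/4:ℝ)^k := by
      rw [hB.mpow, show (1/4:ℝ) = 2 ^ (-2:ℝ) by rw [Real.rpow_neg (by norm_num)]; norm_num,
        ← Real.rpow_natCast, ← Real.rpow_mul (by norm_num)]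
      exact Real.rpow_le_rpow_of_exponent_le (by norm_num) (by linarith)
    calc (m:ℝ)^(0.999:ℝ) = (m:ℝ)^(1:ℝ) * (m:ℝ) ^ (-0.001:ℝ) := by rw [hB.madd]; norm_num
      _ ≤ _ := by rw [Real.rpow_one]; gcongr
  have hx := hB.x1
  have hu0 : 1 ≤ (m:ℝ)^(0.499:ℝ) := Real.one_le_rpow hx (by norm_num)
  have h5 : (m:ℝ)^(0.499:ℝ) * (14 * L^2) ≤ (m:ℝ)^(0.999:ℝ) := by
    calc _ ≤ (m:ℝ)^(0.499:ℝ) * (m:ℝ)^(0.5:ℝ) := by gcongr; exact hB.h5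
      _ = _ := by rw [hB.madd]; norm_num
  have hhalf : Real.exp (-1) ≤ 1/2 := by
    rw [Real.exp_neg, one_div]
    gcongr
    linarith [Real.add_one_le_exp (1:ℝ)]
  calc (2 * ((Wc (k+1) S : ℝ) + 1)) ^ u * th k ^ m
      ≤ (Real.exp (12 * L^2)) ^ u * Real.exp (-(m * (1/4)^k)) := by
        gcongr
        · exact pow_nonneg (th_nonneg k) m
        · exact hW.trans hW2
        · exact th_exp k m
    _ = Real.exp (u * (12 * L^2) - m * (1/4)^k) := by
        rw [← Real.exp_nat_mul, ← Real.exp_add]; congr 1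
    _ ≤ Real.exp (-((m:ℝ)^(0.499:ℝ)) + -1) := by
        apply Real.exp_le_exp.2
        have : (u:ℝ) * (12 * L^2) ≤ (m:ℝ)^(0.499:ℝ) * (12 * L^2) := by gcongr
        have : (m:ℝ)^(0.499:ℝ) * 1 ≤ (m:ℝ)^(0.499:ℝ) * L^2 := by gcongr; nlinarith
        linarith
    _ = Real.exp (-((m:ℝ)^(0.499:ℝ))) * Real.exp (-1) := Real.exp_add _ _
    _ ≤ Real.exp (-((m:ℝ)^(0.499:ℝ))) * (1/2) := by gcongr
    _ = _ := by ring

theorem Big.tail (hB : Big d m L) :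
    (d + 1 : ℝ) * ((1 + (m:ℝ)^2) * Real.exp (-((m:ℝ)^(0.5:ℝ)/2))) ≤ Real.exp (-((m:ℝ)^(0.499:ℝ))) / 2 := by
  have hL1 := hB.hL1
  have hx := hB.x1
  have h1 : (m:ℝ)^(0.499:ℝ) * 4 ≤ (m:ℝ)^(0.5:ℝ) := by
    calc _ ≤ (m:ℝ)^(0.499:ℝ) * (m:ℝ)^(0.001:ℝ) := by gcongr; linarith [hB.h3]
      _ = _ := by rw [hB.madd]; norm_num
  have h2 : (m:ℝ)^3 ≤ Real.exp ((m:ℝ)^(0.5:ℝ)/4) := by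
    calc (m:ℝ)^3 = (2:ℝ) ^ (L * 3) := by rw [← hB.hL, Real.rpow_mul (by norm_num)]; norm_cast
      _ ≤ (Real.exp 1) ^ (L * 3) := by
        apply Real.rpow_le_rpow (by norm_num) _ (by positivity)
        linarith [Real.add_one_le_exp (1:ℝ)]
      _ = Real.exp (L*3) := by rw [← Real.exp_mul, one_mul]
      _ ≤ _ := by
        apply Real.exp_le_exp.2
        have := hB.h5
        nlinarith
  have h3 : (d + 1 : ℝ) * (1 + (m:ℝ)^2) ≤ (m:ℝ)^3 / 2 := by
    have := hB.h4
    have : (1:ℝ) ≤ (m:ℝ)^2 := one_le_pow₀ hx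
    have : (d + 1 : ℝ) ≤ m / 4 := by linarith
    calc (d + 1 : ℝ) * (1 + (m:ℝ)^2) ≤ (m/4) * (2 * (m:ℝ)^2) := by gcongr; linarith
      _ = _ := by ring
  calc (d + 1 : ℝ) * ((1 + (m:ℝ)^2) * Real.exp (-((m:ℝ)^(0.5:ℝ)/2)))
      = ((d + 1 : ℝ) * (1 + (m:ℝ)^2)) * Real.exp (-((m:ℝ)^(0.5:ℝ)/2)) := by ring
    _ ≤ (Real.exp ((m:ℝ)^(0.5:ℝ)/4) / 2) * Real.exp (-((m:ℝ)^(0.5:ℝ)/2)) := by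
      gcongr; linarith
    _ = Real.exp ((m:ℝ)^(0.5:ℝ)/4 + -((m:ℝ)^(0.5:ℝ)/2)) / 2 := by rw [Real.exp_add]; ring
    _ ≤ _ := by
      gcongr
      linarith
end
end CB

set_option linter.unusedSectionVars false

namespace CB
set_option maxHeartbeats 1000000 in
theorem main_num {d m k u : ℕ} {L : ℝ} (hB : Big d m L) (hk : k = ⌊(0.0005:ℝ) * L⌋₊)
    (hu : (u:ℝ) ≤ ((m * (k+1) * m : ℕ) : ℝ) ^ (0.249:ℝ)) {s : ℝ}
    (hs : s = ((m * (k+1) * m : ℕ) : ℝ) ^ ((0.000001:ℝ) * Real.logb 2 ((m * (k+1) * m : ℕ) : ℝ)))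
    (h : (Fin u → Bool) → Bool)
    (Fi : Fin u → (Fin m × Fin (k + 1) × Fin m → Bool) → Bool)
    (hFi : ∀ i, SymOnAC0 s d (Fi i) ∨ ThrOnAC0 s d (Fi i)) :
    agreePr (fun x => h fun i => Fi i x) (RW m k m) ≤
      1/2 + Real.exp (-(((m * (k+1) * m : ℕ) : ℝ) ^ (0.249:ℝ))) := by
  obtain ⟨a1, a2, a3, a4⟩ := hB.kL hk
  have hL1 := hB.hL1
  have hx := hB.x1
  have hU := hB.nU hk
  have hS := hB.sS hk hs
  have hu1 : (u:ℝ) ≤ (m:ℝ)^(0.499:ℝ) := hu.trans hU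
  have hum : u ≤ m := by
    have : (m:ℝ)^(0.499:ℝ) ≤ (m:ℝ)^(1:ℝ) := Real.rpow_le_rpow_of_exponent_le hx (by norm_num)
    rw [Real.rpow_one] at this
    exact_mod_cast hu1.trans this
  have hL2 : (1:ℝ) ≤ L^2 := by nlinarith
  have hS1 : 1 ≤ ⌈s⌉₊ := by
    rw [Nat.one_le_ceil_iff, hs]
    have : (0:ℝ) < ((m * (k+1) * m : ℕ) : ℝ) := by push_cast; positivity
    positivity
  obtain ⟨N0, hN0⟩ : ∃ N0, ⌈L^2⌉₊ = N0 + 1 :=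
    ⟨⌈L^2⌉₊ - 1, by have := Nat.ceil_pos.2 (show (0:ℝ) < L^2 by linarith); omega⟩
  have hNl : L^2 ≤ ((N0 + 1 : ℕ) : ℝ) := by rw [← hN0]; exact Nat.le_ceil _
  have hNu : ((N0 + 1 : ℕ) : ℝ) ≤ 2 * L^2 := by
    rw [← hN0]
    have := (Nat.ceil_lt_add_one (show (0:ℝ) ≤ L^2 by linarith)).le
    linarith
  set N : ℕ := N0 + 1 with hN
  clear_value N
  have hN1 : 1 ≤ N := by omega
  have hN1' : (1:ℝ) ≤ N := by exact_mod_cast hN1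
  set q : ℕ := ⌈(m:ℝ)^(0.5:ℝ)⌉₊ with hq
  have hql : (m:ℝ)^(0.5:ℝ) ≤ q := Nat.le_ceil _
  have hm5 : 1 ≤ (m:ℝ)^(0.5:ℝ) := Real.one_le_rpow hx (by norm_num)
  have hqu : (q:ℝ) ≤ 2 * (m:ℝ)^(0.5:ℝ) := by
    have := (Nat.ceil_lt_add_one (show (0:ℝ) ≤ (m:ℝ)^(0.5:ℝ) by linarith)).le
    rw [← hq] at this
    linarith
  clear_value q
  set D : ℕ := 256 * N with hD
  clear_value D
  have hD0 : 0 < D := by omega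
  have hDu : (D:ℝ) ≤ 512 * L^2 := by rw [hD]; push_cast; linarith
  have hDd : (D:ℝ)^d ≤ (512 * L^2)^d := by gcongr
  have hDd1 : (1:ℝ) ≤ (D:ℝ)^d := one_le_pow₀ (by exact_mod_cast hD0)
  have hP : 64 * L^4 * (D:ℝ)^d ≤ (m:ℝ)^(0.1:ℝ) := le_trans (by gcongr) hB.h2
  have hL4 : (1:ℝ) ≤ L^4 := one_le_pow₀ (by linarith)
  -- the key sizes
  have hDm : (D:ℝ)^d * 2 ≤ m := by
    have : (m:ℝ)^(0.1:ℝ) ≤ (m:ℝ)^(1:ℝ) := Real.rpow_le_rpow_of_exponent_le hx (by norm_num)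
    rw [Real.rpow_one] at this
    have h64 : 2 * (D:ℝ)^d ≤ 64 * L^4 * (D:ℝ)^d := by gcongr; linarith
    linarith
  have hAd : (m:ℝ) / (2 * (D:ℝ)^d) ≤ ((m / D^d : ℕ) : ℝ) := by
    have h1 : m < (m / D^d + 1) * D^d := by
      have := Nat.lt_mul_div_succ m (pow_pos hD0 d)
      rw [mul_comm]; exact this
    have h2 : 1 ≤ m / D^d := by
      rw [Nat.one_le_div_iff (pow_pos hD0 d)]
      have : (D:ℝ)^d ≤ m := by linarith
      exact_mod_cast this
    have h3 : m ≤ (m / D^d) * (2 * D^d) := by nlinarith [pow_pos hD0 d]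
    rw [div_le_iff₀ (by positivity)]
    exact_mod_cast h3
  have hp0 : (0:ℝ) < 1/(32*N) := by positivity
  have hp1 : (1:ℝ)/(32*N) ≤ 1/2 := by
    apply one_div_le_one_div_of_le <;> linarith
  set p2 : ℝ := (m:ℝ)^(-0.4:ℝ) with hp2
  have hp20 : 0 < p2 := by rw [hp2]; positivity
  have h16 : 16 * (N:ℝ) ≤ (m:ℝ)^(0.01:ℝ) := by linarith [hB.h1]
  have hp21 : p2 ≤ 1/2 := by
    rw [hp2, hB.mpow]
    exact rpow2_half (by linarith)
  set lam : ℝ := (m:ℝ)^(0.4:ℝ) / (16 * N) with hlam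
  have hpl : p2 * (m:ℝ)^(0.4:ℝ) = 1 := by
    rw [hp2, hB.madd]; norm_num
  have hlaml : (m:ℝ)^(0.39:ℝ) ≤ lam := by
    rw [hlam, le_div_iff₀ (by positivity)]
    calc _ ≤ (m:ℝ)^(0.39:ℝ) * (m:ℝ)^(0.01:ℝ) := by gcongr
      _ = _ := by rw [hB.madd]; norm_num
  have hlam' : p2 * lam * (16 * N) = 1 := by
    rw [← hpl, hlam]; field_simp
  have hlam1 : 1 ≤ lam := le_trans (Real.one_le_rpow hx (by norm_num)) hlaml
  clear_value lam
  -- final star count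
  have hfin : (q:ℝ) * ((k+1) * N) ≤ p2 * ((m / D^d : ℕ) : ℝ) / 4 := by
    have e1 : (q:ℝ) * ((k+1) * N) * (8 * (D:ℝ)^d) ≤ p2 * m := by
      calc (q:ℝ) * ((k+1) * N) * (8 * (D:ℝ)^d) ≤ (2 * (m:ℝ)^(0.5:ℝ)) * (L * (2 * L^2)) * (8 * (D:ℝ)^d) := by gcongr
        _ = (m:ℝ)^(0.5:ℝ) * (32 * L^3 * (D:ℝ)^d) := by ring
        _ ≤ (m:ℝ)^(0.5:ℝ) * (64 * L^4 * (D:ℝ)^d) := by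
          gcongr 
          · norm_num
          · linarith
          · norm_num
        _ ≤ (m:ℝ)^(0.5:ℝ) * (m:ℝ)^(0.1:ℝ) := by gcongr
        _ = p2 * (m:ℝ)^(1:ℝ) := by rw [hp2, hB.madd, hB.madd]; norm_num
        _ = _ := by rw [Real.rpow_one]
    calc (q:ℝ) * ((k+1) * N) = (q:ℝ) * ((k+1) * N) * (8 * (D:ℝ)^d) / (8 * (D:ℝ)^d) := by field_simp
      _ ≤ p2 * m / (8 * (D:ℝ)^d) := by gcongr
      _ = p2 * (m / (2 * (D:ℝ)^d)) / 4 := by field_simp; norm_num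
      _ ≤ _ := by gcongr
  have hmid : q * ((N + 1) * N) ≤ m / D^d := by
    have e1 : (q:ℝ) * ((N + 1) * N) ≤ ((m / D^d : ℕ) : ℝ) := by
      refine le_trans ?_ hAd
      rw [le_div_iff₀ (by positivity)]
      calc (q:ℝ) * ((N+1) * N) * (2 * (D:ℝ)^d) ≤ (2 * (m:ℝ)^(0.5:ℝ)) * ((2*L^2 + 1*L^2) * (2 * L^2)) * (2 * (D:ℝ)^d) := by
            gcongr; linarith
        _ = (m:ℝ)^(0.5:ℝ) * (24 * L^4 * (D:ℝ)^d) := by ring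
        _ ≤ (m:ℝ)^(0.5:ℝ) * (64 * L^4 * (D:ℝ)^d) := by gcongr; norm_num
        _ ≤ (m:ℝ)^(0.5:ℝ) * (m:ℝ)^(0.1:ℝ) := by gcongr
        _ = (m:ℝ)^(0.6:ℝ) := by rw [hB.madd]; norm_num
        _ ≤ (m:ℝ)^(1:ℝ) := Real.rpow_le_rpow_of_exponent_le hx (by norm_num)
        _ = _ := by rw [Real.rpow_one]
    exact_mod_cast e1
  set A : ℕ → ℕ := fun t => m / D^t with hA
  set a : ℕ → ℕ := fun t => if t < d then A t / (128 * N) else ⌊p2 * A d / 4⌋₊ with ha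
  have hA0 : A 0 ≤ m := by simp [hA]
  have had : a d = ⌊p2 * A d / 4⌋₊ := by simp [ha]
  have hat : ∀ t < d, a t = A t / (128 * N) := fun t ht => by simp [ha, ht]
  have hstep : ∀ t < d, A (t+1) + q*((N+1)*N) ≤ a t := by
    intro t ht
    rw [hat t ht]
    have b1 : A (t+1) = A t / (128 * N) / 2 := by
      simp only [hA]
      rw [Nat.div_div_eq_div_mul, Nat.div_div_eq_div_mul, pow_succ, hD]
      congr 1; ring
    have b2 : A d ≤ A (t+1) := Nat.div_le_div_left (Nat.pow_le_pow_right hD0 ht) (by positivity)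
    have b3 : q * ((N + 1) * N) ≤ A (t+1) := hmid.trans b2
    omega
  have hlast : q*((k+1)*N) ≤ a d := by
    rw [had]
    apply Nat.le_floor
    push_cast
    exact hfin
  clear_value a A p2
  have main := main_comb h Fi hFi (Nat.le_ceil s) hp0 (lt_of_le_of_lt hp1 (by norm_num)) (N0 := N0)
    (by
      rw [← hN]
      apply wt hp0 hp1 (by norm_num) hN1
      apply le_of_eq; field_simp; norm_num) hp20 (lt_of_le_of_lt hp21 (by norm_num)) hlam1
    (by
      rw [← hN]
      apply wt hp20 hp21 (by linarith) hN1
      exact hlam'.le) q A a hA0 (fun t ht => by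
        have := hstep t ht
        rw [show N0 + 2 = N + 1 by omega, ← hN]
        omega) (by rw [← hN]; omega)
  refine main.trans ?_
  have hmk : ((m * (k+1) : ℕ) : ℝ) ≤ (m:ℝ)^2 := by
    push_cast
    rw [sq]; gcongr
  have hq0 : (0:ℝ) ≤ q := by positivity
  have bnd : ∀ X Z : ℝ, 0 ≤ X → X ≤ 1/2 → ∀ e : ℕ, q ≤ e → Z ≤ Real.exp (-(e:ℝ)) →
      X ^ q + ((m * (k+1) : ℕ) : ℝ) * Z ≤ (1 + (m:ℝ)^2) * Real.exp (-((m:ℝ)^(0.5:ℝ)/2)) := by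
    intro X Z hX0 hX e he hZ
    have he' : (q:ℝ) ≤ e := by exact_mod_cast he
    have c1 : X ^ q ≤ Real.exp (-((m:ℝ)^(0.5:ℝ)/2)) :=
      (pow_half hX0 hX q).trans (Real.exp_le_exp.2 (by linarith))
    have c2 : Z ≤ Real.exp (-((m:ℝ)^(0.5:ℝ)/2)) := hZ.trans (Real.exp_le_exp.2 (by linarith))
    calc _ ≤ Real.exp (-((m:ℝ)^(0.5:ℝ)/2)) + (m:ℝ)^2 * Real.exp (-((m:ℝ)^(0.5:ℝ)/2)) := by
          refine add_le_add c1 ?_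
          calc ((m * (k+1) : ℕ) : ℝ) * Z ≤ ((m * (k+1) : ℕ) : ℝ) * Real.exp (-((m:ℝ)^(0.5:ℝ)/2)) := by gcongr
            _ ≤ _ := by gcongr
      _ = _ := by ring
  have hX1 := hB.X1 hum hS (N := N) hNl
  rw [show N + 1 = N0 + 2 by omega] at hX1
  have hX2 := hB.X2 hk hum hS hlaml
  have hβ := hB.beta hk hu1 hS hS1
  have htail := hB.tail
  have s1 : ∀ t ∈ range d, ((((u * ⌈s⌉₊ : ℕ) : ℝ)*((2:ℝ)⁻¹)^(N0+2))^q +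
      ((m * (k+1) : ℕ) : ℝ) * (2^a t * (1-1/(32*(N:ℝ))/2)^A t)) ≤
      (1 + (m:ℝ)^2) * Real.exp (-((m:ℝ)^(0.5:ℝ)/2)) := by
    intro t ht
    have ht := mem_range.1 ht
    have hqa : q ≤ a t := by
      have := hstep t ht
      have : q * 1 ≤ q * ((N+1)*N) := Nat.mul_le_mul_left _ (Nat.mul_pos (by omega) (by omega))
      omega
    refine bnd _ _ (by positivity) hX1 (a t) hqa (conc hp0 (lt_of_le_of_lt hp1 (by norm_num)) ?_)
    rw [hat t ht]
    calc ((A t / (128 * N) : ℕ) : ℝ) ≤ (A t : ℝ) / ((128 * N : ℕ) : ℝ) := Nat.cast_div_le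
      _ = _ := by push_cast; field_simp; ring
  have s2 : ((((u * ⌈s⌉₊ : ℕ) : ℝ)*(lam⁻¹)^(k+1))^q + ((m * (k+1) : ℕ) : ℝ) * (2^a d * (1-p2/2)^A d)) ≤
      (1 + (m:ℝ)^2) * Real.exp (-((m:ℝ)^(0.5:ℝ)/2)) := by
    have hqa : q ≤ a d := by
      have : q * 1 ≤ q * ((k+1)*N) := Nat.mul_le_mul_left _ (Nat.mul_pos (by omega) (by omega))
      omega
    refine bnd _ _ (by positivity) hX2 (a d) hqa (conc hp20 (lt_of_le_of_lt hp21 (by norm_num)) ?_)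
    rw [had]
    exact Nat.floor_le (by positivity)
  have s3 := sum_le_sum s1
  rw [sum_const, card_range, nsmul_eq_mul] at s3
  have s4 : Real.exp (-((m:ℝ)^(0.499:ℝ))) ≤ Real.exp (-(((m * (k+1) * m : ℕ) : ℝ) ^ (0.249:ℝ))) :=
    Real.exp_le_exp.2 (by linarith)
  have : (d + 1 : ℝ) * ((1 + (m:ℝ)^2) * Real.exp (-((m:ℝ)^(0.5:ℝ)/2))) = 
    d * ((1 + (m:ℝ)^2) * Real.exp (-((m:ℝ)^(0.5:ℝ)/2))) + ((1 + (m:ℝ)^2) * Real.exp (-((m:ℝ)^(0.5:ℝ)/2))) := by ring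
  linarith
end CB


/-- **Theorem B.3 (correlation bound against ANY∘{SYM,THR}∘AC⁰ circuits).**
There are absolute constants `τ, c > 0` such that for every depth `d`, for all
sufficiently large `n = m(k+1)r` (`m = r`, `k = ⌊0.0005·log₂ m⌋`), with
`u = ⌊n^{0.249}⌋` and `s = n^{τ·log₂ n}`, every `F = h(F_1,…,F_u)` with each
`F_i` a `{SYM,THR}∘AC⁰_d` circuit of size at most `s` agrees with `RW_{m,k,r}`
on at most a `1/2 + exp(-c·n^{0.249})` fraction of inputs. -/
theorem correlation_bound_any_sym_thr :
    ∃ τ c : ℝ, 0 < τ ∧ 0 < c ∧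
      ∀ d : ℕ, ∃ n₀ : ℕ, ∀ m k r n : ℕ,
        n₀ ≤ n → m = r → k = ⌊(0.0005 : ℝ) * Real.logb 2 (m : ℝ)⌋₊ →
        n = m * (k + 1) * r →
        ∀ u : ℕ, u = ⌊(n : ℝ) ^ (0.249 : ℝ)⌋₊ →
        ∀ s : ℝ, s = (n : ℝ) ^ (τ * Real.logb 2 (n : ℝ)) →
        ∀ (h : (Fin u → Bool) → Bool)
          (Fi : Fin u → (Fin m × Fin (k + 1) × Fin r → Bool) → Bool),
          (∀ i, SymOnAC0 s d (Fi i) ∨ ThrOnAC0 s d (Fi i)) →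
          agreePr (fun x => h fun i => Fi i x) (RW m k r) ≤
            1 / 2 + Real.exp (-(c * (n : ℝ) ^ (0.249 : ℝ))) := by
  refine ⟨0.000001, 1, by norm_num, by norm_num, fun d => ?_⟩
  obtain ⟨M, hM⟩ := Filter.eventually_atTop.1 (CB.big_ev d)
  refine ⟨∑ m ∈ Finset.range M, m * (⌊(0.0005 : ℝ) * Real.logb 2 (m : ℝ)⌋₊ + 1) * m + 1, ?_⟩
  intro m k r n hn hmr hk hnm u hu s hs h Fi hFi
  subst hmr
  have hmM : M ≤ m := by
    by_contra hlt
    have := Finset.single_le_sum (f := fun m : ℕ => m * (⌊(0.0005 : ℝ) * Real.logb 2 (m : ℝ)⌋₊ + 1) * m)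
      (fun i _ => Nat.zero_le _) (Finset.mem_range.2 (not_le.1 hlt))
    simp only [← hk, ← hnm] at this
    omega
  subst hnm
  rw [one_mul]
  refine CB.main_num (hM m hmM) hk ?_ hs h Fi hFi
  rw [hu]
  exact Nat.floor_le (by positivity)
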